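/- Let n ≥ 3 and let Γ ≤ SL(n,ℤ) be a finite-index subgroup. Then for every r with 2 < r ≤ ∞, and also for r = ω (real-analytic), there exists an uncountable family of C^r actions of Γ on the n-torus 𝕋ⁿ = ℝⁿ/ℤⁿ such that no two distinct actions in the family are C¹-conjugate. -/

import Mathlib

open Matrix ContDiff

/-- The `n`-torus `𝕋ⁿ = ℝⁿ/ℤⁿ`, as a product of copies of `ℝ/ℤ`. -/
abbrev Torus (n : ℕ) : Type := Fin n → AddCircle (1 : ℝ)

/-- The canonical projection `ℝⁿ → 𝕋ⁿ`. -/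
noncomputable def torusProj (n : ℕ) (x : Fin n → ℝ) : Torus n := fun i => (x i : AddCircle (1 : ℝ))

/-- `F : ℝⁿ → ℝⁿ` is a lift of `φ : 𝕋ⁿ → 𝕋ⁿ` through the projection `ℝⁿ → 𝕋ⁿ`. -/
def IsTorusLift (n : ℕ) (φ : Torus n → Torus n) (F : (Fin n → ℝ) → (Fin n → ℝ)) : Prop :=
  ∀ x : Fin n → ℝ, torusProj n (F x) = φ (torusProj n x)

/-- `φ` is a `C^r` diffeomorphism of the torus `𝕋ⁿ`: both `φ` and an inverse of `φ` admit
`C^r` lifts to `ℝⁿ`.  Here `r : WithTop ℕ∞`, so that `r = ω` (real-analyticity) is allowed. -/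
def IsCrTorusDiffeo (n : ℕ) (r : WithTop ℕ∞) (φ : Torus n → Torus n) : Prop :=
  ∃ (ψ : Torus n → Torus n) (F G : (Fin n → ℝ) → (Fin n → ℝ)),
    ContDiff ℝ r F ∧ IsTorusLift n φ F ∧ ContDiff ℝ r G ∧ IsTorusLift n ψ G ∧
    φ ∘ ψ = id ∧ ψ ∘ φ = id

/-- Two actions `ρ₁, ρ₂` of a group `Γ` on `𝕋ⁿ` are `C¹`-conjugate if there is a `C¹`
diffeomorphism `h` of `𝕋ⁿ` with `h ∘ ρ₁(γ) = ρ₂(γ) ∘ h` for all `γ ∈ Γ`. -/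
def AreC1Conjugate {Γ : Type*} (n : ℕ) (ρ₁ ρ₂ : Γ → Torus n → Torus n) : Prop :=
  ∃ h : Torus n → Torus n, IsCrTorusDiffeo n 1 h ∧ ∀ γ : Γ, h ∘ ρ₁ γ = ρ₂ γ ∘ h

namespace TorusBlowup

open Metric Set Filter Topology MeasureTheory

section Osgood

variable {E : Type*} [NormedAddCommGroup E] [NormedSpace ℂ E]

/-- Continuity and holomorphy in each variable separately. -/
def SepHolo {n : ℕ} (f : (Fin n → ℂ) → E) (U : Set (Fin n → ℂ)) : Prop :=
  ContinuousOn f U ∧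
    ∀ x ∈ U, ∀ i, DifferentiableAt ℂ (fun s => f (Function.update x i s)) (x i)

theorem norm_torusMap_sub {n : ℕ} (c : Fin n → ℂ) {R : ℝ} (hR : 0 ≤ R) (θ : Fin n → ℝ) (i : Fin n) :
    ‖torusMap c (fun _ => R) θ i - c i‖ = R := by
  simp [torusMap, Complex.norm_exp, abs_of_nonneg hR]

theorem torusMap_mem_closedBall {n : ℕ} (c : Fin n → ℂ) {R : ℝ} (hR : 0 ≤ R) (θ : Fin n → ℝ) :
    torusMap c (fun _ => R) θ ∈ closedBall c R := by
  rw [mem_closedBall, dist_pi_le_iff hR]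
  intro i
  rw [dist_eq_norm, norm_torusMap_sub c hR]

theorem continuous_torusMap {n : ℕ} (c : Fin n → ℂ) (R : Fin n → ℝ) :
    Continuous (torusMap c R) := by
  unfold torusMap; fun_prop

theorem torusMap_sub_ne_zero {n : ℕ} {c x : Fin n → ℂ} {R : ℝ} (hx : x ∈ ball c R)
    (θ : Fin n → ℝ) (i : Fin n) : torusMap c (fun _ => R) θ i - x i ≠ 0 := by
  have hR : 0 < R := pos_of_mem_ball hx
  intro h
  have h1 := norm_torusMap_sub c hR.le θ i
  rw [sub_eq_zero.1 h, ← dist_eq_norm] at h1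
  have h2 := dist_le_pi_dist x c i
  have h3 := mem_ball.1 hx
  linarith

theorem cauchy_torus [CompleteSpace E] {R : ℝ} : ∀ {n : ℕ} {f : (Fin n → ℂ) → E}
    {U : Set (Fin n → ℂ)} {c x : Fin n → ℂ}, IsOpen U → SepHolo f U → closedBall c R ⊆ U →
    x ∈ ball c R →
    (∯ ζ in T(c, fun _ => R), (∏ i, (ζ i - x i)⁻¹) • f ζ) =
      (2 * Real.pi * Complex.I : ℂ) ^ n • f x := by
  intro n
  induction n with
  | zero =>
    intro f U c x _ _ _ _
    rw [torusIntegral_dim0]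
    simp [Subsingleton.elim c x]
  | succ n ih =>
    intro f U c x hU hf hcU hx
    have hR : 0 < R := pos_of_mem_ball hx
    have hInt : TorusIntegrable (fun ζ : Fin (n+1) → ℂ => (∏ i, (ζ i - x i)⁻¹) • f ζ) c
        (fun _ => R) := by
      refine ContinuousOn.integrableOn_compact isCompact_Icc (Continuous.continuousOn ?_)
      refine Continuous.smul ?_ ?_
      · refine continuous_finsetProd _ fun i _ => Continuous.inv₀ ?_ fun θ =>
          torusMap_sub_ne_zero hx θ i
        have := continuous_torusMap c (fun _ => R)
        fun_prop
      · exact hf.1.comp_continuous (continuous_torusMap _ _)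
          fun θ => hcU (torusMap_mem_closedBall c hR.le θ)
    rw [torusIntegral_succ hInt]
    have hball : ∀ a ∈ closedBall (c 0) R, ∀ y ∈ closedBall (Fin.tail c) R,
        Fin.cons a y ∈ closedBall c R := by
      intro a ha y hy
      rw [mem_closedBall, dist_pi_le_iff hR.le]
      rw [mem_closedBall, dist_pi_le_iff hR.le] at hy
      intro i
      refine Fin.cases ?_ (fun j => ?_) i
      · simpa using ha
      · simpa [Fin.tail] using hy j
    have htx : Fin.tail x ∈ ball (Fin.tail c) R := by
      rw [mem_ball, dist_pi_lt_iff hR]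
      exact fun j => (dist_le_pi_dist x c j.succ).trans_lt hx
    have hx0 : x 0 ∈ ball (c 0) R := (dist_le_pi_dist x c 0).trans_lt hx
    have hcons : ∀ (a b : ℂ) (y : Fin n → ℂ),
        (Fin.cons b y : Fin (n+1) → ℂ) = Function.update (Fin.cons a y) 0 b := by
      intro a b y; exact (Fin.update_cons_zero (α := fun _ => ℂ) a y b).symm
    have inner : ∀ a ∈ sphere (c 0) R,
        (∯ y in T(c ∘ Fin.succ, (fun _ : Fin (n+1) => R) ∘ Fin.succ),
          (∏ i, ((Fin.cons a y : Fin (n+1) → ℂ) i - x i)⁻¹) • f (Fin.cons a y)) =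
        (2 * Real.pi * Complex.I : ℂ) ^ n • ((a - x 0)⁻¹ • f (Fin.cons a (Fin.tail x))) := by
      intro a ha
      have hopen : IsOpen {y : Fin n → ℂ | (Fin.cons a y : Fin (n+1) → ℂ) ∈ U} := by
        refine hU.preimage ?_
        exact continuous_const.finCons continuous_id
      have hs : SepHolo (fun y : Fin n → ℂ => f (Fin.cons a y))
          {y : Fin n → ℂ | (Fin.cons a y : Fin (n+1) → ℂ) ∈ U} := by
        have hc : Continuous fun y : Fin n → ℂ => (Fin.cons a y : Fin (n+1) → ℂ) :=
          continuous_const.finCons continuous_id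
        refine ⟨hf.1.comp hc.continuousOn fun y hy => hy, fun y hy i => ?_⟩
        have := hf.2 _ hy i.succ
        simpa [Fin.cons_update] using this
      have := ih hopen hs (c := Fin.tail c) (x := Fin.tail x)
        (fun y hy => hcU (hball a (sphere_subset_closedBall ha) y hy)) htx
      rw [smul_comm, ← this, ← torusIntegral_smul]
      congr 1
      ext y
      rw [Fin.prod_univ_succ, smul_smul]
      simp [Fin.tail]
    rw [circleIntegral.integral_congr hR.le inner, circleIntegral.integral_smul, pow_succ,
      mul_smul]
    congr 1
    have hd : DifferentiableOn ℂ (fun a => f (Fin.cons a (Fin.tail x))) (closedBall (c 0) R) := by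
      intro a ha
      have := hf.2 _ (hcU (hball a ha _ (ball_subset_closedBall htx))) 0
      simp only [← hcons, Fin.cons_zero] at this
      exact this.differentiableWithinAt
    have := hd.circleIntegral_sub_inv_smul hx0
    simpa using this

/-- Osgood's lemma. -/
theorem SepHolo.analyticOnNhd [CompleteSpace E] {n : ℕ} {f : (Fin n → ℂ) → E}
    {U : Set (Fin n → ℂ)} (hf : SepHolo f U) (hU : IsOpen U) : AnalyticOnNhd ℂ f U := by
  intro c hc
  obtain ⟨R, hR, hcU⟩ := nhds_basis_closedBall.mem_iff.1 (hU.mem_nhds hc)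
  let K : Set (Fin n → ℝ) := Icc 0 fun _ => 2 * Real.pi
  have hK : IsCompact K := isCompact_Icc
  have : CompactSpace K := isCompact_iff_compactSpace.1 hK
  let μ : Measure K := Measure.comap Subtype.val volume
  have : IsFiniteMeasure μ := by
    refine ⟨?_⟩
    rw [(MeasurableEmbedding.subtype_coe hK.measurableSet).comap_apply]
    simpa using hK.measure_lt_top
  let φ : C(K, E) := ⟨fun θ => (∏ i, (R : ℂ) * Complex.exp (θ.1 i * Complex.I) * Complex.I) •
      f (torusMap c (fun _ => R) θ.1), by
    refine Continuous.smul (continuous_finsetProd _ fun i _ => ?_) ?_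
    · have : Continuous fun θ : K => θ.1 i := (continuous_apply i).comp continuous_subtype_val
      exact (continuous_const.mul (Complex.continuous_exp.comp
        ((Complex.continuous_ofReal.comp this).mul continuous_const))).mul continuous_const
    exact hf.1.comp_continuous ((continuous_torusMap _ _).comp continuous_subtype_val)
      fun θ => hcU (torusMap_mem_closedBall c hR.le _)⟩
  have hInt : ∀ g : C(K, ℂ), Integrable (fun θ => g θ • φ θ) μ := fun g =>
    (g.continuous.smul φ.continuous).integrable_of_hasCompactSupport (HasCompactSupport.of_compactSpace _)
  let L : C(K, ℂ) →L[ℂ] E := LinearMap.mkContinuous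
    { toFun := fun g => ∫ θ, g θ • φ θ ∂μ
      map_add' := fun g₁ g₂ => by
        rw [← integral_add (hInt g₁) (hInt g₂)]; simp [add_smul]
      map_smul' := fun a g => by
        rw [RingHom.id_apply, ← integral_smul]; simp [mul_smul] }
    (‖φ‖ * μ.real univ) (fun g => by
      refine (norm_integral_le_of_norm_le_const (C := ‖g‖ * ‖φ‖)
        (Eventually.of_forall fun θ => ?_)).trans_eq (by ring)
      rw [norm_smul]
      exact mul_le_mul (g.norm_coe_le_norm θ) (φ.norm_coe_le_norm θ) (norm_nonneg _) (norm_nonneg _))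
  let e : Fin n → C(K, ℂ) := fun i => ⟨fun θ => torusMap c (fun _ => R) θ.1 i, by
    have := continuous_torusMap c (fun _ => R); fun_prop⟩
  let k : (Fin n → ℂ) → C(K, ℂ) := fun x => ∏ i, Ring.inverse (e i - algebraMap ℂ C(K, ℂ) (x i))
  have hunit : ∀ x ∈ ball c R, ∀ i, IsUnit (e i - algebraMap ℂ C(K, ℂ) (x i)) := by
    intro x hx i
    rw [ContinuousMap.isUnit_iff_forall_ne_zero]
    exact fun θ => torusMap_sub_ne_zero hx θ.1 i
  have hk : ∀ x ∈ ball c R, ∀ θ, k x θ = ∏ i, (torusMap c (fun _ => R) θ.1 i - x i)⁻¹ := by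
    intro x hx θ
    simp only [k, ContinuousMap.prod_apply]
    refine Finset.prod_congr rfl fun i _ => ?_
    have h1 := Ring.mul_inverse_cancel _ (hunit x hx i)
    have h2 := DFunLike.congr_fun h1 θ
    rw [ContinuousMap.mul_apply, ContinuousMap.one_apply] at h2
    exact eq_inv_of_mul_eq_one_right h2
  have hana : AnalyticAt ℂ k c := by
    refine Finset.analyticAt_fun_prod _ fun i _ => ?_
    obtain ⟨u, hu⟩ := hunit c (mem_ball_self hR) i
    have h1 : AnalyticAt ℂ Ring.inverse (e i - algebraMap ℂ C(K, ℂ) (c i)) := by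
      rw [← hu]; exact analyticAt_inverse u
    refine AnalyticAt.fun_comp h1 (analyticAt_const.sub ?_)
    exact ((Algebra.linearMap ℂ C(K, ℂ)).toContinuousLinearMap.analyticAt _).fun_comp
      ((ContinuousLinearMap.proj (R := ℂ) (φ := fun _ : Fin n => ℂ) i).analyticAt c)
  have hL : AnalyticAt ℂ (fun x => ((2 * Real.pi * Complex.I : ℂ) ^ n)⁻¹ • L (k x)) c :=
    (L.analyticAt _ |>.fun_comp hana).const_smul
  refine hL.congr ?_
  filter_upwards [ball_mem_nhds c hR] with x hx
  rw [inv_smul_eq_iff₀ (by simp [Real.pi_ne_zero]), ← cauchy_torus hU hf hcU hx]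
  change ∫ θ, k x θ • φ θ ∂μ = _
  rw [torusIntegral, ← integral_subtype_comap hK.measurableSet]
  refine integral_congr_ae (Eventually.of_forall fun θ => ?_)
  simp only [hk x hx]
  exact smul_comm _ _ _

end Osgood

end TorusBlowup

namespace TorusBlowup

open Metric Set Filter Topology MeasureTheory

section HolomorphicLimits

variable {E : Type*} [NormedAddCommGroup E] [NormedSpace ℂ E]

theorem hasDerivAt_update {n : ℕ} (x : Fin n → ℂ) (i : Fin n) (s : ℂ) :
    HasDerivAt (Function.update x i) (Pi.single i 1) s := by
  rw [hasDerivAt_pi]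
  intro j
  by_cases hj : j = i
  · subst hj; simpa using hasDerivAt_id' s
  · simpa [Function.update_of_ne hj, Pi.single_eq_of_ne hj] using hasDerivAt_const s (x j)

theorem continuous_update_coord {n : ℕ} (x : Fin n → ℂ) (i : Fin n) :
    Continuous (Function.update x i) :=
  continuous_iff_continuousAt.2 fun s => (hasDerivAt_update x i s).continuousAt

theorem isOpen_slice {n : ℕ} {U : Set (Fin n → ℂ)} (hU : IsOpen U) (x : Fin n → ℂ) (i : Fin n) :
    IsOpen {s | Function.update x i s ∈ U} :=
  hU.preimage (continuous_update_coord x i)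

theorem differentiableOn_slice {n : ℕ} {f : (Fin n → ℂ) → E} {U : Set (Fin n → ℂ)}
    (hf : DifferentiableOn ℂ f U) (x : Fin n → ℂ) (i : Fin n) :
    DifferentiableOn ℂ (fun s => f (Function.update x i s)) {s | Function.update x i s ∈ U} :=
  hf.comp (fun s _ => (hasDerivAt_update x i s).differentiableAt.differentiableWithinAt)
    fun _ hs => hs

theorem exists_bound_of_continuousOn {X F : Type*} [MetricSpace X] [ProperSpace X]
    [NormedAddCommGroup F]
    {U : Set X} (hU : IsOpen U) {G : X → ℝ → F} (a b : ℝ)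
    (hG : ContinuousOn (Function.uncurry G) (U ×ˢ univ)) {x : X} (hx : x ∈ U) :
    ∃ R > 0, closedBall x R ⊆ U ∧ ∃ C, ∀ y ∈ closedBall x R, ∀ t ∈ uIcc a b, ‖G y t‖ ≤ C := by
  obtain ⟨R, hR, hRU⟩ := nhds_basis_closedBall.mem_iff.1 (hU.mem_nhds hx)
  obtain ⟨C, hC⟩ := ((isCompact_closedBall x R).prod isCompact_uIcc).exists_bound_of_continuousOn
    (f := Function.uncurry G) (s := closedBall x R ×ˢ uIcc a b)
    (hG.mono (prod_mono hRU (subset_univ _)))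
  exact ⟨R, hR, hRU, C, fun y hy t ht => hC (y, t) ⟨hy, ht⟩⟩

theorem continuous_section {X F : Type*} [TopologicalSpace X] [TopologicalSpace F]
    {U : Set X} {G : X → ℝ → F} (hG : ContinuousOn (Function.uncurry G) (U ×ˢ univ))
    {x : X} (hx : x ∈ U) : Continuous (G x) :=
  hG.comp_continuous (f := fun t => (x, t)) (by fun_prop) fun t => ⟨hx, mem_univ t⟩

theorem continuousOn_intervalIntegral {X : Type*} [MetricSpace X] [ProperSpace X]
    {U : Set X} (hU : IsOpen U) {G : X → ℝ → E}
    (a b : ℝ) (hG : ContinuousOn (Function.uncurry G) (U ×ˢ univ)) :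
    ContinuousOn (fun y => ∫ t in a..b, G y t) U := by
  intro x hx
  obtain ⟨R, hR, hRU, C, hC⟩ := exists_bound_of_continuousOn hU a b hG hx
  refine (intervalIntegral.continuousAt_of_dominated_interval (bound := fun _ => C) ?_ ?_
    intervalIntegrable_const ?_).continuousWithinAt
  · filter_upwards [hU.mem_nhds hx] with y hy
    exact (continuous_section hG hy).aestronglyMeasurable
  · filter_upwards [closedBall_mem_nhds x hR] with y hy
    exact Eventually.of_forall fun t ht => hC y hy t (uIoc_subset_uIcc ht)
  · refine Eventually.of_forall fun t _ => ?_
    exact (hG.continuousAt ((hU.prod isOpen_univ).mem_nhds ⟨hx, mem_univ t⟩)).comp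
      (f := fun y => (y, t)) (by fun_prop)

theorem differentiableOn_intervalIntegral_one {U : Set ℂ} (hU : IsOpen U) {G : ℂ → ℝ → E}
    (a b : ℝ) (hG : ContinuousOn (Function.uncurry G) (U ×ˢ univ))
    (hd : ∀ t, DifferentiableOn ℂ (fun y => G y t) U) :
    DifferentiableOn ℂ (fun y => ∫ t in a..b, G y t) U := by
  intro x hx
  obtain ⟨R, hR, hRU, C, hC⟩ := exists_bound_of_continuousOn hU a b hG hx
  have hsec : ∀ y ∈ U, Continuous (G y) := fun y hy => continuous_section hG hy
  have hev : ∀ᶠ y in 𝓝 x, y ∈ U := hU.mem_nhds hx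
  refine (intervalIntegral.hasDerivAt_integral_of_dominated_loc_of_deriv_le (μ := volume)
    (F' := fun y t => deriv (fun y => G y t) y)
    (s := ball x (R / 2)) (bound := fun _ => C / (R / 2)) (ball_mem_nhds x (by positivity))
    (hev.mono fun y hy => (hsec y hy).aestronglyMeasurable)
    ((hsec x hx).intervalIntegrable _ _) ?_ ?_ (intervalIntegrable_const) ?_).2.differentiableAt.differentiableWithinAt
  · have hseq : ∀ k : ℕ, x + (R / (k + 1) : ℝ) ∈ closedBall x R := by
      intro k
      rw [mem_closedBall, dist_eq_norm, add_sub_cancel_left, Complex.norm_real,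
        Real.norm_of_nonneg (by positivity)]
      exact div_le_self hR.le (by linarith [Nat.cast_nonneg (α := ℝ) k])
    refine aestronglyMeasurable_of_tendsto_ae atTop
      (f := fun (k : ℕ) t => ((R / (k + 1) : ℝ) : ℂ)⁻¹ • (G (x + (R / (k + 1) : ℝ)) t - G x t))
      (fun k => (((hsec _ (hRU (hseq k))).sub (hsec x hx)).const_smul _).aestronglyMeasurable)
      (Eventually.of_forall fun t => ?_)
    have hder := ((hd t).differentiableAt (hU.mem_nhds hx)).hasDerivAt
    rw [hasDerivAt_iff_tendsto_slope_zero] at hder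
    refine hder.comp ?_
    rw [tendsto_nhdsWithin_iff]
    refine ⟨?_, Eventually.of_forall fun k => ?_⟩
    · have h0 : Tendsto (fun k : ℕ => R / ((k : ℝ) + 1)) atTop (𝓝 0) :=
        tendsto_const_div_atTop_nhds_zero_nat R |>.comp (tendsto_add_atTop_nat 1) |>.congr
          fun k => by simp
      have := (Complex.continuous_ofReal.tendsto 0).comp h0
      rwa [Complex.ofReal_zero] at this
    · have : (R / (k + 1) : ℝ) ≠ 0 := by positivity
      exact Complex.ofReal_ne_zero.2 this
  · refine Eventually.of_forall fun t ht y hy => ?_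
    have hyb : ∀ z ∈ closedBall y (R / 2), z ∈ closedBall x R := fun z hz => by
      rw [mem_closedBall] at *
      rw [mem_ball] at hy
      linarith [dist_triangle z y x]
    refine Complex.norm_deriv_le_of_forall_mem_sphere_norm_le (by positivity) ?_ fun z hz =>
      hC z (hyb z (sphere_subset_closedBall hz)) t (uIoc_subset_uIcc ht)
    exact ((hd t).mono fun z hz => hRU (hyb z (closure_ball_subset_closedBall hz))).diffContOnCl
  · refine Eventually.of_forall fun t _ y hy => ?_
    exact ((hd t).differentiableAt (hU.mem_nhds (hRU (ball_subset_closedBall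
      (ball_subset_ball (by linarith) hy))))).hasDerivAt

variable [CompleteSpace E]

theorem differentiableOn_of_slices {n : ℕ} {f : (Fin n → ℂ) → E} {U : Set (Fin n → ℂ)}
    (hU : IsOpen U) (hc : ContinuousOn f U)
    (hs : ∀ x ∈ U, ∀ i,
      DifferentiableOn ℂ (fun s => f (Function.update x i s)) {s | Function.update x i s ∈ U}) :
    DifferentiableOn ℂ f U := by
  have : SepHolo f U := ⟨hc, fun x hx i =>
    (hs x hx i).differentiableAt ((isOpen_slice hU x i).mem_nhds (by simpa using hx))⟩
  exact (this.analyticOnNhd hU).differentiableOn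

theorem analyticOnNhd_of_differentiableOn {n : ℕ} {f : (Fin n → ℂ) → E} {U : Set (Fin n → ℂ)}
    (hU : IsOpen U) (hf : DifferentiableOn ℂ f U) : AnalyticOnNhd ℂ f U :=
  SepHolo.analyticOnNhd ⟨hf.continuousOn, fun x hx i =>
    (differentiableOn_slice hf x i).differentiableAt
      ((isOpen_slice hU x i).mem_nhds (by simpa using hx))⟩ hU

theorem differentiableOn_tsum {n : ℕ} {ι : Type*} {f : ι → (Fin n → ℂ) → E}
    {U : Set (Fin n → ℂ)} {u : ι → ℝ} (hU : IsOpen U) (hu : Summable u)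
    (hf : ∀ l, DifferentiableOn ℂ (f l) U) (hb : ∀ l, ∀ x ∈ U, ‖f l x‖ ≤ u l) :
    DifferentiableOn ℂ (fun x => ∑' l, f l x) U :=
  differentiableOn_of_slices hU (continuousOn_tsum (fun l => (hf l).continuousOn) hu hb)
    fun x _ i => Complex.differentiableOn_tsum_of_summable_norm hu
      (fun l => differentiableOn_slice (hf l) x i) (isOpen_slice hU x i) fun l _ hw => hb l _ hw

theorem differentiableOn_of_tendstoUniformlyOn {n : ℕ} {f : ℕ → (Fin n → ℂ) → E}
    {g : (Fin n → ℂ) → E} {U : Set (Fin n → ℂ)} (hU : IsOpen U)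
    (hf : ∀ l, DifferentiableOn ℂ (f l) U) (hg : TendstoUniformlyOn f g atTop U) :
    DifferentiableOn ℂ g U := by
  refine differentiableOn_of_slices hU
    (hg.continuousOn (Frequently.of_forall fun l => (hf l).continuousOn)) fun x _ i => ?_
  have h := (hg.comp (Function.update x i)).tendstoLocallyUniformlyOn
  exact h.differentiableOn (Eventually.of_forall fun l => differentiableOn_slice (hf l) x i)
    (isOpen_slice hU x i)

theorem differentiableOn_circleIntegral {n : ℕ} {U : Set (Fin n → ℂ)} (hU : IsOpen U)
    {G : (Fin n → ℂ) → ℂ → E} {c : ℝ} (hc : 0 ≤ c)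
    (hG : ContinuousOn (Function.uncurry G) (U ×ˢ sphere 0 c))
    (hd : ∀ z ∈ sphere (0 : ℂ) c, DifferentiableOn ℂ (fun y => G y z) U) :
    DifferentiableOn ℂ (fun y => ∮ z in C(0, c), G y z) U := by
  have hmem : ∀ t, circleMap 0 c t ∈ sphere (0 : ℂ) c := circleMap_mem_sphere 0 hc
  have hcont : ContinuousOn (Function.uncurry fun y t => deriv (circleMap 0 c) t •
      G y (circleMap 0 c t)) (U ×ˢ univ) := by
    refine ContinuousOn.smul ?_ ?_
    · simp only [deriv_circleMap]
      fun_prop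
    · exact hG.comp (f := fun p : (Fin n → ℂ) × ℝ => (p.1, circleMap 0 c p.2)) (by fun_prop)
        fun p hp => ⟨hp.1, hmem _⟩
  have hdiff : ∀ t, DifferentiableOn ℂ (fun y => deriv (circleMap 0 c) t •
      G y (circleMap 0 c t)) U := fun t => (hd _ (hmem t)).const_smul _
  unfold circleIntegral
  refine differentiableOn_of_slices hU (continuousOn_intervalIntegral hU _ _ hcont) fun x _ i => ?_
  refine differentiableOn_intervalIntegral_one (isOpen_slice hU x i)
    (G := fun s t => deriv (circleMap 0 c) t • G (Function.update x i s) (circleMap 0 c t))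
    _ _ ?_ fun t => differentiableOn_slice (hdiff t) x i
  have := continuous_update_coord x i
  exact hcont.comp (f := fun p : ℂ × ℝ => (Function.update x i p.1, p.2)) (by fun_prop)
    fun p hp => ⟨hp.1, mem_univ _⟩

end HolomorphicLimits

end TorusBlowup

namespace TorusBlowup

open Metric Set Filter Topology MeasureTheory

section CauchyJump

theorem cauchy_jump {E : Type*} [NormedAddCommGroup E] [NormedSpace ℂ E] [CompleteSpace E]
    {g : ℂ → E} {A : Set ℂ} (hA : IsOpen A) (hg : DifferentiableOn ℂ g A) {c₁ c₂ : ℝ} {w : ℂ}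
    (hc₁ : 0 < c₁) (h₁ : c₁ < ‖w‖) (h₂ : ‖w‖ < c₂)
    (hsub : closedBall (0 : ℂ) c₂ \ ball 0 c₁ ⊆ A) :
    ((2 * Real.pi * Complex.I : ℂ)⁻¹ • ∮ z in C(0, c₂), (z - w)⁻¹ • g z) -
      ((2 * Real.pi * Complex.I : ℂ)⁻¹ • ∮ z in C(0, c₁), (z - w)⁻¹ • g z) = g w := by
  have hc₂ : 0 < c₂ := hc₁.trans (h₁.trans h₂)
  have hwA : w ∈ A := hsub ⟨by simpa using h₂.le, by simpa using h₁.le⟩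
  have hds : DifferentiableOn ℂ (dslope g w) A :=
    (Complex.differentiableOn_dslope (hA.mem_nhds hwA)).2 hg
  have hne : ∀ z ∈ ball (0 : ℂ) c₂ \ closedBall 0 c₁, z ∈ A := fun z hz =>
    hsub ⟨ball_subset_closedBall hz.1, fun h => hz.2 (ball_subset_closedBall h)⟩
  have hsame := Complex.circleIntegral_eq_of_differentiable_on_annulus_off_countable hc₁
    (h₁.trans h₂).le countable_empty (hds.continuousOn.mono hsub)
    (fun z hz => hds.differentiableAt (hA.mem_nhds (hne z hz.1)))
  have hdec : ∀ c : ℝ, 0 < c → sphere (0 : ℂ) c ⊆ A → ‖w‖ ≠ c →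
      (∮ z in C(0, c), (z - w)⁻¹ • g z) =
        (∮ z in C(0, c), dslope g w z) + (∮ z in C(0, c), (z - w)⁻¹) • g w := by
    intro c hc hcA hwc
    have hzw : ∀ z ∈ sphere (0 : ℂ) c, z - w ≠ 0 := by
      intro z hz h
      rw [mem_sphere_zero_iff_norm, sub_eq_zero.1 h] at hz
      exact hwc hz
    have hinv : ContinuousOn (fun z : ℂ => (z - w)⁻¹) (sphere 0 c) :=
      ContinuousOn.inv₀ (by fun_prop) hzw
    have hi₂ : CircleIntegrable (fun z => (z - w)⁻¹ • g w) 0 c :=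
      (ContinuousOn.smul hinv continuousOn_const).circleIntegrable hc.le
    rw [← circleIntegral.integral_smul_const]
    refine Eq.trans ?_ (circleIntegral.integral_add
      ((hds.continuousOn.mono hcA).circleIntegrable hc.le) hi₂)
    refine circleIntegral.integral_congr hc.le fun z hz => ?_
    have : z ≠ w := sub_ne_zero.1 (hzw z hz)
    simp only [dslope_of_ne _ this, slope, vsub_eq_sub, smul_sub]
    abel
  have hs₁ : sphere (0 : ℂ) c₁ ⊆ A := fun z hz => hsub
    ⟨closedBall_subset_closedBall (h₁.trans h₂).le (sphere_subset_closedBall hz), by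
      rw [mem_sphere_zero_iff_norm] at hz; simp [hz]⟩
  have hs₂ : sphere (0 : ℂ) c₂ ⊆ A := fun z hz => hsub ⟨sphere_subset_closedBall hz, by
      rw [mem_sphere_zero_iff_norm] at hz; simp [hz, (h₁.trans h₂).le]⟩
  have hz₁ : (∮ z in C(0, c₁), (z - w)⁻¹) = 0 := by
    have hzw : ∀ z ∈ closedBall (0 : ℂ) c₁, z - w ≠ 0 := by
      intro z hz h
      rw [mem_closedBall_zero_iff, sub_eq_zero.1 h] at hz
      linarith
    refine Complex.circleIntegral_eq_zero_of_differentiable_on_off_countable hc₁.le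
      countable_empty (ContinuousOn.inv₀ (by fun_prop) hzw) fun z hz => ?_
    exact DifferentiableAt.inv (by fun_prop) (hzw z (ball_subset_closedBall hz.1))
  rw [hdec c₂ hc₂ hs₂ h₂.ne, hdec c₁ hc₁ hs₁ h₁.ne', hsame, hz₁,
    circleIntegral.integral_sub_inv_of_mem_ball (by simpa using h₂), ← smul_sub,
    zero_smul, add_zero, add_sub_cancel_left, inv_smul_smul₀ Complex.two_pi_I_ne_zero]

end CauchyJump

section Cocycle

variable {n : ℕ}

/-- The difference of `f` along the radial scaling by `h z`, localised by a Gaussian factor. -/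
noncomputable def cocycle (B : ℝ) (h : ℂ → ℂ) (f : (Fin n → ℂ) → (Fin n → ℂ)) (y : Fin n → ℂ)
    (z : ℂ) : Fin n → ℂ :=
  f ((Complex.exp (B * (z - y ⬝ᵥ y)) * h z) • y) - f (Complex.exp (B * (z - y ⬝ᵥ y)) • y)

/-- The Cauchy integral of the cocycle over the circle of radius `c`. -/
noncomputable def cauchyPart (B : ℝ) (h : ℂ → ℂ) (c : ℝ) (f : (Fin n → ℂ) → (Fin n → ℂ))
    (y : Fin n → ℂ) : Fin n → ℂ :=
  (2 * Real.pi * Complex.I : ℂ)⁻¹ • ∮ z in C(0, c), (z - y ⬝ᵥ y)⁻¹ • cocycle B h f y z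

variable {B r ε M c : ℝ} {h : ℂ → ℂ} {f : (Fin n → ℂ) → (Fin n → ℂ)}

theorem norm_sub_le_of_bounded (hf : DifferentiableOn ℂ f (ball 0 r))
    (hM : ∀ x ∈ ball 0 r, ‖f x‖ ≤ M) {p q : Fin n → ℂ} (hp : ‖p‖ < r / 3)
    (hq : ‖q - p‖ < 2 * r / 3) : ‖f q - f p‖ ≤ 3 * M / r * ‖q - p‖ := by
  have hr : 0 < r := by linarith [norm_nonneg p]
  have hsub : ball p (2 * r / 3) ⊆ ball 0 r := by
    intro x hx
    rw [mem_ball_iff_norm] at hx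
    rw [mem_ball_zero_iff]
    have := norm_add_le (x - p) p
    rw [sub_add_cancel] at this
    linarith
  have h1 := Complex.dist_le_div_mul_dist_of_mapsTo_ball (hf.mono hsub) (R₂ := 2 * M)
    (fun x hx => by
      rw [mem_closedBall, dist_eq_norm]
      have h1 := hM x (hsub hx)
      have h2 := hM p (hsub (mem_ball_self (by positivity)))
      linarith [norm_sub_le (f x) (f p)])
    (mem_ball_iff_norm.2 hq)
  rw [dist_eq_norm, dist_eq_norm] at h1
  convert h1 using 2
  field_simp

theorem scaled_mem (hε : ε ≤ 1) {y : Fin n → ℂ} {e s : ℂ} (he : ‖e‖ * ‖y‖ < r / 3)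
    (hs : ‖s - 1‖ ≤ ε) : ‖e • y‖ < r / 3 ∧ ‖(e * s) • y - e • y‖ ≤ ε * (‖e‖ * ‖y‖) ∧
      ‖(e * s) • y - e • y‖ < 2 * r / 3 ∧ ‖(e * s) • y‖ < r := by
  have h0 : 0 ≤ ‖e‖ * ‖y‖ := by positivity
  have h2 : ‖(e * s) • y - e • y‖ ≤ ε * (‖e‖ * ‖y‖) := by
    have : (e * s) • y - e • y = ((s - 1) * e) • y := by
      rw [← sub_smul]; congr 1; ring
    rw [this, norm_smul, norm_mul, mul_assoc]
    exact mul_le_mul_of_nonneg_right hs h0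
  have h3 : ε * (‖e‖ * ‖y‖) ≤ ‖e‖ * ‖y‖ := mul_le_of_le_one_left h0 hε
  have h1 : ‖e • y‖ < r / 3 := by rwa [norm_smul]
  have h4 := norm_add_le ((e * s) • y - e • y) (e • y)
  rw [sub_add_cancel] at h4
  refine ⟨h1, h2, by linarith, by linarith⟩

theorem norm_cocycle_le (hf : DifferentiableOn ℂ f (ball 0 r)) (hM : ∀ x ∈ ball 0 r, ‖f x‖ ≤ M)
    (hM0 : 0 ≤ M) (hε : ε ≤ 1) {y : Fin n → ℂ} {z : ℂ}
    (he : ‖Complex.exp (B * (z - y ⬝ᵥ y))‖ * ‖y‖ < r / 3) (hh : ‖h z - 1‖ ≤ ε) :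
    ‖cocycle B h f y z‖ ≤ 3 * M / r * (ε * (‖Complex.exp (B * (z - y ⬝ᵥ y))‖ * ‖y‖)) := by
  obtain ⟨h1, h2, h3, -⟩ := scaled_mem hε he hh
  have hr : 0 < r := by linarith [norm_nonneg (Complex.exp (B * (z - y ⬝ᵥ y)) • y)]
  exact (norm_sub_le_of_bounded hf hM h1 h3).trans (mul_le_mul_of_nonneg_left h2 (by positivity))

theorem norm_cauchyPart_le (hf : DifferentiableOn ℂ f (ball 0 r))
    (hM : ∀ x ∈ ball 0 r, ‖f x‖ ≤ M) (hM0 : 0 ≤ M) (hε0 : 0 ≤ ε) (hε : ε ≤ 1) (hc : 0 ≤ c)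
    {d e : ℝ} (hd : 0 < d) {y : Fin n → ℂ}
    (hdist : ∀ z ∈ sphere (0 : ℂ) c, d ≤ ‖z - y ⬝ᵥ y‖)
    (hexp : ∀ z ∈ sphere (0 : ℂ) c, ‖Complex.exp (B * (z - y ⬝ᵥ y))‖ * ‖y‖ ≤ e)
    (he : e < r / 3) (hh : ∀ z ∈ sphere (0 : ℂ) c, ‖h z - 1‖ ≤ ε) :
    ‖cauchyPart B h c f y‖ ≤ c / d * (3 * M / r * (ε * e)) := by
  rw [div_mul_eq_mul_div, mul_div_assoc]
  refine circleIntegral.norm_two_pi_i_inv_smul_integral_le_of_norm_le_const hc fun z hz => ?_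
  have hr : 0 < r := by
    have : 0 ≤ ‖Complex.exp (B * (z - y ⬝ᵥ y))‖ * ‖y‖ := by positivity
    linarith [hexp z hz]
  rw [norm_smul, norm_inv, div_eq_inv_mul]
  refine mul_le_mul (inv_anti₀ hd (hdist z hz)) ?_ (norm_nonneg _) (by positivity)
  refine (norm_cocycle_le hf hM hM0 hε ((hexp z hz).trans_lt he) (hh z hz)).trans ?_
  gcongr
  exact hexp z hz

theorem continuous_dotProduct_self : Continuous fun y : Fin n → ℂ => y ⬝ᵥ y := by
  unfold dotProduct; fun_prop

theorem differentiable_dotProduct_self : Differentiable ℂ fun y : Fin n → ℂ => y ⬝ᵥ y := by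
  unfold dotProduct; fun_prop

theorem continuousOn_cocycle {S : Set ((Fin n → ℂ) × ℂ)}
    (hf : ContinuousOn f (ball 0 r)) (hε : ε ≤ 1)
    (hh : ContinuousOn (fun p : (Fin n → ℂ) × ℂ => h p.2) S)
    (he : ∀ p ∈ S, ‖Complex.exp (B * (p.2 - p.1 ⬝ᵥ p.1))‖ * ‖p.1‖ < r / 3)
    (hh1 : ∀ p ∈ S, ‖h p.2 - 1‖ ≤ ε) :
    ContinuousOn (Function.uncurry (cocycle B h f)) S := by
  have hq : Continuous fun p : (Fin n → ℂ) × ℂ => p.1 ⬝ᵥ p.1 :=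
    continuous_dotProduct_self.comp continuous_fst
  have hexp : Continuous fun p : (Fin n → ℂ) × ℂ => Complex.exp (B * (p.2 - p.1 ⬝ᵥ p.1)) := by
    fun_prop
  refine ContinuousOn.sub (hf.comp (f := fun p : (Fin n → ℂ) × ℂ =>
    (Complex.exp (B * (p.2 - p.1 ⬝ᵥ p.1)) * h p.2) • p.1) ?_ fun p hp => ?_)
    (hf.comp (f := fun p : (Fin n → ℂ) × ℂ => Complex.exp (B * (p.2 - p.1 ⬝ᵥ p.1)) • p.1)
      ?_ fun p hp => ?_)
  · exact (hexp.continuousOn.mul hh).smul continuousOn_fst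
  · simpa using (scaled_mem hε (he p hp) (hh1 p hp)).2.2.2
  · exact hexp.continuousOn.smul continuousOn_fst
  · have := (scaled_mem hε (he p hp) (hh1 p hp)).1
    have h0 := norm_nonneg (Complex.exp (B * (p.2 - p.1 ⬝ᵥ p.1)) • p.1)
    rw [mem_ball_zero_iff]
    linarith

theorem differentiableOn_cocycle {U : Set (Fin n → ℂ)}
    (hf : DifferentiableOn ℂ f (ball 0 r)) (hε : ε ≤ 1) {z : ℂ}
    (he : ∀ y ∈ U, ‖Complex.exp (B * (z - y ⬝ᵥ y))‖ * ‖y‖ < r / 3) (hh1 : ‖h z - 1‖ ≤ ε) :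
    DifferentiableOn ℂ (fun y => cocycle B h f y z) U := by
  have hq := differentiable_dotProduct_self (n := n)
  refine DifferentiableOn.sub (hf.comp (f := fun y : Fin n → ℂ =>
    (Complex.exp (B * (z - y ⬝ᵥ y)) * h z) • y) ?_ fun p hp => ?_)
    (hf.comp (f := fun y : Fin n → ℂ => Complex.exp (B * (z - y ⬝ᵥ y)) • y)
      ?_ fun p hp => ?_)
  · exact Differentiable.differentiableOn (by fun_prop)
  · simpa using (scaled_mem hε (he p hp) hh1).2.2.2
  · exact Differentiable.differentiableOn (by fun_prop)
  · have := (scaled_mem hε (he p hp) hh1).1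
    have h0 := norm_nonneg (Complex.exp (B * (z - p ⬝ᵥ p)) • p)
    rw [mem_ball_zero_iff]
    linarith

theorem continuousOn_cocycle_sphere (hf : DifferentiableOn ℂ f (ball 0 r)) (hε : ε ≤ 1)
    {y : Fin n → ℂ} (hh : ContinuousOn h (sphere 0 c))
    (he : ∀ z ∈ sphere (0 : ℂ) c, ‖Complex.exp (B * (z - y ⬝ᵥ y))‖ * ‖y‖ < r / 3)
    (hh1 : ∀ z ∈ sphere (0 : ℂ) c, ‖h z - 1‖ ≤ ε) :
    ContinuousOn (cocycle B h f y) (sphere 0 c) := by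
  have := continuousOn_cocycle (S := {y} ×ˢ sphere (0 : ℂ) c) (B := B) hf.continuousOn hε
    (hh.comp continuousOn_snd fun p hp => hp.2)
    (by rintro ⟨a, z⟩ ⟨rfl, hz⟩; exact he z hz) (by rintro ⟨a, z⟩ ⟨_, hz⟩; exact hh1 z hz)
  exact this.comp (f := fun z => (y, z)) (by fun_prop) fun z hz => ⟨rfl, hz⟩

theorem differentiableOn_cauchyPart {U : Set (Fin n → ℂ)} (hU : IsOpen U)
    (hf : DifferentiableOn ℂ f (ball 0 r)) (hε : ε ≤ 1) (hc : 0 ≤ c)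
    (hne : ∀ y ∈ U, ‖y ⬝ᵥ y‖ ≠ c) (hh : ContinuousOn h (sphere 0 c))
    (he : ∀ y ∈ U, ∀ z ∈ sphere (0 : ℂ) c, ‖Complex.exp (B * (z - y ⬝ᵥ y))‖ * ‖y‖ < r / 3)
    (hh1 : ∀ z ∈ sphere (0 : ℂ) c, ‖h z - 1‖ ≤ ε) :
    DifferentiableOn ℂ (cauchyPart B h c f) U := by
  have hzw : ∀ y ∈ U, ∀ z ∈ sphere (0 : ℂ) c, z - y ⬝ᵥ y ≠ 0 := by
    intro y hy z hz h
    rw [mem_sphere_zero_iff_norm, sub_eq_zero.1 h] at hz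
    exact hne y hy hz
  have hq := differentiable_dotProduct_self (n := n)
  have key : DifferentiableOn ℂ
      (fun y => ∮ z in C(0, c), (z - y ⬝ᵥ y)⁻¹ • cocycle B h f y z) U := by
    refine differentiableOn_circleIntegral hU hc ?_ fun z hz => ?_
    · have h1 : ContinuousOn (fun p : (Fin n → ℂ) × ℂ => (p.2 - p.1 ⬝ᵥ p.1)⁻¹)
          (U ×ˢ sphere 0 c) :=
        ContinuousOn.inv₀ ((continuous_snd.sub
          (continuous_dotProduct_self.comp continuous_fst)).continuousOn)
          fun p hp => hzw p.1 hp.1 p.2 hp.2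
      exact h1.smul (continuousOn_cocycle hf.continuousOn hε
        (hh.comp continuousOn_snd fun p hp => hp.2)
        (fun p hp => he p.1 hp.1 p.2 hp.2) fun p hp => hh1 p.2 hp.2)
    · refine DifferentiableOn.smul (DifferentiableOn.inv ?_ fun y hy => hzw y hy z hz)
        (differentiableOn_cocycle hf hε (fun y hy => he y hy z hz) (hh1 z hz))
      exact Differentiable.differentiableOn (by fun_prop)
  exact key.const_smul (2 * Real.pi * Complex.I : ℂ)⁻¹

theorem cauchyPart_sub {g : (Fin n → ℂ) → (Fin n → ℂ)} (hf : DifferentiableOn ℂ f (ball 0 r))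
    (hg : DifferentiableOn ℂ g (ball 0 r)) (hε : ε ≤ 1) (hc : 0 ≤ c) {y : Fin n → ℂ}
    (hne : ‖y ⬝ᵥ y‖ ≠ c) (hh : ContinuousOn h (sphere 0 c))
    (he : ∀ z ∈ sphere (0 : ℂ) c, ‖Complex.exp (B * (z - y ⬝ᵥ y))‖ * ‖y‖ < r / 3)
    (hh1 : ∀ z ∈ sphere (0 : ℂ) c, ‖h z - 1‖ ≤ ε) :
    cauchyPart B h c (f - g) y = cauchyPart B h c f y - cauchyPart B h c g y := by
  have hzw : ∀ z ∈ sphere (0 : ℂ) c, z - y ⬝ᵥ y ≠ 0 := by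
    intro z hz h
    rw [mem_sphere_zero_iff_norm, sub_eq_zero.1 h] at hz
    exact hne hz
  have hinv : ContinuousOn (fun z : ℂ => (z - y ⬝ᵥ y)⁻¹) (sphere 0 c) :=
    ContinuousOn.inv₀ (by fun_prop) hzw
  rw [cauchyPart, cauchyPart, cauchyPart, ← smul_sub]
  congr 1
  refine Eq.trans ?_ (circleIntegral.integral_sub
    ((hinv.smul (continuousOn_cocycle_sphere hf hε hh he hh1)).circleIntegrable hc)
    ((hinv.smul (continuousOn_cocycle_sphere hg hε hh he hh1)).circleIntegrable hc))
  refine circleIntegral.integral_congr hc fun z _ => ?_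
  simp only [cocycle, Pi.sub_apply, ← smul_sub]
  congr 1
  abel

theorem cauchyPart_jump (hf : DifferentiableOn ℂ f (ball 0 r)) (hε : ε ≤ 1) {c₀ c₁ c₂ : ℝ}
    {y : Fin n → ℂ} (h0 : 0 ≤ c₀) (h01 : c₀ < c₁) (h1 : c₁ < ‖y ⬝ᵥ y‖) (h2 : ‖y ⬝ᵥ y‖ < c₂)
    (hh : DifferentiableOn ℂ h {z | c₀ < ‖z‖}) (hh1 : ∀ z, c₀ < ‖z‖ → ‖h z - 1‖ ≤ ε)
    (he : ∀ z ∈ closedBall (0 : ℂ) c₂, ‖Complex.exp (B * (z - y ⬝ᵥ y))‖ * ‖y‖ < r / 3) :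
    cauchyPart B h c₂ f y - cauchyPart B h c₁ f y = f (h (y ⬝ᵥ y) • y) - f y := by
  set A : Set ℂ := {z | c₀ < ‖z‖} ∩ {z | ‖Complex.exp (B * (z - y ⬝ᵥ y))‖ * ‖y‖ < r / 3}
  have hA : IsOpen A := (isOpen_lt continuous_const continuous_norm).inter
    (isOpen_lt (by fun_prop) continuous_const)
  have hd : DifferentiableOn ℂ (cocycle B h f y) A := by
    refine DifferentiableOn.sub (hf.comp (f := fun z : ℂ =>
      (Complex.exp (B * (z - y ⬝ᵥ y)) * h z) • y) ?_ fun z hz => ?_)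
      (hf.comp (f := fun z : ℂ => Complex.exp (B * (z - y ⬝ᵥ y)) • y)
        ?_ fun z hz => ?_)
    · refine DifferentiableOn.smul_const (DifferentiableOn.mul ?_ (hh.mono fun z hz => hz.1)) _
      exact Differentiable.differentiableOn (by fun_prop)
    · simpa using (scaled_mem hε hz.2 (hh1 z hz.1)).2.2.2
    · exact Differentiable.differentiableOn (by fun_prop)
    · have := (scaled_mem hε hz.2 (hh1 z hz.1)).1
      have h0 := norm_nonneg (Complex.exp (B * (z - y ⬝ᵥ y)) • y)
      rw [mem_ball_zero_iff]
      linarith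
  have := cauchy_jump hA hd (h0.trans_lt h01) h1 h2 fun z hz => ⟨by
    have : c₁ ≤ ‖z‖ := by simpa using hz.2
    exact h01.trans_le this, he z hz.1⟩
  rw [cauchyPart, cauchyPart, this, cocycle]
  simp

end Cocycle

end TorusBlowup

namespace TorusBlowup

open Metric Set Filter Topology MeasureTheory

section Lattice

/-- Integer vectors as complex vectors. -/
def intC {n : ℕ} (l : Fin n → ℤ) : Fin n → ℂ := fun i => (l i : ℂ)

theorem norm_intC {n : ℕ} (l : Fin n → ℤ) : ‖intC l‖ = ‖l‖ := by
  simp [intC, Pi.norm_def, nnnorm, Int.norm_eq_abs]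

theorem summable_exp_neg_abs {t : ℝ} (ht : 0 < t) :
    Summable fun m : ℤ => Real.exp (-(|(m : ℝ)| * t)) := by
  refine Summable.of_nat_of_neg ?_ ?_ <;>
  · simp only [Int.cast_natCast, Int.cast_neg, abs_neg, Nat.abs_cast, ← mul_neg]
    exact Real.summable_exp_nat_mul_iff.2 (by linarith)

theorem summable_exp_neg_norm (n : ℕ) :
    Summable fun l : Fin n → ℤ => Real.exp (-‖l‖) := by
  have ht : (0 : ℝ) < 1 / (n + 1) := by positivity
  have hs := summable_exp_neg_abs ht
  have hprod : Summable fun l : Fin n → ℤ =>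
      ∏ i, Real.exp (-(|(l i : ℝ)| * (1 / (n + 1)))) := by
    refine summable_of_sum_le (c := (∑' m : ℤ, Real.exp (-(|(m : ℝ)| * (1 / (n + 1))))) ^ n)
      (fun l => Finset.prod_nonneg fun i _ => (Real.exp_pos _).le) fun u => ?_
    classical
    have hsub : u ⊆ Fintype.piFinset fun i : Fin n => u.image fun l => l i := fun l hl =>
      Fintype.mem_piFinset.2 fun i => Finset.mem_image_of_mem _ hl
    refine (Finset.sum_le_sum_of_subset_of_nonneg hsub fun l _ _ =>
      Finset.prod_nonneg fun i _ => (Real.exp_pos _).le).trans ?_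
    rw [← Finset.prod_univ_sum (fun i : Fin n => u.image fun l => l i)
      (fun _ (m : ℤ) => Real.exp (-(|(m : ℝ)| * (1 / (n + 1)))))]
    refine (Finset.prod_le_prod (fun i _ => Finset.sum_nonneg fun _ _ => (Real.exp_pos _).le)
      fun i _ => hs.sum_le_tsum _ fun _ _ => (Real.exp_pos _).le).trans ?_
    simp
  refine Summable.of_nonneg_of_le (fun l => (Real.exp_pos _).le) (fun l => ?_) hprod
  rw [← Real.exp_sum, Real.exp_le_exp, Finset.sum_neg_distrib, neg_le_neg_iff, ← Finset.sum_mul,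
    mul_one_div, div_le_iff₀ (by positivity)]
  calc ∑ i, |(l i : ℝ)| ≤ ∑ _i : Fin n, ‖l‖ := Finset.sum_le_sum fun i _ => by
        simpa [Int.norm_eq_abs] using norm_le_pi_norm l i
    _ = n * ‖l‖ := by simp
    _ ≤ ‖l‖ * (n + 1) := by nlinarith [norm_nonneg l]

end Lattice

/-- Numerical data entering the solution of the additive Cousin problem. -/
structure CousinData (n : ℕ) where
  /-- The radius of the polydisc. -/
  r : ℝ
  /-- The size of the perturbation. -/
  ε : ℝ
  /-- The transition function. -/
  h : ℂ → ℂ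
  /-- The inverse transition function. -/
  k : ℂ → ℂ
  r_pos : 0 < r
  r_le : 8 * (n + 1) * r ≤ 1
  ε_nonneg : 0 ≤ ε
  ε_le : 12 * (n + 1) * ε ≤ 1
  dh : DifferentiableOn ℂ h {z | r ^ 2 / 65536 < ‖z‖}
  dk : DifferentiableOn ℂ k {z | r ^ 2 / 65536 < ‖z‖}
  h_near : ∀ z, r ^ 2 / 65536 < ‖z‖ → ‖h z - 1‖ ≤ ε
  k_near : ∀ z, r ^ 2 / 65536 < ‖z‖ → ‖k z - 1‖ ≤ ε

namespace CousinData

variable {n : ℕ} (D : CousinData n)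

/-- The inner radius. -/
noncomputable def c₁ : ℝ := D.r ^ 2 / 32768

/-- The outer radius. -/
noncomputable def c₂ : ℝ := D.r ^ 2 / 128

/-- The Gaussian weight. -/
noncomputable def B : ℝ := 64 / D.r ^ 2

theorem c₁_pos : 0 < D.c₁ := by have := D.r_pos; unfold c₁; positivity

theorem r_le_one : D.r ≤ 1 / 8 := by
  have h1 := D.r_le
  have h2 := D.r_pos
  have h3 : (0 : ℝ) ≤ n := n.cast_nonneg
  nlinarith

theorem ε_le_one : D.ε ≤ 1 / 12 := by
  have h1 := D.ε_le
  have h2 := D.ε_nonneg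
  have h3 : (0 : ℝ) ≤ n := n.cast_nonneg
  nlinarith

theorem n_ε_le : (n : ℝ) * D.ε ≤ 1 / 12 := by
  have h1 := D.ε_le
  have h2 := D.ε_nonneg
  nlinarith

theorem mem_of_sphere {z : ℂ} {c : ℝ} (hc : D.c₁ ≤ c) (hz : z ∈ sphere (0 : ℂ) c) :
    D.r ^ 2 / 65536 < ‖z‖ := by
  rw [mem_sphere_zero_iff_norm] at hz
  have := D.c₁_pos
  unfold c₁ at *
  linarith

/-- Points with dominating real direction, off the zero locus of the quadratic form. -/
def Ω : Set (Fin n → ℂ) := {x | ‖x‖ ^ 2 < 2 * (x ⬝ᵥ x).re ∧ 2 * D.c₁ < ‖x ⬝ᵥ x‖}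

/-- An auxiliary enlargement of `Ω`. -/
def Ω' : Set (Fin n → ℂ) := {x | ‖x‖ ^ 2 < 5 * (x ⬝ᵥ x).re ∧ 3 / 2 * D.c₁ < ‖x ⬝ᵥ x‖}

theorem isOpen_Ω' : IsOpen D.Ω' := by
  have := continuous_dotProduct_self (n := n)
  have h1 : Continuous fun x : Fin n → ℂ => 5 * (x ⬝ᵥ x).re :=
    continuous_const.mul (Complex.continuous_re.comp this)
  exact (isOpen_lt (f := fun x : Fin n → ℂ => ‖x‖ ^ 2) (by fun_prop) h1).inter
    (isOpen_lt (g := fun x : Fin n → ℂ => ‖x ⬝ᵥ x‖) continuous_const this.norm)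

end CousinData

theorem norm_dotProduct_self_le {n : ℕ} (x : Fin n → ℂ) : ‖x ⬝ᵥ x‖ ≤ n * ‖x‖ ^ 2 := by
  calc ‖x ⬝ᵥ x‖ ≤ ∑ i, ‖x i * x i‖ := norm_sum_le _ _
    _ ≤ ∑ _i : Fin n, ‖x‖ ^ 2 := Finset.sum_le_sum fun i _ => by
        rw [norm_mul, ← sq]; gcongr; exact norm_le_pi_norm x i
    _ = n * ‖x‖ ^ 2 := by simp

theorem le_re_dotProduct_self {n : ℕ} {x : Fin n → ℂ} {s : ℝ} (hs : ∀ i, |(x i).im| ≤ s) :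
    ‖x‖ ^ 2 - (n + 1) * s ^ 2 ≤ (x ⬝ᵥ x).re := by
  have hre : (x ⬝ᵥ x).re = ∑ i, ((x i).re ^ 2 - (x i).im ^ 2) := by
    simp [dotProduct, Complex.re_sum, sq]
  have him : ∀ i, (x i).im ^ 2 ≤ s ^ 2 := fun i => sq_le_sq' (by linarith [abs_le.1 (hs i)])
    (abs_le.1 (hs i)).2
  have h1 : ∑ i, (x i).re ^ 2 - n * s ^ 2 ≤ (x ⬝ᵥ x).re := by
    rw [hre, Finset.sum_sub_distrib]
    have : ∑ i, (x i).im ^ 2 ≤ ∑ _i : Fin n, s ^ 2 := Finset.sum_le_sum fun i _ => him i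
    simp at this
    linarith
  have h2 : ‖x‖ ^ 2 ≤ ∑ i, (x i).re ^ 2 + s ^ 2 := by
    have h0 : 0 ≤ ∑ i, (x i).re ^ 2 + s ^ 2 := by positivity
    rw [← Real.le_sqrt (norm_nonneg _) h0, pi_norm_le_iff_of_nonneg (Real.sqrt_nonneg _)]
    intro i
    rw [Real.le_sqrt (norm_nonneg _) h0, Complex.sq_norm, Complex.normSq_apply]
    have := Finset.single_le_sum (f := fun i => (x i).re ^ 2) (fun i _ => sq_nonneg _)
      (Finset.mem_univ i)
    have h3 := him i
    nlinarith
  linarith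

namespace CousinData

variable {n : ℕ} (D : CousinData n)

theorem mem_Ω {x : Fin n → ℂ} {s : ℝ} (hs : ∀ i, |(x i).im| ≤ s)
    (h1 : 2 * D.c₁ < (x ⬝ᵥ x).re) (h2 : (n + 1) * s ^ 2 < (x ⬝ᵥ x).re) : x ∈ D.Ω :=
  ⟨by linarith [le_re_dotProduct_self hs], h1.trans_le (Complex.re_le_norm _)⟩

theorem exp_bound {y : Fin n → ℂ} (hy : y ∈ D.Ω') {z : ℂ} (hz : z ∈ sphere (0 : ℂ) D.c₁) :
    ‖Complex.exp (D.B * (z - y ⬝ᵥ y))‖ * ‖y‖ ≤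
      2 * (‖y‖ * Real.exp (-(64 / 5 * (‖y‖ / D.r) ^ 2))) := by
  have hr := D.r_pos
  have h1 : (D.B * (z - y ⬝ᵥ y) : ℂ).re ≤ 1 / 512 + -(64 / 5 * (‖y‖ / D.r) ^ 2) := by
    have h2 : (D.B * (z - y ⬝ᵥ y) : ℂ).re = D.B * (z.re - (y ⬝ᵥ y).re) := by simp
    have h3 : z.re ≤ D.c₁ := (Complex.re_le_norm z).trans (mem_sphere_zero_iff_norm.1 hz).le
    have h4 := hy.1
    have h5 : D.B * (z.re - (y ⬝ᵥ y).re) ≤ D.B * (D.c₁ - ‖y‖ ^ 2 / 5) := by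
      have : 0 ≤ D.B := by unfold B; positivity
      exact mul_le_mul_of_nonneg_left (by linarith) this
    rw [h2]
    refine h5.trans (le_of_eq ?_)
    unfold B c₁
    field_simp
    ring
  rw [Complex.norm_exp]
  have h6 : Real.exp (1 / 512) ≤ 2 := by
    have := Real.exp_bound_div_one_sub_of_interval (x := 1 / 512) (by norm_num) (by norm_num)
    linarith
  calc Real.exp (D.B * (z - y ⬝ᵥ y) : ℂ).re * ‖y‖
      ≤ Real.exp (1 / 512 + -(64 / 5 * (‖y‖ / D.r) ^ 2)) * ‖y‖ := by gcongr
    _ = Real.exp (1 / 512) * (‖y‖ * Real.exp (-(64 / 5 * (‖y‖ / D.r) ^ 2))) := by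
        rw [Real.exp_add]; ring
    _ ≤ _ := by gcongr

theorem mul_exp_neg_lt (y : Fin n → ℂ) :
    2 * (‖y‖ * Real.exp (-(64 / 5 * (‖y‖ / D.r) ^ 2))) < D.r / 3 := by
  have hr := D.r_pos
  set v := ‖y‖ / D.r with hv
  have hy : ‖y‖ = D.r * v := by rw [hv]; field_simp
  have hv0 : 0 ≤ v := by positivity
  have h1 : 1 + 64 / 5 * v ^ 2 ≤ Real.exp (64 / 5 * v ^ 2) := by
    linarith [Real.add_one_le_exp (64 / 5 * v ^ 2)]
  have h2 : Real.exp (-(64 / 5 * v ^ 2)) ≤ (1 + 64 / 5 * v ^ 2)⁻¹ := by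
    rw [Real.exp_neg]; exact inv_anti₀ (by positivity) h1
  have h3 : v * (1 + 64 / 5 * v ^ 2)⁻¹ < 1 / 6 := by
    rw [← div_eq_mul_inv, div_lt_iff₀ (by positivity)]
    nlinarith [sq_nonneg (v - 1 / 4)]
  rw [hy]
  calc 2 * (D.r * v * Real.exp (-(64 / 5 * v ^ 2)))
      ≤ 2 * (D.r * v * (1 + 64 / 5 * v ^ 2)⁻¹) := by gcongr
    _ = 2 * D.r * (v * (1 + 64 / 5 * v ^ 2)⁻¹) := by ring
    _ < 2 * D.r * (1 / 6) := by gcongr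
    _ = D.r / 3 := by ring

theorem dist_sphere {y : Fin n → ℂ} (hy : y ∈ D.Ω') {z : ℂ} (hz : z ∈ sphere (0 : ℂ) D.c₁) :
    D.c₁ / 2 ≤ ‖z - y ⬝ᵥ y‖ := by
  rw [mem_sphere_zero_iff_norm] at hz
  have h1 := norm_sub_norm_le (y ⬝ᵥ y) z
  rw [norm_sub_rev] at h1
  linarith [hy.2]

variable {f g : (Fin n → ℂ) → (Fin n → ℂ)} {M : ℝ}

theorem norm_cauchyPart_Ω' (hf : DifferentiableOn ℂ f (ball 0 D.r))
    (hM : ∀ x ∈ ball 0 D.r, ‖f x‖ ≤ M) (hM0 : 0 ≤ M) {y : Fin n → ℂ} (hy : y ∈ D.Ω') :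
    ‖cauchyPart D.B D.h D.c₁ f y‖ ≤
      12 * M * D.ε * (‖y‖ / D.r * Real.exp (-(64 / 5 * (‖y‖ / D.r) ^ 2))) := by
  have hc := D.c₁_pos
  have hr := D.r_pos
  refine (norm_cauchyPart_le hf hM hM0 D.ε_nonneg (by linarith [D.ε_le_one]) hc.le
    (d := D.c₁ / 2) (by linarith) (fun z hz => D.dist_sphere hy hz)
    (fun z hz => D.exp_bound hy hz) (D.mul_exp_neg_lt y)
    fun z hz => D.h_near z (D.mem_of_sphere le_rfl hz)).trans (le_of_eq ?_)
  field_simp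
  ring

theorem differentiableOn_cauchyPart_Ω' (hf : DifferentiableOn ℂ f (ball 0 D.r)) :
    DifferentiableOn ℂ (cauchyPart D.B D.h D.c₁ f) D.Ω' := by
  have hc := D.c₁_pos
  refine differentiableOn_cauchyPart D.isOpen_Ω' hf (ε := D.ε) (by linarith [D.ε_le_one]) hc.le
    (fun y hy => by linarith [hy.2]) (D.dh.continuousOn.mono fun z hz => D.mem_of_sphere le_rfl hz)
    (fun y hy z hz => (D.exp_bound hy hz).trans_lt (D.mul_exp_neg_lt y))
    fun z hz => D.h_near z (D.mem_of_sphere le_rfl hz)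

/-- The Cauchy part in the outer coordinate. -/
noncomputable def q (f : (Fin n → ℂ) → (Fin n → ℂ)) (x : Fin n → ℂ) : Fin n → ℂ :=
  cauchyPart D.B D.h D.c₁ f (D.k (x ⬝ᵥ x) • x)

theorem lt_of_mem_Ω {x : Fin n → ℂ} (hx : x ∈ D.Ω) : D.r ^ 2 / 65536 < ‖x ⬝ᵥ x‖ := by
  have := hx.2
  have h2 := D.c₁_pos
  unfold c₁ at *
  linarith

theorem smul_k_mem {x : Fin n → ℂ} (hx : x ∈ D.Ω) : D.k (x ⬝ᵥ x) • x ∈ D.Ω' ∧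
    11 / 12 * ‖x‖ ≤ ‖D.k (x ⬝ᵥ x) • x‖ ∧ ‖D.k (x ⬝ᵥ x) • x‖ ≤ 13 / 12 * ‖x‖ := by
  obtain ⟨h1, h2⟩ := id hx
  have hk := D.k_near _ (D.lt_of_mem_Ω hx)
  set k := D.k (x ⬝ᵥ x)
  set w := x ⬝ᵥ x with hw
  have hε := D.ε_le_one
  have hε0 := D.ε_nonneg
  have hc := D.c₁_pos
  have hk1 : 11 / 12 ≤ ‖k‖ := by
    have := norm_sub_norm_le (1 : ℂ) (1 - k)
    rw [norm_one, norm_sub_rev, sub_sub_cancel] at this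
    linarith
  have hk2 : ‖k‖ ≤ 13 / 12 := by
    have := norm_add_le (k - 1) 1
    rw [norm_one, sub_add_cancel] at this
    linarith
  have hn : ‖k • x‖ = ‖k‖ * ‖x‖ := norm_smul _ _
  have hW : (k • x) ⬝ᵥ (k • x) = k * k * w := by
    rw [smul_dotProduct, dotProduct_smul, smul_eq_mul, smul_eq_mul, mul_assoc]
  have hx0 := norm_nonneg x
  have hwle : ‖w‖ ≤ n * ‖x‖ ^ 2 := norm_dotProduct_self_le x
  have hdiff : ‖k * k * w - w‖ ≤ ‖x‖ ^ 2 / 4 := by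
    have h3 : k * k * w - w = (k - 1) * (k + 1) * w := by ring
    have h4 : ‖k + 1‖ ≤ 3 := by
      have := norm_add_le k 1
      rw [norm_one] at this
      linarith
    rw [h3, norm_mul, norm_mul]
    calc ‖k - 1‖ * ‖k + 1‖ * ‖w‖ ≤ D.ε * 3 * (n * ‖x‖ ^ 2) := by gcongr
      _ = 3 * (n * D.ε) * ‖x‖ ^ 2 := by ring
      _ ≤ 3 * (1 / 12) * ‖x‖ ^ 2 := by
        have := D.n_ε_le
        gcongr
      _ = _ := by ring
  have hre : ‖x‖ ^ 2 / 4 < (k * k * w).re := by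
    have h5 := Complex.abs_re_le_norm (k * k * w - w)
    rw [Complex.sub_re] at h5
    have := (abs_le.1 (h5.trans hdiff)).1
    linarith
  refine ⟨⟨?_, ?_⟩, ?_, ?_⟩
  · rw [hW, hn, mul_pow]
    have : ‖k‖ ^ 2 ≤ (13 / 12) ^ 2 := by gcongr
    nlinarith [sq_nonneg ‖x‖]
  · rw [hW, norm_mul, norm_mul]
    have : 121 / 144 ≤ ‖k‖ * ‖k‖ := by nlinarith
    nlinarith [norm_nonneg w]
  · rw [hn]; gcongr
  · rw [hn]; gcongr

theorem norm_q_le (hf : DifferentiableOn ℂ f (ball 0 D.r))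
    (hM : ∀ x ∈ ball 0 D.r, ‖f x‖ ≤ M) (hM0 : 0 ≤ M) {x : Fin n → ℂ} (hx : x ∈ D.Ω) :
    ‖D.q f x‖ ≤ 12 * M * D.ε * Real.exp (1 - ‖x‖) := by
  obtain ⟨h1, h2, h3⟩ := D.smul_k_mem hx
  refine (D.norm_cauchyPart_Ω' hf hM hM0 h1).trans ?_
  have hr := D.r_pos
  have hr1 := D.r_le_one
  have hε0 := D.ε_nonneg
  set y := D.k (x ⬝ᵥ x) • x
  set v := ‖y‖ / D.r with hv
  have hvx : ‖x‖ ≤ v := by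
    rw [hv, le_div_iff₀ hr]
    nlinarith [norm_nonneg x]
  have hv0 : 0 ≤ v := by positivity
  gcongr
  calc v * Real.exp (-(64 / 5 * v ^ 2)) ≤ Real.exp v * Real.exp (-(64 / 5 * v ^ 2)) := by
        gcongr
        linarith [Real.add_one_le_exp v]
    _ = Real.exp (v + -(64 / 5 * v ^ 2)) := by rw [Real.exp_add]
    _ ≤ Real.exp (1 - ‖x‖) := by
        rw [Real.exp_le_exp]
        nlinarith [sq_nonneg (v - 1)]

theorem differentiableOn_q (hf : DifferentiableOn ℂ f (ball 0 D.r)) :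
    DifferentiableOn ℂ (D.q f) D.Ω := by
  refine (D.differentiableOn_cauchyPart_Ω' hf).comp
    (f := fun x : Fin n → ℂ => D.k (x ⬝ᵥ x) • x) ?_ fun x hx => (D.smul_k_mem hx).1
  exact (D.dk.comp differentiable_dotProduct_self.differentiableOn
    fun x hx => D.lt_of_mem_Ω hx).smul differentiableOn_id

theorem q_sub (hf : DifferentiableOn ℂ f (ball 0 D.r)) (hg : DifferentiableOn ℂ g (ball 0 D.r))
    {x : Fin n → ℂ} (hx : x ∈ D.Ω) : D.q (f - g) x = D.q f x - D.q g x := by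
  have h1 := (D.smul_k_mem hx).1
  have hc := D.c₁_pos
  exact cauchyPart_sub hf hg (ε := D.ε) (by linarith [D.ε_le_one]) hc.le
    (by linarith [h1.2]) (D.dh.continuousOn.mono fun z hz => D.mem_of_sphere le_rfl hz)
    (fun z hz => (D.exp_bound h1 hz).trans_lt (D.mul_exp_neg_lt _))
    fun z hz => D.h_near z (D.mem_of_sphere le_rfl hz)

end CousinData

end TorusBlowup

namespace TorusBlowup

open Metric Set Filter Topology MeasureTheory

/-- A constant controlling lattice sums. -/
noncomputable def latticeConst (n : ℕ) : ℝ :=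
  ∑' l : Fin n → ℤ, 12 * Real.exp 3 * Real.exp (-‖l‖)

theorem latticeConst_nonneg (n : ℕ) : 0 ≤ latticeConst n := tsum_nonneg fun l => by positivity

namespace CousinData

variable {n : ℕ} (D : CousinData n) {f g : (Fin n → ℂ) → (Fin n → ℂ)} {M : ℝ}
  {S : Set (Fin n → ℤ)}

open Classical in
/-- The lattice sum of translates of the Cauchy part over the index set `S`. -/
noncomputable def qsum (f : (Fin n → ℂ) → (Fin n → ℂ)) (S : Set (Fin n → ℤ)) (x : Fin n → ℂ) :
    Fin n → ℂ :=
  ∑' l : Fin n → ℤ, if l ∈ S then D.q f (x - intC l) else 0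

open Classical in
theorem norm_qterm_le (hf : DifferentiableOn ℂ f (ball 0 D.r))
    (hM : ∀ x ∈ ball 0 D.r, ‖f x‖ ≤ M) (hM0 : 0 ≤ M) {x : Fin n → ℂ} (hx : ‖x‖ ≤ 2)
    (hS : ∀ l ∈ S, x - intC l ∈ D.Ω) (l : Fin n → ℤ) :
    ‖if l ∈ S then D.q f (x - intC l) else 0‖ ≤
      D.ε * M * (12 * Real.exp 3 * Real.exp (-‖l‖)) := by
  have hε0 := D.ε_nonneg
  split_ifs with h
  · refine (D.norm_q_le hf hM hM0 (hS l h)).trans ?_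
    have h1 := norm_sub_norm_le (intC l) x
    rw [norm_sub_rev, norm_intC] at h1
    calc 12 * M * D.ε * Real.exp (1 - ‖x - intC l‖) ≤ 12 * M * D.ε * Real.exp (3 + -‖l‖) := by
          gcongr
          linarith
      _ = _ := by rw [Real.exp_add]; ring
  · rw [norm_zero]; positivity

theorem summable_bound (n : ℕ) (c : ℝ) :
    Summable fun l : Fin n → ℤ => c * (12 * Real.exp 3 * Real.exp (-‖l‖)) :=
  ((summable_exp_neg_norm n).mul_left _).mul_left _

theorem norm_qsum_le (hf : DifferentiableOn ℂ f (ball 0 D.r))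
    (hM : ∀ x ∈ ball 0 D.r, ‖f x‖ ≤ M) (hM0 : 0 ≤ M) {x : Fin n → ℂ} (hx : ‖x‖ ≤ 2)
    (hS : ∀ l ∈ S, x - intC l ∈ D.Ω) : ‖D.qsum f S x‖ ≤ latticeConst n * D.ε * M := by
  refine (tsum_of_norm_bounded (summable_bound n (D.ε * M)).hasSum
    (D.norm_qterm_le hf hM hM0 hx hS)).trans (le_of_eq ?_)
  rw [tsum_mul_left, latticeConst]
  ring

open Classical in
theorem summable_qterm (hf : DifferentiableOn ℂ f (ball 0 D.r))
    (hM : ∀ x ∈ ball 0 D.r, ‖f x‖ ≤ M) (hM0 : 0 ≤ M) {x : Fin n → ℂ} (hx : ‖x‖ ≤ 2)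
    (hS : ∀ l ∈ S, x - intC l ∈ D.Ω) :
    Summable fun l => if l ∈ S then D.q f (x - intC l) else 0 := by
  exact Summable.of_norm_bounded (summable_bound n (D.ε * M)) (D.norm_qterm_le hf hM hM0 hx hS)

theorem differentiableOn_qsum (hf : DifferentiableOn ℂ f (ball 0 D.r))
    (hM : ∀ x ∈ ball 0 D.r, ‖f x‖ ≤ M) (hM0 : 0 ≤ M) {V : Set (Fin n → ℂ)} (hV : IsOpen V)
    (hV2 : ∀ x ∈ V, ‖x‖ ≤ 2) (hS : ∀ x ∈ V, ∀ l ∈ S, x - intC l ∈ D.Ω) :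
    DifferentiableOn ℂ (D.qsum f S) V := by
  classical
  refine differentiableOn_tsum hV (summable_bound n (D.ε * M)) (fun l => ?_)
    fun l x hx => D.norm_qterm_le hf hM hM0 (hV2 x hx) (hS x hx) l
  by_cases h : l ∈ S
  · simp only [h, if_true]
    exact (D.differentiableOn_q hf).comp (f := fun x => x - intC l)
      (Differentiable.differentiableOn (by fun_prop)) fun x hx => hS x hx l h
  · simp only [h, if_false]
    exact differentiableOn_const _

theorem qsum_sub {M' : ℝ} (hf : DifferentiableOn ℂ f (ball 0 D.r))
    (hM : ∀ x ∈ ball 0 D.r, ‖f x‖ ≤ M) (hg : DifferentiableOn ℂ g (ball 0 D.r))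
    (hM' : ∀ x ∈ ball 0 D.r, ‖g x‖ ≤ M') (hM0 : 0 ≤ M) (hM0' : 0 ≤ M') {x : Fin n → ℂ}
    (hx : ‖x‖ ≤ 2) (hS : ∀ l ∈ S, x - intC l ∈ D.Ω) :
    D.qsum (f - g) S x = D.qsum f S x - D.qsum g S x := by
  classical
  unfold qsum
  rw [← (D.summable_qterm hf hM hM0 hx hS).tsum_sub (D.summable_qterm hg hM' hM0' hx hS)]
  refine tsum_congr fun l => ?_
  split_ifs with h
  · exact D.q_sub hf hg (hS l h)
  · simp

theorem sub_intC_mem {x : Fin n → ℂ} (hx : x ∈ ball 0 D.r) {l : Fin n → ℤ} (hl : l ≠ 0) :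
    x - intC l ∈ D.Ω := by
  rw [mem_ball_zero_iff] at hx
  have hr := D.r_pos
  have hr1 := D.r_le_one
  have him : ∀ i, |((x - intC l) i).im| ≤ D.r := fun i => by
    have h1 : ((x - intC l) i).im = (x i).im := by simp [intC]
    rw [h1]
    exact (Complex.abs_im_le_norm _).trans ((norm_le_pi_norm x i).trans hx.le)
  have h1 : 1 ≤ ‖l‖ := by
    obtain ⟨i, hi⟩ := Function.ne_iff.1 hl
    refine le_trans ?_ (norm_le_pi_norm l i)
    rw [Int.norm_eq_abs]
    exact_mod_cast Int.one_le_abs hi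
  have h2 : 7 / 8 ≤ ‖x - intC l‖ := by
    have h1 := norm_sub_norm_le (intC l) x
    rw [norm_sub_rev, norm_intC] at h1
    linarith
  have h3 := le_re_dotProduct_self him
  have h4 : (n + 1) * D.r ^ 2 ≤ 1 / 64 := by
    have := D.r_le
    have h5 : (n + 1) * D.r ^ 2 = ((n + 1) * D.r) * D.r := by ring
    rw [h5]
    nlinarith
  have h5 : D.c₁ ≤ 1 / 64 := by unfold c₁; nlinarith
  refine D.mem_Ω him ?_ ?_ <;> nlinarith

/-- The sum of the contributions of the other lattice points. -/
noncomputable def δ (f : (Fin n → ℂ) → (Fin n → ℂ)) : (Fin n → ℂ) → (Fin n → ℂ) :=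
  D.qsum f {l | l ≠ 0}

theorem ball_le_two {x : Fin n → ℂ} (hx : x ∈ ball 0 D.r) : ‖x‖ ≤ 2 := by
  rw [mem_ball_zero_iff] at hx
  linarith [D.r_le_one]

theorem differentiableOn_δ (hf : DifferentiableOn ℂ f (ball 0 D.r))
    (hM : ∀ x ∈ ball 0 D.r, ‖f x‖ ≤ M) (hM0 : 0 ≤ M) :
    DifferentiableOn ℂ (D.δ f) (ball 0 D.r) :=
  D.differentiableOn_qsum hf hM hM0 isOpen_ball (fun _ hx => D.ball_le_two hx)
    fun _ hx _ hl => D.sub_intC_mem hx hl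

theorem norm_δ_le (hf : DifferentiableOn ℂ f (ball 0 D.r))
    (hM : ∀ x ∈ ball 0 D.r, ‖f x‖ ≤ M) (hM0 : 0 ≤ M) {x : Fin n → ℂ} (hx : x ∈ ball 0 D.r) :
    ‖D.δ f x‖ ≤ latticeConst n * D.ε * M :=
  D.norm_qsum_le hf hM hM0 (D.ball_le_two hx) fun _ hl => D.sub_intC_mem hx hl

theorem norm_δ_sub_le {m : ℝ} (hf : DifferentiableOn ℂ f (ball 0 D.r))
    (hM : ∀ x ∈ ball 0 D.r, ‖f x‖ ≤ M) (hg : DifferentiableOn ℂ g (ball 0 D.r))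
    (hM' : ∀ x ∈ ball 0 D.r, ‖g x‖ ≤ M) (hM0 : 0 ≤ M)
    (hm : ∀ x ∈ ball 0 D.r, ‖f x - g x‖ ≤ m) (hm0 : 0 ≤ m) {x : Fin n → ℂ}
    (hx : x ∈ ball 0 D.r) :
    ‖D.δ f x - D.δ g x‖ ≤ latticeConst n * D.ε * m := by
  rw [δ, δ, ← D.qsum_sub (S := {l | l ≠ 0}) hf hM hg hM' hM0 hM0 (D.ball_le_two hx) fun _ hl => D.sub_intC_mem hx hl]
  exact D.norm_qsum_le (hf.sub hg) hm hm0 (D.ball_le_two hx) fun _ hl => D.sub_intC_mem hx hl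

/-- The iterates converging to the solution. -/
noncomputable def iter : ℕ → (Fin n → ℂ) → (Fin n → ℂ)
  | 0 => id
  | j + 1 => id + D.δ (iter j)

theorem iter_spec (hK : latticeConst n * D.ε ≤ 1 / 2) (j : ℕ) :
    DifferentiableOn ℂ (D.iter j) (ball 0 D.r) ∧
    ∀ x ∈ ball 0 D.r, ‖D.iter j x‖ ≤ 2 * D.r := by
  have hr := D.r_pos
  induction j with
  | zero =>
    refine ⟨differentiableOn_id, fun x hx => ?_⟩
    rw [mem_ball_zero_iff] at hx
    change ‖x‖ ≤ _
    linarith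
  | succ j ih =>
    refine ⟨differentiableOn_id.add (D.differentiableOn_δ ih.1 ih.2 (by positivity)),
      fun x hx => ?_⟩
    have h1 := D.norm_δ_le ih.1 ih.2 (by positivity) hx
    rw [mem_ball_zero_iff] at hx
    refine (norm_add_le x (D.δ (D.iter j) x)).trans ?_
    nlinarith

theorem iter_dist (hK : latticeConst n * D.ε ≤ 1 / 2) (j : ℕ) : ∀ x ∈ ball 0 D.r,
    ‖D.iter (j + 1) x - D.iter j x‖ ≤ 2 * D.r * (1 / 2) ^ j := by
  have hr := D.r_pos
  induction j with
  | zero =>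
    intro x hx
    have h1 := D.norm_δ_le (D.iter_spec hK 0).1 (D.iter_spec hK 0).2 (by positivity) hx
    have : D.iter (0 + 1) x - D.iter 0 x = D.δ (D.iter 0) x := add_sub_cancel_left x _
    rw [this]
    nlinarith
  | succ j ih =>
    intro x hx
    obtain ⟨h1, h2⟩ := D.iter_spec hK j
    obtain ⟨h3, h4⟩ := D.iter_spec hK (j + 1)
    have h5 := D.norm_δ_sub_le h3 h4 h1 h2 (by positivity) ih (by positivity) hx
    have : D.iter (j + 1 + 1) x - D.iter (j + 1) x = D.δ (D.iter (j + 1)) x - D.δ (D.iter j) x :=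
      add_sub_add_left_eq_sub _ _ x
    rw [this]
    refine h5.trans ?_
    have : 0 ≤ 2 * D.r * (1 / 2) ^ j := by positivity
    rw [pow_succ]
    nlinarith

/-- The solution of the additive Cousin problem. -/
theorem exists_fixed (hK : latticeConst n * D.ε ≤ 1 / 2) :
    ∃ f : (Fin n → ℂ) → (Fin n → ℂ),
    DifferentiableOn ℂ f (ball 0 D.r) ∧ (∀ x ∈ ball 0 D.r, ‖f x‖ ≤ 2 * D.r) ∧
    ∀ x ∈ ball 0 D.r, f x = x + D.δ f x := by
  have hr := D.r_pos
  have hdist : ∀ x ∈ ball (0 : Fin n → ℂ) D.r, ∀ j,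
      dist (D.iter j x) (D.iter (j + 1) x) ≤ 2 * D.r * (1 / 2) ^ j := fun x hx j => by
    rw [dist_comm, dist_eq_norm]; exact D.iter_dist hK j x hx
  have hex : ∀ x, ∃ y, x ∈ ball (0 : Fin n → ℂ) D.r →
      Tendsto (fun j => D.iter j x) atTop (𝓝 y) := by
    intro x
    by_cases hx : x ∈ ball (0 : Fin n → ℂ) D.r
    · obtain ⟨y, hy⟩ := cauchySeq_tendsto_of_complete
        (cauchySeq_of_le_geometric (1 / 2) _ (by norm_num) (hdist x hx))
      exact ⟨y, fun _ => hy⟩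
    · exact ⟨0, fun h => absurd h hx⟩
  choose f hf using hex
  have hb : ∀ x ∈ ball (0 : Fin n → ℂ) D.r, ∀ j,
      ‖D.iter j x - f x‖ ≤ 4 * D.r * (1 / 2) ^ j := by
    intro x hx j
    have := dist_le_of_le_geometric_of_tendsto (1 / 2) _ (by norm_num) (hdist x hx) (hf x hx) j
    rw [dist_eq_norm] at this
    refine this.trans (le_of_eq ?_)
    ring
  have hlim : Tendsto (fun j : ℕ => 4 * D.r * (1 / 2 : ℝ) ^ j) atTop (𝓝 0) := by
    simpa using (tendsto_pow_atTop_nhds_zero_of_lt_one (r := (1 / 2 : ℝ)) (by norm_num)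
      (by norm_num)).const_mul (4 * D.r)
  have hu : TendstoUniformlyOn D.iter f atTop (ball 0 D.r) := by
    rw [Metric.tendstoUniformlyOn_iff]
    intro e he
    filter_upwards [hlim.eventually (gt_mem_nhds he)] with j hj x hx
    rw [dist_comm, dist_eq_norm]
    exact (hb x hx j).trans_lt hj
  have hd := differentiableOn_of_tendstoUniformlyOn isOpen_ball
    (fun j => (D.iter_spec hK j).1) hu
  have hbd : ∀ x ∈ ball (0 : Fin n → ℂ) D.r, ‖f x‖ ≤ 2 * D.r := fun x hx =>
    le_of_tendsto (hf x hx).norm (Eventually.of_forall fun j => (D.iter_spec hK j).2 x hx)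
  refine ⟨f, hd, hbd, fun x hx => ?_⟩
  have h1 : Tendsto (fun j => D.δ (D.iter j) x) atTop (𝓝 (D.δ f x)) := by
    rw [tendsto_iff_norm_sub_tendsto_zero]
    refine squeeze_zero (fun _ => norm_nonneg _) (fun j => ?_) hlim
    refine (D.norm_δ_sub_le (D.iter_spec hK j).1 (D.iter_spec hK j).2 hd hbd (by positivity)
      (fun x hx => hb x hx j) (by positivity) hx).trans ?_
    have : 0 ≤ 4 * D.r * (1 / 2 : ℝ) ^ j := by positivity
    nlinarith
  have h2 : Tendsto (fun j => D.iter (j + 1) x) atTop (𝓝 (x + D.δ f x)) := h1.const_add x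
  exact tendsto_nhds_unique ((tendsto_add_atTop_iff_nat 1).2 (hf x hx)) h2

end CousinData

end TorusBlowup

namespace TorusBlowup

open Metric Set Filter Topology MeasureTheory

section RealPart

variable {n : ℕ}

/-- The inclusion of real vectors into complex vectors. -/
noncomputable def toC (n : ℕ) : (Fin n → ℝ) →L[ℝ] (Fin n → ℂ) :=
  ContinuousLinearMap.pi fun i => Complex.ofRealCLM ∘L ContinuousLinearMap.proj i

/-- The real part of a complex vector. -/
noncomputable def reV (n : ℕ) : (Fin n → ℂ) →L[ℝ] (Fin n → ℝ) :=
  ContinuousLinearMap.pi fun i => Complex.reCLM ∘L ContinuousLinearMap.proj i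

@[simp] theorem toC_apply (x : Fin n → ℝ) (i : Fin n) : toC n x i = (x i : ℂ) := rfl

@[simp] theorem reV_apply (x : Fin n → ℂ) (i : Fin n) : reV n x i = (x i).re := rfl

@[simp] theorem reV_toC (x : Fin n → ℝ) : reV n (toC n x) = x := by ext i; simp

theorem norm_toC (x : Fin n → ℝ) : ‖toC n x‖ = ‖x‖ := by
  simp [Pi.norm_def, nnnorm]

theorem norm_reV_le (x : Fin n → ℂ) : ‖reV n x‖ ≤ ‖x‖ :=
  (pi_norm_le_iff_of_nonneg (norm_nonneg _)).2 fun i =>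
    (Complex.abs_re_le_norm _).trans (norm_le_pi_norm x i)

theorem toC_dotProduct (x : Fin n → ℝ) : toC n x ⬝ᵥ toC n x = ((x ⬝ᵥ x : ℝ) : ℂ) := by
  simp [dotProduct]

theorem toC_intC (l : Fin n → ℤ) : toC n (fun i => (l i : ℝ)) = intC l := by
  ext i; simp [intC]

theorem real_part_estimate {F : (Fin n → ℂ) → (Fin n → ℂ)} {x₀ : Fin n → ℝ} {ρ m : ℝ}
    (hρ : 0 < ρ) (hF : DifferentiableOn ℂ F (ball (toC n x₀) ρ))
    (hm : ∀ z ∈ ball (toC n x₀) ρ, ‖F z‖ ≤ m) :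
    ContDiffAt ℝ ω (fun x => reV n (F (toC n x))) x₀ ∧
      ‖reV n (F (toC n x₀))‖ ≤ m ∧
      ‖fderiv ℝ (fun x => reV n (F (toC n x))) x₀‖ ≤ 2 * m / ρ := by
  have hself : toC n x₀ ∈ ball (toC n x₀) ρ := mem_ball_self hρ
  have hm0 : 0 ≤ m := (norm_nonneg _).trans (hm _ hself)
  have han : AnalyticAt ℝ F (toC n x₀) :=
    (analyticOnNhd_of_differentiableOn isOpen_ball hF _ hself).restrictScalars
  have hC : ContDiffAt ℝ ω (fun x => reV n (F (toC n x))) x₀ :=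
    (reV n).contDiff.contDiffAt.comp x₀ (han.contDiffAt.comp x₀ (toC n).contDiff.contDiffAt)
  refine ⟨hC, (norm_reV_le _).trans (hm _ hself), ?_⟩
  refine (hC.differentiableAt (by simp)).hasFDerivAt.le_of_lip' (by positivity) ?_
  filter_upwards [ball_mem_nhds x₀ hρ] with x hx
  rw [← map_sub]
  refine (norm_reV_le _).trans ?_
  have hx' : toC n x ∈ ball (toC n x₀) ρ := by
    rw [mem_ball, dist_eq_norm, ← map_sub, norm_toC]
    exact mem_ball_iff_norm.1 hx
  have h1 := Complex.dist_le_div_mul_dist_of_mapsTo_ball hF (R₂ := 2 * m)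
    (fun z hz => by
      rw [mem_closedBall, dist_eq_norm]
      have h1 := hm z hz
      have h2 := hm _ hself
      linarith [norm_sub_le (F z) (F (toC n x₀))]) hx'
  rwa [dist_eq_norm, dist_eq_norm, ← map_sub, norm_toC] at h1

theorem norm_sq_le_dotProduct (x : Fin n → ℝ) : ‖x‖ ^ 2 ≤ x ⬝ᵥ x := by
  have h0 : 0 ≤ x ⬝ᵥ x := Finset.sum_nonneg fun i _ => mul_self_nonneg _
  rw [← Real.le_sqrt (norm_nonneg _) h0, pi_norm_le_iff_of_nonneg (Real.sqrt_nonneg _)]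
  intro i
  rw [Real.le_sqrt (norm_nonneg _) h0, Real.norm_eq_abs, sq_abs, sq]
  exact Finset.single_le_sum (f := fun i => x i * x i) (fun i _ => mul_self_nonneg _)
      (Finset.mem_univ i)

theorem dotProduct_le_norm_sq (x : Fin n → ℝ) : x ⬝ᵥ x ≤ n * ‖x‖ ^ 2 := by
  have := norm_dotProduct_self_le (toC n x)
  rw [toC_dotProduct, norm_toC, Complex.norm_real] at this
  exact (le_abs_self _).trans this

theorem le_re_dotProduct_add (y : Fin n → ℝ) {v : Fin n → ℂ} {ρ : ℝ} (hv : ‖v‖ ≤ ρ) :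
    3 / 4 * (y ⬝ᵥ y) - 3 * n * ρ ^ 2 ≤ ((toC n y + v) ⬝ᵥ (toC n y + v)).re := by
  have : 3 / 4 * (y ⬝ᵥ y) - 3 * n * ρ ^ 2 = ∑ i, (3 / 4 * (y i * y i) - 3 * ρ ^ 2) := by
    rw [Finset.sum_sub_distrib, ← Finset.mul_sum]
    simp [dotProduct]
    ring
  rw [this, dotProduct, Complex.re_sum]
  refine Finset.sum_le_sum fun i _ => ?_
  have h1 : (v i).re ^ 2 + (v i).im ^ 2 ≤ ρ ^ 2 := by
    have := (norm_le_pi_norm v i).trans hv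
    have h2 : ‖v i‖ ^ 2 ≤ ρ ^ 2 := by gcongr
    rw [Complex.sq_norm, Complex.normSq_apply] at h2
    linarith
  simp
  nlinarith [sq_nonneg (y i + 4 * (v i).re), sq_nonneg (y i / 2 + 2 * (v i).re),
    sq_nonneg (v i).im]

end RealPart

namespace CousinData

variable {n : ℕ} (D : CousinData n) {f : (Fin n → ℂ) → (Fin n → ℂ)}

theorem exp_bound_outer {y : Fin n → ℂ} (hy : ‖y ⬝ᵥ y‖ ≤ D.c₂) {z : ℂ} (hz : ‖z‖ ≤ D.c₂) :
    ‖Complex.exp (D.B * (z - y ⬝ᵥ y))‖ * ‖y‖ ≤ Real.exp 1 * ‖y‖ := by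
  have hr := D.r_pos
  rw [Complex.norm_exp]
  gcongr
  have h2 : (D.B * (z - y ⬝ᵥ y) : ℂ).re = D.B * (z - y ⬝ᵥ y).re := by simp
  have h3 : (z - y ⬝ᵥ y).re ≤ 2 * D.c₂ :=
    (Complex.re_le_norm _).trans ((norm_sub_le _ _).trans (by linarith))
  have hB : 0 ≤ D.B := by unfold B; positivity
  rw [h2]
  refine (mul_le_mul_of_nonneg_left h3 hB).trans (le_of_eq ?_)
  unfold B c₂
  field_simp
  norm_num

theorem exp_mul_lt {t : ℝ} (ht : t < D.r / 9) : Real.exp 1 * t < D.r / 3 := by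
  have h3 : Real.exp 1 < 3 := Real.exp_one_lt_three
  have := D.r_pos
  by_cases h : 0 ≤ t
  · nlinarith
  · nlinarith [Real.exp_pos 1]

/-- The domain of the inner chart. -/
def Ωin : Set (Fin n → ℂ) := {y | ‖y‖ < D.r / 9 ∧ ‖y ⬝ᵥ y‖ < D.c₂ / 2}

theorem c₁_lt_c₂ : D.c₁ < D.c₂ := by
  have := D.r_pos
  unfold c₁ c₂
  nlinarith

theorem isOpen_Ωin : IsOpen D.Ωin := by
  have := continuous_dotProduct_self (n := n)
  exact (isOpen_lt (f := fun x : Fin n → ℂ => ‖x‖) (by fun_prop) continuous_const).inter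
    (isOpen_lt (f := fun x : Fin n → ℂ => ‖x ⬝ᵥ x‖) this.norm continuous_const)

theorem Ωin_subset {y : Fin n → ℂ} (hy : y ∈ D.Ωin) : y ∈ ball 0 D.r := by
  rw [mem_ball_zero_iff]
  linarith [hy.1, D.r_pos]

theorem differentiableOn_in (hf : DifferentiableOn ℂ f (ball 0 D.r)) :
    DifferentiableOn ℂ (cauchyPart D.B D.h D.c₂ f) D.Ωin := by
  have h1 := D.c₁_pos
  have h2 := D.c₁_lt_c₂
  refine differentiableOn_cauchyPart D.isOpen_Ωin hf (ε := D.ε) (by linarith [D.ε_le_one])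
    (by linarith) (fun y hy => by linarith [hy.2])
    (D.dh.continuousOn.mono fun z hz => D.mem_of_sphere h2.le hz)
    (fun y hy z hz => (D.exp_bound_outer (by linarith [hy.2])
      (mem_sphere_zero_iff_norm.1 hz).le).trans_lt (D.exp_mul_lt hy.1))
    fun z hz => D.h_near z (D.mem_of_sphere h2.le hz)

theorem norm_in_le (hf : DifferentiableOn ℂ f (ball 0 D.r))
    (hM : ∀ x ∈ ball 0 D.r, ‖f x‖ ≤ 2 * D.r) {y : Fin n → ℂ} (hy : y ∈ D.Ωin) :
    ‖cauchyPart D.B D.h D.c₂ f y‖ ≤ 4 * D.r * D.ε := by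
  have h1 := D.c₁_pos
  have h2 := D.c₁_lt_c₂
  have hr := D.r_pos
  have hε := D.ε_nonneg
  have hlt := D.exp_mul_lt hy.1
  refine (norm_cauchyPart_le hf hM (by positivity) hε (by linarith [D.ε_le_one])
    (by linarith) (d := D.c₂ / 2) (by linarith) (fun z hz => ?_)
    (fun z hz => D.exp_bound_outer (by linarith [hy.2]) (mem_sphere_zero_iff_norm.1 hz).le) hlt
    fun z hz => D.h_near z (D.mem_of_sphere h2.le hz)).trans ?_
  · rw [mem_sphere_zero_iff_norm] at hz
    have h1 := norm_sub_norm_le z (y ⬝ᵥ y)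
    linarith [hy.2]
  · have h3 : D.c₂ / (D.c₂ / 2) = 2 := by
      have : D.c₂ ≠ 0 := by linarith
      field_simp
    have h4 : 3 * (2 * D.r) / D.r = 6 := by field_simp; norm_num
    rw [h3, h4]
    nlinarith

/-- The inner parametrisation. -/
noncomputable def Pin (f : (Fin n → ℂ) → (Fin n → ℂ)) (y : Fin n → ℝ) : Fin n → ℝ :=
  y + reV n (D.δ f (toC n y) + cauchyPart D.B D.h D.c₂ f (toC n y))

/-- The outer parametrisation. -/
noncomputable def Pout (f : (Fin n → ℂ) → (Fin n → ℂ)) (x : Fin n → ℝ) : Fin n → ℝ :=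
  x + reV n (D.qsum f univ (toC n x))

theorem qsum_univ_add (x : Fin n → ℂ) (m : Fin n → ℤ) :
    D.qsum f univ (x + intC m) = D.qsum f univ x := by
  simp only [qsum, mem_univ, if_true]
  rw [← (Equiv.addRight m).tsum_eq]
  refine tsum_congr fun l => ?_
  congr 1
  ext i
  simp [intC]

theorem Pout_add (x : Fin n → ℝ) (m : Fin n → ℤ) :
    D.Pout f (x + fun i => (m i : ℝ)) = D.Pout f x + fun i => (m i : ℝ) := by
  rw [Pout, map_add, toC_intC, qsum_univ_add, Pout]
  abel

theorem near_id {G : (Fin n → ℝ) → (Fin n → ℝ)} {x : Fin n → ℝ} {m ρ : ℝ}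
    (h : ContDiffAt ℝ ω G x ∧ ‖G x‖ ≤ m ∧ ‖fderiv ℝ G x‖ ≤ 2 * m / ρ) :
    ContDiffAt ℝ ω (fun y => y + G y) x ∧ ‖(x + G x) - x‖ ≤ m ∧
      ‖fderiv ℝ (fun y => y + G y) x - ContinuousLinearMap.id ℝ _‖ ≤ 2 * m / ρ := by
  refine ⟨contDiffAt_id.add h.1, by simpa using h.2.1, ?_⟩
  have h1 : HasFDerivAt (fun y => y + G y) (ContinuousLinearMap.id ℝ _ + fderiv ℝ G x) x :=
    (hasFDerivAt_id x).add (h.1.differentiableAt (by simp)).hasFDerivAt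
  rw [h1.fderiv, add_sub_cancel_left]
  exact h.2.2

theorem Pin_spec (hf : DifferentiableOn ℂ f (ball 0 D.r))
    (hM : ∀ x ∈ ball 0 D.r, ‖f x‖ ≤ 2 * D.r) {y : Fin n → ℝ} (hy : y ⬝ᵥ y < 32 * D.c₁) :
    ContDiffAt ℝ ω (D.Pin f) y ∧ ‖D.Pin f y - y‖ ≤ (latticeConst n + 1) * D.ε ∧
      ‖fderiv ℝ (D.Pin f) y - ContinuousLinearMap.id ℝ _‖ ≤
        2 * ((latticeConst n + 1) * D.ε) / (D.r / (64 * (n + 1))) := by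
  have hr := D.r_pos
  have hr1 := D.r_le_one
  have hε := D.ε_nonneg
  have hK := latticeConst_nonneg n
  have hy1 : ‖y‖ ≤ D.r / 32 := by
    have h1 := norm_sq_le_dotProduct y
    unfold c₁ at hy
    rw [← abs_of_nonneg (norm_nonneg y)]
    refine abs_le_of_sq_le_sq ?_ (by positivity)
    linarith
  set ρ := D.r / (64 * (n + 1)) with hρ
  have hρ0 : 0 < ρ := by positivity
  have hn : (n : ℝ) * ρ ≤ D.r / 64 ∧ ρ ≤ D.r / 64 := by
    have h1 : ρ * (64 * (n + 1)) = D.r := by rw [hρ]; field_simp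
    have : (0 : ℝ) ≤ n := n.cast_nonneg
    constructor <;> nlinarith
  have hball : ∀ z ∈ ball (toC n y) ρ, z ∈ D.Ωin := by
    intro z hz
    rw [mem_ball_iff_norm] at hz
    obtain ⟨v, rfl⟩ : ∃ v, z = toC n y + v := ⟨z - toC n y, by abel⟩
    rw [add_sub_cancel_left] at hz
    have h2 : ((toC n y + v) ⬝ᵥ (toC n y + v)) =
        ((y ⬝ᵥ y : ℝ) : ℂ) + (2 * (toC n y ⬝ᵥ v) + v ⬝ᵥ v) := by
      rw [add_dotProduct, dotProduct_add, dotProduct_add, toC_dotProduct, dotProduct_comm v]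
      ring
    constructor
    · have := norm_add_le (toC n y) v
      rw [norm_toC] at this
      linarith
    · rw [h2]
      have h3 : ‖toC n y ⬝ᵥ v‖ ≤ n * (‖y‖ * ρ) := by
        calc ‖toC n y ⬝ᵥ v‖ ≤ ∑ i, ‖toC n y i * v i‖ := norm_sum_le _ _
          _ ≤ ∑ _i : Fin n, ‖y‖ * ρ := Finset.sum_le_sum fun i _ => by
              rw [norm_mul]
              have h4 := norm_le_pi_norm (toC n y) i
              rw [norm_toC] at h4
              have h5 := (norm_le_pi_norm v i).trans hz.le
              gcongr
          _ = n * (‖y‖ * ρ) := by simp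
      have h4 := norm_dotProduct_self_le v
      have h5 : ‖v‖ ^ 2 ≤ ρ ^ 2 := by gcongr
      have h6 : ‖((y ⬝ᵥ y : ℝ) : ℂ)‖ ≤ 32 * D.c₁ := by
        rw [Complex.norm_real, Real.norm_eq_abs, abs_of_nonneg]
        · exact hy.le
        · exact Finset.sum_nonneg fun i _ => mul_self_nonneg _
      have h7 : ‖2 * (toC n y ⬝ᵥ v)‖ ≤ 2 * (n * (‖y‖ * ρ)) := by
        rw [norm_mul, Complex.norm_ofNat]
        linarith
      have h8 := norm_add_le ((y ⬝ᵥ y : ℝ) : ℂ) (2 * (toC n y ⬝ᵥ v) + v ⬝ᵥ v)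
      have h9 := norm_add_le (2 * (toC n y ⬝ᵥ v)) (v ⬝ᵥ v)
      have h10 : (n : ℝ) * (‖y‖ * ρ) ≤ D.r / 32 * (D.r / 64) := by
        have : (n : ℝ) * (‖y‖ * ρ) = ‖y‖ * (n * ρ) := by ring
        rw [this]
        have : 0 ≤ n * ρ := by positivity
        exact mul_le_mul hy1 hn.1 this (by positivity)
      have h11 : (n : ℝ) * ‖v‖ ^ 2 ≤ D.r / 64 * (D.r / 64) := by
        calc (n : ℝ) * ‖v‖ ^ 2 ≤ n * ρ ^ 2 := by gcongr
          _ = (n * ρ) * ρ := by ring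
          _ ≤ _ := mul_le_mul hn.1 hn.2 hρ0.le (by positivity)
      unfold c₁ at h6
      unfold c₂
      nlinarith
  have key := real_part_estimate (F := fun z => D.δ f z + cauchyPart D.B D.h D.c₂ f z)
    (m := (latticeConst n + 1) * D.ε) hρ0
    (((D.differentiableOn_δ hf hM (by positivity)).mono fun z hz =>
      D.Ωin_subset (hball z hz)).add ((D.differentiableOn_in hf).mono hball)) fun z hz => by
        refine (norm_add_le _ _).trans ?_
        have h1 := D.norm_δ_le hf hM (by positivity) (D.Ωin_subset (hball z hz))
        have h2 := D.norm_in_le hf hM (hball z hz)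
        have : 0 ≤ latticeConst n * D.ε := by positivity
        nlinarith
  exact near_id key

theorem Pout_spec_aux (hf : DifferentiableOn ℂ f (ball 0 D.r))
    (hM : ∀ x ∈ ball 0 D.r, ‖f x‖ ≤ 2 * D.r) {x : Fin n → ℝ} (hx1 : ‖x‖ ≤ 1)
    (hx : ∀ l : Fin n → ℤ, 4 * D.c₁ < (x - fun i => (l i : ℝ)) ⬝ᵥ (x - fun i => (l i : ℝ))) :
    ContDiffAt ℝ ω (D.Pout f) x ∧ ‖D.Pout f x - x‖ ≤ (latticeConst n + 1) * D.ε ∧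
      ‖fderiv ℝ (D.Pout f) x - ContinuousLinearMap.id ℝ _‖ ≤
        2 * ((latticeConst n + 1) * D.ε) / (D.c₁ / (8 * (n + 1))) := by
  have hr := D.r_pos
  have hr1 := D.r_le_one
  have hε := D.ε_nonneg
  have hK := latticeConst_nonneg n
  have hc := D.c₁_pos
  have hc1 : D.c₁ ≤ 1 := by unfold c₁; nlinarith
  set ρ := D.c₁ / (8 * (n + 1)) with hρ
  have hρ0 : 0 < ρ := by positivity
  have hn0 : (0 : ℝ) ≤ n := n.cast_nonneg
  have hn : ((n : ℝ) + 1) * ρ ≤ D.c₁ / 8 := by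
    have h1 : ρ * (8 * (n + 1)) = D.c₁ := by rw [hρ]; field_simp
    nlinarith
  have hρ1 : ρ ≤ 1 / 8 := by nlinarith
  have hnρ : ((n : ℝ) + 1) * ρ ^ 2 ≤ D.c₁ / 64 := by nlinarith
  have hball : ∀ z ∈ ball (toC n x) ρ, ∀ l ∈ (univ : Set (Fin n → ℤ)), z - intC l ∈ D.Ω := by
    intro z hz l _
    rw [mem_ball_iff_norm] at hz
    obtain ⟨v, rfl⟩ : ∃ v, z = toC n x + v := ⟨z - toC n x, by abel⟩
    rw [add_sub_cancel_left] at hz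
    have h1 : toC n x + v - intC l = toC n (x - fun i => (l i : ℝ)) + v := by
      rw [map_sub, toC_intC]; abel
    have h2 := le_re_dotProduct_add (x - fun i => (l i : ℝ)) hz.le
    have h3 := hx l
    rw [h1]
    have h4 : 3 * (n : ℝ) * ρ ^ 2 ≤ 3 * (D.c₁ / 64) := by nlinarith [sq_nonneg ρ]
    refine D.mem_Ω (s := ρ) (fun i => ?_) (by linarith) (by linarith)
    have : ((toC n (x - fun i => (l i : ℝ)) + v) i).im = (v i).im := by simp
    rw [this]
    exact (Complex.abs_im_le_norm _).trans ((norm_le_pi_norm v i).trans hz.le)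
  have hball2 : ∀ z ∈ ball (toC n x) ρ, ‖z‖ ≤ 2 := by
    intro z hz
    rw [mem_ball_iff_norm] at hz
    have h1 := norm_add_le (z - toC n x) (toC n x)
    rw [sub_add_cancel, norm_toC] at h1
    linarith
  have key := real_part_estimate (F := D.qsum f univ) (m := (latticeConst n + 1) * D.ε) hρ0
    (D.differentiableOn_qsum hf hM (by positivity) isOpen_ball hball2 hball) fun z hz => by
        have h1 := D.norm_qsum_le hf hM (by positivity) (hball2 z hz) (hball z hz)
        have : 0 ≤ latticeConst n * D.ε := by positivity
        nlinarith
  exact near_id key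

theorem Pout_spec (hf : DifferentiableOn ℂ f (ball 0 D.r))
    (hM : ∀ x ∈ ball 0 D.r, ‖f x‖ ≤ 2 * D.r) {x : Fin n → ℝ}
    (hx : ∀ l : Fin n → ℤ, 4 * D.c₁ < (x - fun i => (l i : ℝ)) ⬝ᵥ (x - fun i => (l i : ℝ))) :
    ContDiffAt ℝ ω (D.Pout f) x ∧ ‖D.Pout f x - x‖ ≤ (latticeConst n + 1) * D.ε ∧
      ‖fderiv ℝ (D.Pout f) x - ContinuousLinearMap.id ℝ _‖ ≤
        2 * ((latticeConst n + 1) * D.ε) / (D.c₁ / (8 * (n + 1))) := by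
  set m : Fin n → ℤ := fun i => ⌊x i⌋
  set mr : Fin n → ℝ := fun i => (m i : ℝ) with hmr
  have h1 : ‖x - mr‖ ≤ 1 := (pi_norm_le_iff_of_nonneg zero_le_one).2 fun i => by
    have h2 := Int.floor_le (x i)
    have h3 := Int.lt_floor_add_one (x i)
    rw [Real.norm_eq_abs, abs_le]
    simp only [Pi.sub_apply, hmr, m]
    constructor <;> linarith
  obtain ⟨h2, h3, h4⟩ := D.Pout_spec_aux hf hM h1 fun l => by
    have := hx (l + m)
    convert this using 2 <;>
    · ext i
      simp [hmr]
      ring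
  have hfun : D.Pout f = fun y => D.Pout f (y - mr) + mr := by
    ext1 y
    rw [← D.Pout_add, sub_add_cancel]
  refine ⟨?_, ?_, ?_⟩
  · rw [hfun]
    exact (h2.comp x (contDiffAt_id.sub contDiffAt_const)).add contDiffAt_const
  · rw [hfun]
    have h5 : D.Pout f (x - mr) + mr - x = D.Pout f (x - mr) - (x - mr) := by abel
    simpa only [h5] using h3
  · rw [hfun, fderiv_add_const, fderiv_comp_sub]
    exact h4

theorem Pin_eq_Pout (hf : DifferentiableOn ℂ f (ball 0 D.r))
    (hM : ∀ x ∈ ball 0 D.r, ‖f x‖ ≤ 2 * D.r) (hfix : ∀ x ∈ ball 0 D.r, f x = x + D.δ f x)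
    {y : Fin n → ℝ} {s : ℝ} (hy8 : 8 * D.c₁ < y ⬝ᵥ y) (hy : y ⬝ᵥ y < 32 * D.c₁)
    (hs : D.h ((y ⬝ᵥ y : ℝ) : ℂ) = s)
    (hk : D.k (((y ⬝ᵥ y) * s ^ 2 : ℝ) : ℂ) * s = 1) :
    D.Pin f y = D.Pout f (s • y) := by
  have hr := D.r_pos
  have hc := D.c₁_pos
  have hε := D.ε_nonneg
  have hy1 : ‖y‖ ≤ D.r / 32 := by
    have h1 := norm_sq_le_dotProduct y
    unfold c₁ at hy
    rw [← abs_of_nonneg (norm_nonneg y)]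
    refine abs_le_of_sq_le_sq ?_ (by positivity)
    linarith
  have hc2 : D.c₂ = 256 * D.c₁ := by unfold c₁ c₂; ring
  have hw : ‖toC n y ⬝ᵥ toC n y‖ = y ⬝ᵥ y := by
    rw [toC_dotProduct, Complex.norm_real, Real.norm_eq_abs, abs_of_nonneg (by linarith)]
  have hjump := cauchyPart_jump (h := D.h) hf (ε := D.ε) (by linarith [D.ε_le_one]) (B := D.B)
    (c₀ := D.r ^ 2 / 65536)
    (c₁ := D.c₁) (c₂ := D.c₂) (y := toC n y) (by positivity) (by unfold c₁; nlinarith)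
    (by rw [hw]; linarith) (by rw [hw]; linarith) D.dh D.h_near fun z hz =>
      (D.exp_bound_outer (by rw [hw]; linarith) (mem_closedBall_zero_iff.1 hz)).trans_lt
        (D.exp_mul_lt (by rw [norm_toC]; linarith))
  rw [toC_dotProduct, hs] at hjump
  have hsy : ((s : ℂ) • toC n y) = toC n (s • y) := by ext i; simp
  have hball : toC n (s • y) ∈ ball (0 : Fin n → ℂ) D.r := by
    rw [mem_ball_zero_iff, norm_toC, norm_smul]
    have h1 := D.h_near ((y ⬝ᵥ y : ℝ) : ℂ) (by
      rw [← toC_dotProduct, hw]; unfold c₁ at hy8; nlinarith)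
    rw [hs] at h1
    have h2 := norm_add_le ((s : ℂ) - 1) 1
    rw [norm_one, sub_add_cancel, Complex.norm_real] at h2
    have h3 := D.ε_le_one
    have h4 : ‖s‖ ≤ 2 := by linarith
    nlinarith [norm_nonneg y]
  have hq : D.q f (toC n (s • y)) = cauchyPart D.B D.h D.c₁ f (toC n y) := by
    rw [q]
    congr 1
    rw [toC_dotProduct]
    have h1 : (s • y) ⬝ᵥ (s • y) = (y ⬝ᵥ y) * s ^ 2 := by
      rw [smul_dotProduct, dotProduct_smul, smul_eq_mul, smul_eq_mul]; ring
    rw [h1, ← hsy, smul_smul, hk, one_smul]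
  have hsum : D.qsum f univ (toC n (s • y)) = D.q f (toC n (s • y)) + D.δ f (toC n (s • y)) := by
    classical
    have hS := D.summable_qterm (S := {l | l ≠ 0}) hf hM (by positivity) (D.ball_le_two hball)
      fun l hl => D.sub_intC_mem hball hl
    have h0 : HasSum (fun l : Fin n → ℤ => if l = 0 then D.q f (toC n (s • y)) else 0)
        (D.q f (toC n (s • y))) := hasSum_ite_eq 0 _
    have h1 := (h0.add hS.hasSum).tsum_eq
    rw [δ]
    unfold qsum
    refine Eq.trans ?_ h1
    refine tsum_congr fun l => ?_
    by_cases hl : l = 0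
    · have : intC (0 : Fin n → ℤ) = 0 := by ext i; simp [intC]
      simp [hl, this]
    · simp [hl]
  have h1 := hfix _ hball
  have h2 : toC n y ∈ ball (0 : Fin n → ℂ) D.r := by
    rw [mem_ball_zero_iff, norm_toC]; linarith
  rw [hfix _ h2, hsy, h1] at hjump
  have hfin : toC n y + (D.δ f (toC n y) + cauchyPart D.B D.h D.c₂ f (toC n y)) =
      toC n (s • y) + D.qsum f univ (toC n (s • y)) := by
    rw [hsum, hq, ← sub_eq_zero]
    rw [sub_eq_iff_eq_add] at hjump
    rw [hjump]
    abel
  have := congrArg (reV n) hfin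
  rw [map_add (reV n) (toC n y), map_add (reV n) (toC n (s • y)), reV_toC, reV_toC] at this
  exact this

end CousinData

/-- Solution of the additive Cousin problem in real form: a transition function `h` close to the
identity can be trivialised by analytic maps close to the identity. -/
theorem exists_cousin_solution (n : ℕ) : ∃ c : ℝ, 0 < c ∧ c ≤ 1 / 1000000 ∧
    ∀ η : ℝ, 0 < η → ∃ ε : ℝ, 0 < ε ∧ ε ≤ 1 / 12 ∧ ∀ h k : ℂ → ℂ,
      DifferentiableOn ℂ h {z | c / 2 < ‖z‖} → DifferentiableOn ℂ k {z | c / 2 < ‖z‖} →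
      (∀ z, c / 2 < ‖z‖ → ‖h z - 1‖ ≤ ε) → (∀ z, c / 2 < ‖z‖ → ‖k z - 1‖ ≤ ε) →
      ∃ P O : (Fin n → ℝ) → (Fin n → ℝ),
        (∀ y, y ⬝ᵥ y < 32 * c → ContDiffAt ℝ ω P y ∧ ‖P y - y‖ ≤ η ∧
          ‖fderiv ℝ P y - ContinuousLinearMap.id ℝ _‖ ≤ η) ∧
        (∀ x : Fin n → ℝ,
          (∀ l : Fin n → ℤ, 4 * c < (x - fun i => (l i : ℝ)) ⬝ᵥ (x - fun i => (l i : ℝ))) →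
          ContDiffAt ℝ ω O x ∧ ‖O x - x‖ ≤ η ∧
          ‖fderiv ℝ O x - ContinuousLinearMap.id ℝ _‖ ≤ η) ∧
        (∀ (x : Fin n → ℝ) (l : Fin n → ℤ),
          O (x + fun i => (l i : ℝ)) = O x + fun i => (l i : ℝ)) ∧
        ∀ (y : Fin n → ℝ) (s : ℝ), 8 * c < y ⬝ᵥ y → y ⬝ᵥ y < 32 * c →
          h ((y ⬝ᵥ y : ℝ) : ℂ) = s → k (((y ⬝ᵥ y) * s ^ 2 : ℝ) : ℂ) * s = 1 →
          P y = O (s • y) := by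
  set r : ℝ := 1 / (8 * (n + 1)) with hr
  have hn0 : (0 : ℝ) ≤ n := n.cast_nonneg
  have hr0 : 0 < r := by positivity
  have hr1 : 8 * (n + 1) * r = 1 := by rw [hr]; field_simp
  have hr2 : r ≤ 1 / 8 := by nlinarith
  have hK := latticeConst_nonneg n
  set c := r ^ 2 / 32768 with hc
  have hc0 : 0 < c := by positivity
  refine ⟨c, hc0, by rw [hc]; nlinarith, fun η hη => ?_⟩
  set K := latticeConst n + 1 with hKdef
  set ε : ℝ := min (min (1 / (12 * (n + 1))) (1 / (2 * K))) (min (min (η / K)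
    (η * (r / (64 * (n + 1))) / (2 * K))) (η * (c / (8 * (n + 1))) / (2 * K))) with hε
  have hK0 : 0 < K := by positivity
  have hε0 : 0 < ε := by simp only [hε, lt_min_iff]; refine ⟨⟨?_, ?_⟩, ⟨?_, ?_⟩, ?_⟩ <;> positivity
  have e1 : ε ≤ 1 / (12 * (n + 1)) := (min_le_left _ _).trans (min_le_left _ _)
  have e2 : ε ≤ 1 / (2 * K) := (min_le_left _ _).trans (min_le_right _ _)
  have e3 : ε ≤ η / K :=
    (min_le_right _ _).trans ((min_le_left _ _).trans (min_le_left _ _))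
  have e4 : ε ≤ η * (r / (64 * (n + 1))) / (2 * K) :=
    (min_le_right _ _).trans ((min_le_left _ _).trans (min_le_right _ _))
  have e5 : ε ≤ η * (c / (8 * (n + 1))) / (2 * K) := (min_le_right _ _).trans (min_le_right _ _)
  rw [le_div_iff₀ (by positivity)] at e1 e2 e3 e4 e5
  refine ⟨ε, hε0, by nlinarith, fun h k dh dk hh hk => ?_⟩
  have hcc : r ^ 2 / 65536 = c / 2 := by rw [hc]; ring
  let D : CousinData n :=
    { r := r, ε := ε, h := h, k := k, r_pos := hr0, r_le := hr1.le, ε_nonneg := hε0.le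
      ε_le := by linarith
      dh := by rw [hcc]; exact dh
      dk := by rw [hcc]; exact dk
      h_near := by rw [hcc]; exact hh
      k_near := by rw [hcc]; exact hk }
  obtain ⟨f, hf, hM, hfix⟩ := D.exists_fixed (by change latticeConst n * ε ≤ 1 / 2; nlinarith)
  refine ⟨D.Pin f, D.Pout f, fun y hy => ?_, fun x hx => ?_, fun x l => D.Pout_add x l,
    fun y s h8 h32 hs hks => D.Pin_eq_Pout hf hM hfix h8 h32 hs hks⟩
  · obtain ⟨h1, h2, h3⟩ := D.Pin_spec hf hM hy
    refine ⟨h1, h2.trans ?_, h3.trans ?_⟩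
    · change K * ε ≤ η; linarith
    · change 2 * (K * ε) / (r / (64 * (n + 1))) ≤ η
      rw [div_le_iff₀ (by positivity)]
      linarith
  · obtain ⟨h1, h2, h3⟩ := D.Pout_spec hf hM hx
    refine ⟨h1, h2.trans ?_, h3.trans ?_⟩
    · change K * ε ≤ η; linarith
    · change 2 * (K * ε) / (c / (8 * (n + 1))) ≤ η
      rw [div_le_iff₀ (by positivity)]
      linarith

end TorusBlowup

namespace TorusBlowup
open Metric Set Filter Topology MeasureTheory

theorem contDiffAt_of_leftInverse {E F : Type*} [NormedAddCommGroup E] [NormedSpace ℝ E]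
    [CompleteSpace E] [NormedAddCommGroup F] [NormedSpace ℝ F] {φ : E → F} {ψ : F → E} {u : E}
    (e : E ≃L[ℝ] F) (h : ContDiffAt ℝ ω φ u) (he : HasFDerivAt φ (e : E →L[ℝ] F) u)
    (hψ : ∀ᶠ x in 𝓝 u, ψ (φ x) = x) : ContDiffAt ℝ ω ψ (φ u) := by
  have h1 := h.to_localInverse he (by simp)
  refine h1.congr_of_eventuallyEq ?_
  exact (h.hasStrictFDerivAt' he (by simp)).localInverse_unique hψ

theorem contDiffAt_rpow_const {x p : ℝ} (hx : 0 < x) :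
    ContDiffAt ℝ ω (fun x : ℝ => x ^ p) x := by
  have h : ContDiffAt ℝ ω (fun x : ℝ => Real.exp (Real.log x * p)) x :=
    Real.contDiff_exp.contDiffAt.comp x ((Real.contDiffAt_log.2 hx.ne').mul contDiffAt_const)
  refine h.congr_of_eventuallyEq ?_
  filter_upwards [lt_mem_nhds hx] with y hy using Real.rpow_def_of_pos hy p

theorem exists_analytic_inverse {φ : ℝ → ℝ} {U : Set ℝ} (hU : IsOpen U) (hUc : IsPreconnected U)
    (hφ : ∀ u ∈ U, ContDiffAt ℝ ω φ u) (hd : ∀ u ∈ U, deriv φ u ≠ 0) (hinj : InjOn φ U)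
    (hlow : ∀ s, ∃ u ∈ U, φ u ≤ s) (hup : ∀ s, ∃ u ∈ U, s ≤ φ u) :
    ∃ ψ : ℝ → ℝ, (∀ s, ψ s ∈ U) ∧ (∀ s, φ (ψ s) = s) ∧ (∀ u ∈ U, ψ (φ u) = u) ∧
      ∀ s, ContDiffAt ℝ ω ψ s := by
  have hsurj : ∀ s, ∃ u ∈ U, φ u = s := fun s => by
    obtain ⟨u, hu, hus⟩ := hlow s
    obtain ⟨v, hv, hvs⟩ := hup s
    exact hUc.intermediate_value hu hv
      (fun x hx => (hφ x hx).continuousAt.continuousWithinAt) ⟨hus, hvs⟩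
  choose ψ hψU hψ using hsurj
  have hl : ∀ u ∈ U, ψ (φ u) = u := fun u hu => hinj (hψU _) hu (hψ _)
  refine ⟨ψ, hψU, hψ, hl, fun s => ?_⟩
  have hu := hψU s
  have h1 : HasDerivAt φ (deriv φ (ψ s)) (ψ s) :=
    ((hφ _ hu).differentiableAt (by simp)).hasDerivAt
  have := contDiffAt_of_leftInverse
    (ContinuousLinearEquiv.unitsEquivAut ℝ (Units.mk0 _ (hd _ hu))) (hφ _ hu)
    (h1.hasFDerivAt_equiv (hd _ hu))
    (by filter_upwards [hU.mem_nhds hu] with x hx using hl x hx)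
  rwa [hψ] at this

/-- The profile of the radial flow outside the inner fixed sphere. -/
noncomputable def gOut (b a w : ℝ) : ℝ := w ^ b * (w - 4 * a) / (w - a)

/-- The profile of the radial flow inside the outer fixed sphere. -/
noncomputable def gIn (b a w : ℝ) : ℝ := w ^ (-b) * (w - a) / (w - 4 * a)

/-- The quadratic factor of the derivatives of both profiles. -/
noncomputable def profileQuad (b a w : ℝ) : ℝ := b * w ^ 2 + (3 - 5 * b) * a * w + 4 * b * a ^ 2

section Profile
variable {b a w : ℝ}

theorem profileQuad_pos (hb : 1 < b) (hb3 : b < 3) (ha : 0 < a) : 0 < profileQuad b a w := by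
  have h : 4 * b * profileQuad b a w =
      (2 * b * w + (3 - 5 * b) * a) ^ 2 + (9 * b - 3) * (3 - b) * a ^ 2 := by
    unfold profileQuad; ring
  have : 0 < (9 * b - 3) * (3 - b) * a ^ 2 :=
    mul_pos (mul_pos (by linarith) (by linarith)) (by positivity)
  have h2 : 0 < 4 * b * profileQuad b a w := by rw [h]; positivity
  exact pos_of_mul_pos_right h2 (by linarith)

theorem hasDerivAt_gOut (hw : 0 < w) (hwa : w ≠ a) :
    HasDerivAt (gOut b a) (w ^ (b - 1) * profileQuad b a w / (w - a) ^ 2) w := by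
  have h1 : HasDerivAt (fun w : ℝ => w ^ b) (b * w ^ (b - 1)) w :=
    Real.hasDerivAt_rpow_const (Or.inl hw.ne')
  have h2 := (h1.mul ((hasDerivAt_id w).sub_const (4 * a))).div ((hasDerivAt_id w).sub_const a)
    (sub_ne_zero.2 hwa)
  refine h2.congr_deriv ?_
  have e : w ^ b = w ^ (b - 1) * w := by
    rw [← Real.rpow_add_one hw.ne']; congr 1; ring
  change ((b * w ^ (b - 1) * (w - 4 * a) + w ^ b * 1) * (w - a) -
    w ^ b * (w - 4 * a) * 1) / (w - a) ^ 2 = _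
  rw [e, profileQuad]; ring

theorem hasDerivAt_gIn (hw : 0 < w) (hwa : w ≠ 4 * a) :
    HasDerivAt (gIn b a) (-(w ^ (-b - 1) * profileQuad b a w / (w - 4 * a) ^ 2)) w := by
  have h1 : HasDerivAt (fun w : ℝ => w ^ (-b)) (-b * w ^ (-b - 1)) w :=
    Real.hasDerivAt_rpow_const (Or.inl hw.ne')
  have h2 := (h1.mul ((hasDerivAt_id w).sub_const a)).div ((hasDerivAt_id w).sub_const (4 * a))
    (sub_ne_zero.2 hwa)
  refine h2.congr_deriv ?_
  have e : w ^ (-b) = w ^ (-b - 1) * w := by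
    rw [← Real.rpow_add_one hw.ne']; congr 1; ring
  change ((-b * w ^ (-b - 1) * (w - a) + w ^ (-b) * 1) * (w - 4 * a) -
    w ^ (-b) * (w - a) * 1) / (w - 4 * a) ^ 2 = _
  rw [e, profileQuad]; ring

theorem contDiffAt_gOut (hw : 0 < w) (hwa : w ≠ a) : ContDiffAt ℝ ω (gOut b a) w := by
  unfold gOut
  exact ((contDiffAt_rpow_const hw).mul
    (contDiffAt_id.sub contDiffAt_const)).div (contDiffAt_id.sub contDiffAt_const)
    (sub_ne_zero.2 hwa)

theorem contDiffAt_gIn (hw : 0 < w) (hwa : w ≠ 4 * a) : ContDiffAt ℝ ω (gIn b a) w := by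
  unfold gIn
  exact ((contDiffAt_rpow_const hw).mul
    (contDiffAt_id.sub contDiffAt_const)).div (contDiffAt_id.sub contDiffAt_const)
    (sub_ne_zero.2 hwa)

theorem gOut_strictMonoOn (hb : 1 < b) (hb3 : b < 3) (ha : 0 < a) :
    StrictMonoOn (gOut b a) (Ioi a) := by
  refine strictMonoOn_of_deriv_pos (convex_Ioi a) (fun x (hx : a < x) =>
    (contDiffAt_gOut (ha.trans hx) hx.ne').continuousAt.continuousWithinAt) fun x hx => ?_
  rw [interior_Ioi] at hx
  have hx' : a < x := hx
  have hx0 := ha.trans hx'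
  rw [(hasDerivAt_gOut hx0 hx'.ne').deriv]
  have := profileQuad_pos (w := x) hb hb3 ha
  have h2 : x - a ≠ 0 := sub_ne_zero.2 hx'.ne'
  positivity

theorem gIn_strictAntiOn (hb : 1 < b) (hb3 : b < 3) (ha : 0 < a) :
    StrictAntiOn (gIn b a) (Ioo 0 (4 * a)) := by
  refine strictAntiOn_of_deriv_neg (convex_Ioo _ _) (fun x hx =>
    (contDiffAt_gIn hx.1 hx.2.ne).continuousAt.continuousWithinAt) fun x hx => ?_
  rw [interior_Ioo] at hx
  have hx0 := hx.1
  rw [(hasDerivAt_gIn hx.1 hx.2.ne).deriv]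
  have := profileQuad_pos (w := x) hb hb3 ha
  have h2 : x - 4 * a ≠ 0 := sub_ne_zero.2 hx.2.ne
  rw [neg_lt_zero]
  positivity

theorem exists_inverse_gOut (hb : 1 < b) (hb3 : b < 3) (ha : 0 < a) :
    ∃ ψ : ℝ → ℝ, (∀ s, a < ψ s) ∧ (∀ s, gOut b a (ψ s) = s) ∧ (∀ u, a < u → ψ (gOut b a u) = u) ∧
      ∀ s, ContDiffAt ℝ ω ψ s := by
  refine exists_analytic_inverse isOpen_Ioi isPreconnected_Ioi
    (fun u (hu : a < u) => contDiffAt_gOut (ha.trans hu) hu.ne') (fun u (hu : a < u) => ?_)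
    (gOut_strictMonoOn hb hb3 ha).injOn (fun s => ?_) (fun s => ?_)
  · have hu0 := ha.trans hu
    rw [(hasDerivAt_gOut hu0 hu.ne').deriv]
    have := profileQuad_pos (w := u) hb hb3 ha
    have h2 : u - a ≠ 0 := sub_ne_zero.2 hu.ne'
    positivity
  · set δ := min a (2 * a * a ^ b / (|s| + 1)) with hδ
    have hab : 0 < a ^ b := Real.rpow_pos_of_pos ha b
    have hδ0 : 0 < δ := lt_min ha (by positivity)
    refine ⟨a + δ, lt_add_of_pos_right a hδ0, ?_⟩
    have h1 : a ^ b ≤ (a + δ) ^ b := Real.rpow_le_rpow ha.le (by linarith) (by linarith)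
    have h2 : δ ≤ a := min_le_left _ _
    have h3 : δ * (|s| + 1) ≤ 2 * a * a ^ b := by
      rw [← le_div_iff₀ (by positivity)]; exact min_le_right _ _
    unfold gOut
    rw [div_le_iff₀ (by linarith)]
    have h4 := neg_abs_le s
    have h5 : a ^ b * (2 * a) ≤ (a + δ) ^ b * (4 * a - (a + δ)) :=
      mul_le_mul h1 (by linarith) (by linarith) (by positivity)
    nlinarith
  · set w := 7 * a + 1 + 2 * |s| with hw
    have h0 := abs_nonneg s
    have h1 : w ≤ w ^ b := by
      conv_lhs => rw [← Real.rpow_one w]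
      exact Real.rpow_le_rpow_of_exponent_le (by linarith) hb.le
    refine ⟨w, show a < w by linarith, ?_⟩
    unfold gOut
    rw [le_div_iff₀ (by linarith)]
    have h2 : w * ((w - a) / 2) ≤ w ^ b * (w - 4 * a) :=
      mul_le_mul h1 (by linarith) (by linarith) (by linarith)
    have h3 : s ≤ w / 2 := by linarith [le_abs_self s]
    nlinarith

theorem exists_inverse_gIn (hb : 1 < b) (hb3 : b < 3) (ha : 0 < a) :
    ∃ ψ : ℝ → ℝ, (∀ s, ψ s ∈ Ioo 0 (4 * a)) ∧ (∀ s, gIn b a (ψ s) = s) ∧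
      (∀ u ∈ Ioo 0 (4 * a), ψ (gIn b a u) = u) ∧ ∀ s, ContDiffAt ℝ ω ψ s := by
  refine exists_analytic_inverse isOpen_Ioo isPreconnected_Ioo
    (fun u hu => contDiffAt_gIn hu.1 hu.2.ne) (fun u hu => ?_)
    (gIn_strictAntiOn hb hb3 ha).injOn (fun s => ?_) (fun s => ?_)
  · have hu0 := hu.1
    rw [(hasDerivAt_gIn hu0 hu.2.ne).deriv]
    have := profileQuad_pos (w := u) hb hb3 ha
    have h2 : u - 4 * a ≠ 0 := sub_ne_zero.2 hu.2.ne
    rw [neg_ne_zero]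
    positivity
  · have hab : 0 < (4 * a) ^ (-b) := Real.rpow_pos_of_pos (by linarith) _
    set δ := min a (2 * a * (4 * a) ^ (-b) / (|s| + 1)) with hδ
    have hδ0 : 0 < δ := lt_min ha (by positivity)
    have h2 : δ ≤ a := min_le_left _ _
    refine ⟨4 * a - δ, ⟨by linarith, by linarith⟩, ?_⟩
    have h1 : (4 * a) ^ (-b) ≤ (4 * a - δ) ^ (-b) :=
      Real.rpow_le_rpow_of_nonpos (by linarith) (by linarith) (by linarith)
    have h3 : δ * (|s| + 1) ≤ 2 * a * (4 * a) ^ (-b) := by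
      rw [← le_div_iff₀ (by positivity)]; exact min_le_right _ _
    unfold gIn
    rw [div_le_iff_of_neg (by linarith)]
    have h4 := neg_abs_le s
    have h5 : (4 * a) ^ (-b) * (2 * a) ≤ (4 * a - δ) ^ (-b) * (4 * a - δ - a) :=
      mul_le_mul h1 (by linarith) (by linarith) (Real.rpow_nonneg (by linarith) _)
    nlinarith
  · set v := 2 / a + 1 + 8 * |s| with hv
    have h0 := abs_nonneg s
    have h00 : 0 < 2 / a := by positivity
    have hv0 : 0 < v := by linarith
    have hva : v⁻¹ ≤ a / 2 := by
      rw [inv_le_comm₀ hv0 (by positivity), inv_div]; linarith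
    have h1 : v ≤ v⁻¹ ^ (-b) := by
      rw [Real.rpow_neg (by positivity), Real.inv_rpow hv0.le, inv_inv]
      conv_lhs => rw [← Real.rpow_one v]
      exact Real.rpow_le_rpow_of_exponent_le (by linarith) hb.le
    have hvp : 0 < v⁻¹ := by positivity
    refine ⟨v⁻¹, ⟨hvp, by linarith⟩, ?_⟩
    unfold gIn
    rw [le_div_iff_of_neg (by linarith)]
    have h2 : v * ((4 * a - v⁻¹) / 8) ≤ v⁻¹ ^ (-b) * (a - v⁻¹) :=
      mul_le_mul h1 (by linarith) (by linarith) (Real.rpow_nonneg hvp.le _)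
    have h3 : s ≤ v / 8 := by linarith [le_abs_self s]
    nlinarith

theorem gIn_mul_gOut (hw : 0 < w) (h1 : w ≠ a) (h2 : w ≠ 4 * a) :
    gIn b a w * gOut b a w = 1 := by
  unfold gIn gOut
  rw [Real.rpow_neg hw.le]
  have := (Real.rpow_pos_of_pos hw b).ne'
  have h1' := sub_ne_zero.2 h1
  have h2' : w - a * 4 ≠ 0 := by rw [mul_comm]; exact sub_ne_zero.2 h2
  field_simp

/-- The multiplicative radial flow with fixed spheres at `a` and `4 * a`. -/
theorem exists_radial_flow (hb : 1 < b) (hb3 : b < 3) (ha : 0 < a) :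
    ∃ Fl : ℝ → ℝ → ℝ,
      (∀ t w, 0 < t → 0 < w → w < 4 * a → 0 < Fl t w ∧ Fl t w < 4 * a ∧
        gIn b a (Fl t w) = t ^ (-b) * gIn b a w) ∧
      (∀ t w, 0 < t → a < w → a < Fl t w ∧ gOut b a (Fl t w) = t ^ b * gOut b a w) ∧
      ∀ t w, 0 < t → 0 < w → ContDiffAt ℝ ω (fun p : ℝ × ℝ => Fl p.1 p.2) (t, w) := by
  obtain ⟨ψ, hψa, hψ, hψl, hψc⟩ := exists_inverse_gOut hb hb3 ha
  obtain ⟨χ, hχa, hχ, hχl, hχc⟩ := exists_inverse_gIn hb hb3 ha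
  have hab : 0 < a ^ b := Real.rpow_pos_of_pos ha b
  have key : ∀ t w, 0 < t → a < w → w < 4 * a →
      χ (t ^ (-b) * gIn b a w) = ψ (t ^ b * gOut b a w) := by
    intro t w ht h1 h2
    have hw0 := ha.trans h1
    have htb : 0 < t ^ b := Real.rpow_pos_of_pos ht b
    have hwb : 0 < w ^ b := Real.rpow_pos_of_pos hw0 b
    set y := ψ (t ^ b * gOut b a w) with hy
    have hneg : t ^ b * gOut b a w < 0 :=
      mul_neg_of_pos_of_neg htb (div_neg_of_neg_of_pos
        (mul_neg_of_pos_of_neg hwb (by linarith)) (by linarith))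
    have hya : a < y := hψa _
    have hy0 := ha.trans hya
    have hy4 : y < 4 * a := by
      by_contra hcon
      have : 0 ≤ gOut b a y :=
        div_nonneg (mul_nonneg (Real.rpow_pos_of_pos hy0 b).le (by linarith)) (by linarith)
      rw [hy, hψ] at this
      linarith
    rw [← hχl y ⟨hy0, hy4⟩]
    congr 1
    have e1 := gIn_mul_gOut (b := b) hy0 hya.ne' hy4.ne
    have e2 := gIn_mul_gOut (b := b) hw0 h1.ne' h2.ne
    have e3 : gOut b a y = t ^ b * gOut b a w := hψ _
    have hg : gOut b a y ≠ 0 := by rw [e3]; exact hneg.ne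
    have e4 : t ^ (-b) * t ^ b = 1 := by rw [← Real.rpow_add ht]; simp
    apply mul_right_cancel₀ hg
    rw [e1, e3]
    linear_combination (t ^ (-b) * t ^ b) * e2 + e4
  classical
  refine ⟨fun t w => if w < 4 * a then χ (t ^ (-b) * gIn b a w) else ψ (t ^ b * gOut b a w),
    fun t w ht hw h4 => ?_, fun t w ht hw => ?_, fun t w ht hw => ?_⟩
  · simp only [if_pos h4]
    exact ⟨(hχa _).1, (hχa _).2, hχ _⟩
  · have e : (if w < 4 * a then χ (t ^ (-b) * gIn b a w) else ψ (t ^ b * gOut b a w)) =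
        ψ (t ^ b * gOut b a w) := by
      split_ifs with h
      · exact key t w ht hw h
      · rfl
    simp only [e]
    exact ⟨hψa _, hψ _⟩
  · rcases lt_or_ge w (4 * a) with h4 | h4
    · have h : ContDiffAt ℝ ω (fun p : ℝ × ℝ => χ (p.1 ^ (-b) * gIn b a p.2)) (t, w) :=
        (hχc _).comp (t, w) (((contDiffAt_rpow_const ht).comp (t, w)
          contDiffAt_fst).mul ((contDiffAt_gIn hw h4.ne).comp (t, w) contDiffAt_snd))
      refine h.congr_of_eventuallyEq ?_
      have : ∀ᶠ p : ℝ × ℝ in 𝓝 (t, w), p.2 < 4 * a :=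
        continuousAt_snd.eventually (gt_mem_nhds h4)
      filter_upwards [this] with p hp
      simp [hp]
    · have haw : a < w := by linarith
      have h : ContDiffAt ℝ ω (fun p : ℝ × ℝ => ψ (p.1 ^ b * gOut b a p.2)) (t, w) :=
        (hψc _).comp (t, w) (((contDiffAt_rpow_const ht).comp (t, w)
          contDiffAt_fst).mul ((contDiffAt_gOut hw haw.ne').comp (t, w) contDiffAt_snd))
      refine h.congr_of_eventuallyEq ?_
      have h1 : ∀ᶠ p : ℝ × ℝ in 𝓝 (t, w), a < p.2 :=
        continuousAt_snd.eventually (lt_mem_nhds haw)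
      have h2 : ∀ᶠ p : ℝ × ℝ in 𝓝 (t, w), 0 < p.1 :=
        continuousAt_fst.eventually (lt_mem_nhds ht)
      filter_upwards [h1, h2] with p hp hp2
      split_ifs with h
      · exact key _ _ hp2 hp h
      · rfl

end Profile

end TorusBlowup

namespace TorusBlowup
open Metric Set Filter Topology MeasureTheory

section Nsq
variable {n : ℕ}

/-- The squared Euclidean length. -/
abbrev nsq (y : Fin n → ℝ) : ℝ := y ⬝ᵥ y

theorem nsq_smul (s : ℝ) (y : Fin n → ℝ) : nsq (s • y) = s ^ 2 * nsq y := by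
  simp only [nsq, smul_dotProduct, dotProduct_smul, smul_eq_mul]; ring

theorem nsq_pos {y : Fin n → ℝ} (hy : y ≠ 0) : 0 < nsq y :=
  lt_of_le_of_ne (Finset.sum_nonneg fun i _ => mul_self_nonneg (y i)) (fun h => hy (dotProduct_self_eq_zero.1 h.symm))

theorem nsq_nonneg (y : Fin n → ℝ) : 0 ≤ nsq y := Finset.sum_nonneg fun i _ => mul_self_nonneg (y i)

theorem ne_zero_of_lt_nsq {y : Fin n → ℝ} {r : ℝ} (hr : 0 ≤ r) (h : r < nsq y) : y ≠ 0 := by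
  rintro rfl
  simp [nsq] at h
  linarith

theorem contDiff_nsq : ContDiff ℝ ω (nsq : (Fin n → ℝ) → ℝ) := by
  unfold nsq dotProduct
  exact ContDiff.sum fun i _ => (contDiff_apply ℝ ℝ i).mul (contDiff_apply ℝ ℝ i)

theorem nsq_sqrt_smul {u : ℝ} (hu : 0 ≤ u) {y : Fin n → ℝ} (hy : y ≠ 0) :
    nsq (√(u / nsq y) • y) = u := by
  have := nsq_pos hy
  rw [nsq_smul, Real.sq_sqrt (by positivity)]
  field_simp

theorem contDiffAt_sqrt' {x : ℝ} (hx : 0 < x) : ContDiffAt ℝ ω Real.sqrt x :=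
  Real.contDiffAt_sqrt hx.ne'

end Nsq

/-- The one-dimensional data of the radial flow. -/
structure RadialFlow (b a : ℝ) where
  hb : 1 < b
  hb3 : b < 3
  ha : 0 < a
  fl : ℝ → ℝ → ℝ
  fl_inner : ∀ t w, 0 < t → 0 < w → w < 4 * a → 0 < fl t w ∧ fl t w < 4 * a ∧
        gIn b a (fl t w) = t ^ (-b) * gIn b a w
  fl_outer : ∀ t w, 0 < t → a < w → a < fl t w ∧ gOut b a (fl t w) = t ^ b * gOut b a w
  fl_analytic : ∀ t w, 0 < t → 0 < w → ContDiffAt ℝ ω (fun p : ℝ × ℝ => fl p.1 p.2) (t, w)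
  ψ : ℝ → ℝ
  ψ_gt : ∀ s, a < ψ s
  gOut_ψ : ∀ s, gOut b a (ψ s) = s
  ψ_gOut : ∀ u, a < u → ψ (gOut b a u) = u
  ψ_analytic : ∀ s, ContDiffAt ℝ ω ψ s
  χ : ℝ → ℝ
  χ_gIn : ∀ u ∈ Ioo 0 (4 * a), χ (gIn b a u) = u

theorem exists_radialFlow {b a : ℝ} (hb : 1 < b) (hb3 : b < 3) (ha : 0 < a) :
    Nonempty (RadialFlow b a) := by
  obtain ⟨fl, h1, h2, h3⟩ := exists_radial_flow hb hb3 ha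
  obtain ⟨ψ, h4, h5, h6, h7⟩ := exists_inverse_gOut hb hb3 ha
  obtain ⟨χ, -, -, h8, -⟩ := exists_inverse_gIn hb hb3 ha
  exact ⟨⟨hb, hb3, ha, fl, h1, h2, h3, ψ, h4, h5, h6, h7, χ, h8⟩⟩

namespace RadialFlow
variable {b a : ℝ} (D : RadialFlow b a)

theorem gOut_inj (D : RadialFlow b a) {u v : ℝ} (hu : a < u) (hv : a < v) (h : gOut b a u = gOut b a v) : u = v := by
  rw [← D.ψ_gOut u hu, h, D.ψ_gOut v hv]

theorem gIn_inj (D : RadialFlow b a) {u v : ℝ} (hu : 0 < u) (hu4 : u < 4 * a) (hv : 0 < v) (hv4 : v < 4 * a)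
    (h : gIn b a u = gIn b a v) : u = v := by
  rw [← D.χ_gIn u ⟨hu, hu4⟩, h, D.χ_gIn v ⟨hv, hv4⟩]

theorem gOut_pos_iff (D : RadialFlow b a) {u : ℝ} (hu : a < u) : 0 < gOut b a u ↔ 4 * a < u := by
  have h0 := D.ha.trans hu
  have := Real.rpow_pos_of_pos h0 b
  unfold gOut
  rw [div_pos_iff_of_pos_right (by linarith), mul_pos_iff_of_pos_left this, sub_pos]

theorem gIn_pos_iff (_ : RadialFlow b a) {u : ℝ} (hu : 0 < u) (hu4 : u < 4 * a) : 0 < gIn b a u ↔ u < a := by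
  have := Real.rpow_pos_of_pos hu (-b)
  have e : gIn b a u = u ^ (-b) * (a - u) / (4 * a - u) := by
    unfold gIn
    rw [← neg_div_neg_eq]; congr 1 <;> ring
  rw [e, div_pos_iff_of_pos_right (by linarith), mul_pos_iff_of_pos_left this, sub_pos]

theorem gOut_four : gOut b a (4 * a) = 0 := by simp [gOut]

theorem fl_pos {t w : ℝ} (ht : 0 < t) (hw : 0 < w) : 0 < D.fl t w := by
  rcases lt_or_ge w (4 * a) with h | h
  · exact (D.fl_inner t w ht hw h).1
  · exact D.ha.trans (D.fl_outer t w ht (by linarith [D.ha])).1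

theorem fl_four {t : ℝ} (ht : 0 < t) : D.fl t (4 * a) = 4 * a := by
  have ha := D.ha
  obtain ⟨h1, h2⟩ := D.fl_outer t (4 * a) ht (by linarith)
  refine D.gOut_inj h1 (by linarith) ?_
  rw [h2, gOut_four, mul_zero]

theorem fl_gt_four {t w : ℝ} (ht : 0 < t) (hw : 4 * a < w) : 4 * a < D.fl t w := by
  have ha := D.ha
  obtain ⟨h1, h2⟩ := D.fl_outer t w ht (by linarith)
  rw [← D.gOut_pos_iff h1, h2]
  exact mul_pos (Real.rpow_pos_of_pos ht b) ((D.gOut_pos_iff (by linarith)).2 hw)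

theorem fl_le_four {t w : ℝ} (ht : 0 < t) (hw0 : 0 < w) (hw : w ≤ 4 * a) : D.fl t w ≤ 4 * a := by
  rcases hw.lt_or_eq with h | rfl
  · exact (D.fl_inner t w ht hw0 h).2.1.le
  · exact (D.fl_four ht).le

theorem fl_one {w : ℝ} (hw : 0 < w) : D.fl 1 w = w := by
  rcases lt_or_ge w (4 * a) with h | h
  · obtain ⟨h1, h2, h3⟩ := D.fl_inner 1 w one_pos hw h
    exact D.gIn_inj h1 h2 hw h (by simpa using h3)
  · have h' : a < w := by linarith [D.ha]
    obtain ⟨h1, h3⟩ := D.fl_outer 1 w one_pos h'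
    exact D.gOut_inj h1 h' (by simpa using h3)

theorem fl_mul {t s w : ℝ} (ht : 0 < t) (hs : 0 < s) (hw : 0 < w) :
    D.fl (t * s) w = D.fl t (D.fl s w) := by
  rcases lt_or_ge w (4 * a) with h | h
  · obtain ⟨h1, h2, h3⟩ := D.fl_inner (t * s) w (by positivity) hw h
    obtain ⟨h4, h5, h6⟩ := D.fl_inner s w hs hw h
    obtain ⟨h7, h8, h9⟩ := D.fl_inner t _ ht h4 h5
    refine D.gIn_inj h1 h2 h7 h8 ?_
    rw [h3, h9, h6, Real.mul_rpow ht.le hs.le, mul_assoc]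
  · have h' : a < w := by linarith [D.ha]
    obtain ⟨h1, h3⟩ := D.fl_outer (t * s) w (by positivity) h'
    obtain ⟨h4, h6⟩ := D.fl_outer s w hs h'
    obtain ⟨h7, h9⟩ := D.fl_outer t _ ht h4
    refine D.gOut_inj h1 h7 ?_
    rw [h3, h9, h6, Real.mul_rpow ht.le hs.le, mul_assoc]

variable {n : ℕ} (A : (Fin n → ℝ) →L[ℝ] (Fin n → ℝ))

/-- The radial deformation of the linear action, with invariant ball of squared radius `4 * a`. -/
noncomputable def act (y : Fin n → ℝ) : Fin n → ℝ :=
  √(D.fl (nsq (A y) / nsq y) (nsq y) / nsq (A y)) • A y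

/-- The outer linearizing coordinate. -/
noncomputable def outX (_ : RadialFlow b a) (y : Fin n → ℝ) : Fin n → ℝ :=
  √(gOut b a (nsq y) ^ b⁻¹ / nsq y) • y

/-- The inverse of the outer linearizing coordinate. -/
noncomputable def outY (x : Fin n → ℝ) : Fin n → ℝ := √(D.ψ (nsq x ^ b) / nsq x) • x

/-- The linearizing coordinate at the origin. -/
noncomputable def inX (_ : RadialFlow b a) (y : Fin n → ℝ) : Fin n → ℝ :=
  ((4 * a - nsq y) / (a - nsq y)) ^ (2 * b)⁻¹ • y

variable {A}

theorem act_zero : D.act A 0 = 0 := by simp [act]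

theorem nsq_act (hA : Function.Injective A) {y : Fin n → ℝ} (hy : y ≠ 0) :
    nsq (D.act A y) = D.fl (nsq (A y) / nsq y) (nsq y) := by
  have h : A y ≠ 0 := fun h => hy (hA (h.trans (map_zero A).symm))
  exact nsq_sqrt_smul (D.fl_pos (div_pos (nsq_pos h) (nsq_pos hy)) (nsq_pos hy)).le h

theorem act_ne_zero (hA : Function.Injective A) {y : Fin n → ℝ} (hy : y ≠ 0) :
    D.act A y ≠ 0 := by
  have h : A y ≠ 0 := fun h => hy (hA (h.trans (map_zero A).symm))
  refine ne_zero_of_lt_nsq le_rfl ?_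
  rw [D.nsq_act hA hy]
  exact D.fl_pos (div_pos (nsq_pos h) (nsq_pos hy)) (nsq_pos hy)

theorem act_id (y : Fin n → ℝ) : D.act (ContinuousLinearMap.id ℝ _) y = y := by
  by_cases hy : y = 0
  · simp [hy, act]
  · have := nsq_pos hy
    simp [act, div_self this.ne', D.fl_one this]

theorem act_comp {B : (Fin n → ℝ) →L[ℝ] (Fin n → ℝ)} (hA : Function.Injective A)
    (hB : Function.Injective B) (y : Fin n → ℝ) :
    D.act (B.comp A) y = D.act B (D.act A y) := by
  by_cases hy : y = 0
  · simp [hy, act]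
  have h0 := nsq_pos hy
  have hAy : A y ≠ 0 := fun h => hy (hA (h.trans (map_zero A).symm))
  have hBy : B (A y) ≠ 0 := fun h => hAy (hB (h.trans (map_zero B).symm))
  have h1 := nsq_pos hAy
  have h2 := nsq_pos hBy
  have hF := D.fl_pos (div_pos h1 h0) h0
  have e : nsq (B (A y)) / nsq y = nsq (B (A y)) / nsq (A y) * (nsq (A y) / nsq y) := by
    field_simp
  have h3 := D.nsq_act hA hy
  set σ := √(D.fl (nsq (A y) / nsq y) (nsq y) / nsq (A y)) with hσ
  have hσ0 : 0 < σ := Real.sqrt_pos.2 (div_pos hF h1)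
  have hact : D.act A y = σ • A y := rfl
  have e2 : nsq (B (σ • A y)) / nsq (σ • A y) = nsq (B (A y)) / nsq (A y) := by
    rw [map_smul, nsq_smul, nsq_smul, mul_div_mul_left _ _ (by positivity)]
  rw [hact] at h3 ⊢
  unfold act
  rw [ContinuousLinearMap.comp_apply, e, D.fl_mul (div_pos h2 h1) (div_pos h1 h0) h0, e2, h3,
    map_smul, smul_smul, nsq_smul]
  congr 1
  rw [mul_comm (σ ^ 2), ← div_div, Real.sqrt_div' _ (sq_nonneg σ), Real.sqrt_sq hσ0.le]
  field_simp

theorem nsq_act_le (hA : Function.Injective A) {y : Fin n → ℝ} (h : nsq y ≤ 4 * a) :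
    nsq (D.act A y) ≤ 4 * a := by
  by_cases hy : y = 0
  · rw [hy, D.act_zero]; simp only [nsq, dotProduct_zero]; linarith [D.ha]
  · have hAy : A y ≠ 0 := fun h => hy (hA (h.trans (map_zero A).symm))
    rw [D.nsq_act hA hy]
    exact D.fl_le_four (div_pos (nsq_pos hAy) (nsq_pos hy)) (nsq_pos hy) h

theorem lt_nsq_act (hA : Function.Injective A) {y : Fin n → ℝ} (h : 4 * a < nsq y) :
    4 * a < nsq (D.act A y) := by
  have hy := ne_zero_of_lt_nsq (by linarith [D.ha]) h
  have hAy : A y ≠ 0 := fun h => hy (hA (h.trans (map_zero A).symm))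
  rw [D.nsq_act hA hy]
  exact D.fl_gt_four (div_pos (nsq_pos hAy) (nsq_pos hy)) h

theorem gOut_nsq_pos (D : RadialFlow b a) {y : Fin n → ℝ} (h : 4 * a < nsq y) : 0 < gOut b a (nsq y) :=
  (D.gOut_pos_iff (by linarith [D.ha])).2 h

theorem nsq_outX {y : Fin n → ℝ} (h : 4 * a < nsq y) :
    nsq (D.outX y) = gOut b a (nsq y) ^ b⁻¹ :=
  nsq_sqrt_smul (Real.rpow_nonneg (D.gOut_nsq_pos h).le _)
    (ne_zero_of_lt_nsq (by linarith [D.ha]) h)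

theorem outX_ne_zero {y : Fin n → ℝ} (h : 4 * a < nsq y) : D.outX y ≠ 0 := by
  refine ne_zero_of_lt_nsq le_rfl ?_
  rw [D.nsq_outX h]
  exact Real.rpow_pos_of_pos (D.gOut_nsq_pos h) _

theorem outX_act (hA : Function.Injective A) {y : Fin n → ℝ} (h : 4 * a < nsq y) :
    D.outX (D.act A y) = A (D.outX y) := by
  have ha := D.ha
  have hy := ne_zero_of_lt_nsq (by linarith [D.ha]) h
  have hAy : A y ≠ 0 := fun h => hy (hA (h.trans (map_zero A).symm))
  have h0 := nsq_pos hy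
  have h1 := nsq_pos hAy
  have ht := div_pos h1 h0
  have h2 := D.nsq_act hA hy
  have h3 := D.fl_outer _ _ ht (show a < nsq y by linarith)
  have hF := D.fl_pos ht h0
  have hG := D.gOut_nsq_pos h
  have hb0 : b ≠ 0 := by linarith [D.hb]
  unfold outX
  rw [h2, h3.2, Real.mul_rpow (by positivity) hG.le, ← Real.rpow_mul ht.le, mul_inv_cancel₀ hb0,
    Real.rpow_one, map_smul]
  unfold act
  rw [smul_smul]
  congr 1
  have hG' := Real.rpow_pos_of_pos hG b⁻¹
  rw [← Real.sqrt_mul (by positivity)]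
  congr 1
  field_simp

theorem ψ_gt_four {s : ℝ} (hs : 0 < s) : 4 * a < D.ψ s := by
  rw [← D.gOut_pos_iff (D.ψ_gt s), D.gOut_ψ]
  exact hs

theorem nsq_outY {x : Fin n → ℝ} (hx : x ≠ 0) : nsq (D.outY x) = D.ψ (nsq x ^ b) :=
  nsq_sqrt_smul (by linarith [D.ha, D.ψ_gt (nsq x ^ b)]) hx

theorem four_lt_nsq_outY {x : Fin n → ℝ} (hx : x ≠ 0) : 4 * a < nsq (D.outY x) := by
  rw [D.nsq_outY hx]
  exact D.ψ_gt_four (Real.rpow_pos_of_pos (nsq_pos hx) b)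

theorem outX_outY {x : Fin n → ℝ} (hx : x ≠ 0) : D.outX (D.outY x) = x := by
  have h0 := nsq_pos hx
  have hb0 : b ≠ 0 := by linarith [D.hb]
  have ha := D.ha
  have hψ := D.ψ_gt (nsq x ^ b)
  unfold outX
  rw [D.nsq_outY hx, D.gOut_ψ, ← Real.rpow_mul h0.le, mul_inv_cancel₀ hb0, Real.rpow_one]
  unfold outY
  rw [smul_smul, ← Real.sqrt_mul (div_nonneg h0.le (by linarith))]
  have : nsq x / D.ψ (nsq x ^ b) * (D.ψ (nsq x ^ b) / nsq x) = 1 := by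
    have : D.ψ (nsq x ^ b) ≠ 0 := by linarith
    field_simp
  rw [this, Real.sqrt_one, one_smul]

theorem outY_outX {y : Fin n → ℝ} (h : 4 * a < nsq y) : D.outY (D.outX y) = y := by
  have ha := D.ha
  have hy := ne_zero_of_lt_nsq (by linarith [D.ha]) h
  have h0 := nsq_pos hy
  have hb0 : b ≠ 0 := by linarith [D.hb]
  have hG := D.gOut_nsq_pos h
  have hG' := Real.rpow_pos_of_pos hG b⁻¹
  unfold outY
  rw [D.nsq_outX h, ← Real.rpow_mul hG.le, inv_mul_cancel₀ hb0, Real.rpow_one,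
    D.ψ_gOut _ (by linarith)]
  unfold outX
  rw [smul_smul, ← Real.sqrt_mul (by positivity)]
  have : nsq y / gOut b a (nsq y) ^ b⁻¹ * (gOut b a (nsq y) ^ b⁻¹ / nsq y) = 1 := by
    field_simp
  rw [this, Real.sqrt_one, one_smul]

theorem contDiffAt_outX {y : Fin n → ℝ} (h : 4 * a < nsq y) : ContDiffAt ℝ ω D.outX y := by
  have ha := D.ha
  have hy := ne_zero_of_lt_nsq (by linarith [D.ha]) h
  have h0 := nsq_pos hy
  have hG := D.gOut_nsq_pos h
  have hG' := Real.rpow_pos_of_pos hG b⁻¹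
  have e1 : ContDiffAt ℝ ω (fun y : Fin n → ℝ => gOut b a (nsq y)) y :=
    (contDiffAt_gOut h0 (by linarith)).comp y contDiff_nsq.contDiffAt
  have e2 : ContDiffAt ℝ ω (fun y : Fin n → ℝ => gOut b a (nsq y) ^ b⁻¹) y :=
    ContDiffAt.comp (g := fun x : ℝ => x ^ b⁻¹) y (contDiffAt_rpow_const hG) e1
  exact ((contDiffAt_sqrt' (div_pos hG' h0)).comp y
    (e2.div contDiff_nsq.contDiffAt h0.ne')).smul contDiffAt_id

theorem contDiffAt_outY {x : Fin n → ℝ} (hx : x ≠ 0) : ContDiffAt ℝ ω D.outY x := by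
  have ha := D.ha
  have h0 := nsq_pos hx
  have hψ := D.ψ_gt (nsq x ^ b)
  have e1 : ContDiffAt ℝ ω (fun y : Fin n → ℝ => nsq y ^ b) x :=
    (contDiffAt_rpow_const h0).comp x contDiff_nsq.contDiffAt
  have e2 : ContDiffAt ℝ ω (fun y : Fin n → ℝ => D.ψ (nsq y ^ b)) x :=
    (D.ψ_analytic _).comp x e1
  exact ((contDiffAt_sqrt' (div_pos (by linarith) h0)).comp x
    (e2.div contDiff_nsq.contDiffAt h0.ne')).smul contDiffAt_id

theorem contDiffAt_act_of_ne (hA : Function.Injective A) {y : Fin n → ℝ} (hy : y ≠ 0) :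
    ContDiffAt ℝ ω (D.act A) y := by
  have hAy : A y ≠ 0 := fun h => hy (hA (h.trans (map_zero A).symm))
  have h0 := nsq_pos hy
  have h1 := nsq_pos hAy
  have ht := div_pos h1 h0
  have e0 : ContDiffAt ℝ ω (fun y : Fin n → ℝ => nsq (A y)) y :=
    contDiff_nsq.contDiffAt.comp y A.contDiff.contDiffAt
  have e1 : ContDiffAt ℝ ω (fun y : Fin n → ℝ => (nsq (A y) / nsq y, nsq y)) y :=
    (e0.div contDiff_nsq.contDiffAt h0.ne').prodMk contDiff_nsq.contDiffAt
  have e2 : ContDiffAt ℝ ω (fun y : Fin n → ℝ => D.fl (nsq (A y) / nsq y) (nsq y)) y :=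
    ContDiffAt.comp (g := fun p : ℝ × ℝ => D.fl p.1 p.2) y (D.fl_analytic _ _ ht h0) e1
  exact ((contDiffAt_sqrt' (div_pos (D.fl_pos ht h0) h1)).comp y
    (e2.div e0 h1.ne')).smul A.contDiff.contDiffAt

end RadialFlow
end TorusBlowup

namespace TorusBlowup
open Metric Set Filter Topology MeasureTheory
namespace RadialFlow
variable {b a : ℝ} (D : RadialFlow b a) {n : ℕ} {A : (Fin n → ℝ) →L[ℝ] (Fin n → ℝ)}

theorem inX_zero : D.inX (0 : Fin n → ℝ) = 0 := by simp [inX]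

theorem inX_eq {y : Fin n → ℝ} (hy : y ≠ 0) (h : nsq y < a) :
    D.inX y = √(gIn b a (nsq y) ^ (-b⁻¹) / nsq y) • y := by
  have ha := D.ha
  have h0 := nsq_pos hy
  have hb0 : b ≠ 0 := by linarith [D.hb]
  have hq : 0 < (4 * a - nsq y) / (a - nsq y) := div_pos (by linarith) (by linarith)
  have e : gIn b a (nsq y) = (nsq y ^ b * ((4 * a - nsq y) / (a - nsq y)))⁻¹ := by
    unfold gIn
    rw [Real.rpow_neg h0.le, mul_inv, inv_div, mul_div_assoc]
    congr 1
    rw [← neg_div_neg_eq]; congr 1 <;> ring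
  unfold inX
  congr 1
  rw [e, Real.rpow_neg (by positivity), Real.inv_rpow (by positivity), inv_inv,
    Real.mul_rpow (by positivity) hq.le, ← Real.rpow_mul h0.le, mul_inv_cancel₀ hb0, Real.rpow_one,
    mul_div_cancel_left₀ _ h0.ne', Real.sqrt_eq_rpow, ← Real.rpow_mul hq.le]
  congr 1
  field_simp

theorem gIn_nsq_pos (D : RadialFlow b a) {y : Fin n → ℝ} (hy : y ≠ 0) (h : nsq y < a) :
    0 < gIn b a (nsq y) :=
  (D.gIn_pos_iff (nsq_pos hy) (by linarith [D.ha])).2 h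

theorem nsq_act_lt (hA : Function.Injective A) {y : Fin n → ℝ} (h : nsq y < a) :
    nsq (D.act A y) < a := by
  have ha := D.ha
  by_cases hy : y = 0
  · rw [hy, D.act_zero]; simpa [nsq] using ha
  have hAy : A y ≠ 0 := fun h => hy (hA (h.trans (map_zero A).symm))
  have ht := div_pos (nsq_pos hAy) (nsq_pos hy)
  obtain ⟨h1, h2, h3⟩ := D.fl_inner _ _ ht (nsq_pos hy) (by linarith)
  rw [D.nsq_act hA hy, ← D.gIn_pos_iff h1 h2, h3]
  exact mul_pos (Real.rpow_pos_of_pos ht _) (D.gIn_nsq_pos hy h)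

theorem inX_act (hA : Function.Injective A) {y : Fin n → ℝ} (h : nsq y < a) :
    D.inX (D.act A y) = A (D.inX y) := by
  have ha := D.ha
  by_cases hy : y = 0
  · simp [hy, D.act_zero, D.inX_zero]
  have hAy : A y ≠ 0 := fun h => hy (hA (h.trans (map_zero A).symm))
  have h0 := nsq_pos hy
  have h1 := nsq_pos hAy
  have ht := div_pos h1 h0
  have h2 := D.nsq_act hA hy
  have h3 := D.fl_inner _ _ ht h0 (by linarith)
  have hF := D.fl_pos ht h0
  have hG := D.gIn_nsq_pos hy h
  have hb0 : b ≠ 0 := by linarith [D.hb]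
  rw [D.inX_eq hy h, D.inX_eq (D.act_ne_zero hA hy) (D.nsq_act_lt hA h),
    h2, h3.2.2, Real.mul_rpow (by positivity) hG.le, ← Real.rpow_mul ht.le, neg_mul_neg,
    mul_inv_cancel₀ hb0, Real.rpow_one, map_smul]
  unfold act
  rw [smul_smul]
  congr 1
  have hG' := Real.rpow_pos_of_pos hG (-b⁻¹)
  rw [← Real.sqrt_mul (by positivity)]
  congr 1
  field_simp

/-- The inverse of the linearizing coordinate at the origin. -/
noncomputable def inY (z : Fin n → ℝ) : Fin n → ℝ := √(D.χ (nsq z ^ (-b)) / nsq z) • z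

theorem inY_inX {y : Fin n → ℝ} (h : nsq y < a) : D.inY (D.inX y) = y := by
  have ha := D.ha
  by_cases hy : y = 0
  · simp [hy, D.inX_zero, inY]
  have h0 := nsq_pos hy
  have hb0 : b ≠ 0 := by linarith [D.hb]
  have hG := D.gIn_nsq_pos hy h
  have hG' := Real.rpow_pos_of_pos hG (-b⁻¹)
  have e : nsq (D.inX y) = gIn b a (nsq y) ^ (-b⁻¹) := by
    rw [D.inX_eq hy h]; exact nsq_sqrt_smul hG'.le hy
  unfold inY
  rw [e, ← Real.rpow_mul hG.le, neg_mul_neg, inv_mul_cancel₀ hb0, Real.rpow_one,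
    D.χ_gIn _ ⟨h0, by linarith⟩, D.inX_eq hy h, smul_smul, ← Real.sqrt_mul (by positivity)]
  have : nsq y / gIn b a (nsq y) ^ (-b⁻¹) * (gIn b a (nsq y) ^ (-b⁻¹) / nsq y) = 1 := by
    field_simp
  rw [this, Real.sqrt_one, one_smul]

theorem contDiffAt_inX_coeff (D : RadialFlow b a) : ContDiffAt ℝ ω (fun y : Fin n → ℝ =>
    ((4 * a - nsq y) / (a - nsq y)) ^ (2 * b)⁻¹) 0 := by
  have ha := D.ha
  have e : ContDiffAt ℝ ω (fun y : Fin n → ℝ => (4 * a - nsq y) / (a - nsq y)) 0 :=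
    (contDiffAt_const.sub contDiff_nsq.contDiffAt).div
      (contDiffAt_const.sub contDiff_nsq.contDiffAt) (by simp [nsq, ha.ne'])
  exact ContDiffAt.comp (g := fun x : ℝ => x ^ (2 * b)⁻¹) 0
    (contDiffAt_rpow_const (by simp only [nsq, dotProduct_zero]; apply div_pos <;> linarith)) e

theorem hasFDerivAt_inX : HasFDerivAt D.inX
    ((4 : ℝ) ^ (2 * b)⁻¹ • ContinuousLinearMap.id ℝ (Fin n → ℝ)) 0 := by
  have h := ((D.contDiffAt_inX_coeff (n := n)).differentiableAt (by simp)).hasFDerivAt.smul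
    (hasFDerivAt_id (0 : Fin n → ℝ))
  refine HasFDerivAt.congr_fderiv h ?_
  ext v i
  have e : (4 * a - nsq (0 : Fin n → ℝ)) / (a - nsq (0 : Fin n → ℝ)) = 4 := by
    have ha := D.ha.ne'
    simp only [nsq, dotProduct_zero, sub_zero]
    field_simp
  rw [e]
  simp

theorem four_rpow_pos (b : ℝ) : (0 : ℝ) < (4 : ℝ) ^ (2 * b)⁻¹ :=
  Real.rpow_pos_of_pos (by norm_num) _

theorem eventually_nsq_lt (D : RadialFlow b a) : ∀ᶠ y : Fin n → ℝ in 𝓝 0, nsq y < a := by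
  have : ContinuousAt (nsq : (Fin n → ℝ) → ℝ) 0 := contDiff_nsq.continuous.continuousAt
  exact this.eventually (gt_mem_nhds (by simpa [nsq] using D.ha))

theorem contDiffAt_act (hA : Function.Injective A) (y : Fin n → ℝ) :
    ContDiffAt ℝ ω (D.act A) y := by
  by_cases hy : y = 0
  · subst hy
    have h1 : ContDiffAt ℝ ω D.inX (0 : Fin n → ℝ) :=
      D.contDiffAt_inX_coeff.smul contDiffAt_id
    have h2 : ContDiffAt ℝ ω D.inY (0 : Fin n → ℝ) := by
      have := contDiffAt_of_leftInverse (ψ := D.inY)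
        (ContinuousLinearEquiv.smulLeft (Units.mk0 _ (four_rpow_pos b).ne')) h1
        (D.hasFDerivAt_inX (n := n))
        (by filter_upwards [D.eventually_nsq_lt] with y hy using D.inY_inX hy)
      rwa [D.inX_zero] at this
    have h3 : ContDiffAt ℝ ω (fun y : Fin n → ℝ => D.inY (A (D.inX y))) 0 := by
      refine ContDiffAt.comp (g := D.inY) 0 ?_ (A.contDiff.contDiffAt.comp 0 h1)
      simpa [D.inX_zero] using h2
    refine h3.congr_of_eventuallyEq ?_
    filter_upwards [D.eventually_nsq_lt] with y hy
    rw [← D.inX_act hA hy, D.inY_inX (D.nsq_act_lt hA hy)]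
  · exact D.contDiffAt_act_of_ne hA hy

theorem hasFDerivAt_act_zero (hA : Function.Injective A) : HasFDerivAt (D.act A) A 0 := by
  have h1 : HasFDerivAt (D.act A) (fderiv ℝ (D.act A) 0) 0 :=
    ((D.contDiffAt_act hA 0).differentiableAt (by simp)).hasFDerivAt
  have h2 := HasFDerivAt.comp (g := D.inX) 0 (by rw [D.act_zero]; exact D.hasFDerivAt_inX) h1
  have h3 : HasFDerivAt (D.inX ∘ D.act A)
      (A.comp ((4 : ℝ) ^ (2 * b)⁻¹ • ContinuousLinearMap.id ℝ _)) 0 := by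
    refine (A.hasFDerivAt.comp 0 D.hasFDerivAt_inX).congr_of_eventuallyEq ?_
    filter_upwards [D.eventually_nsq_lt] with y hy using D.inX_act hA hy
  have h4 := h2.unique h3
  refine h1.congr_fderiv ?_
  ext v i
  have := congrFun (congrArg (fun L => L v) h4) i
  simp only [ContinuousLinearMap.comp_apply, _root_.smul_apply,
    ContinuousLinearMap.id_apply, map_smul, Pi.smul_apply, smul_eq_mul] at this
  exact mul_left_cancel₀ (four_rpow_pos b).ne' this

end RadialFlow
end TorusBlowup

namespace TorusBlowup
open Metric Set Filter Topology MeasureTheory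

/-- The complexified ratio of the outer linearizing coordinate to the identity. -/
noncomputable def ratioC (b : ℝ) (v : ℂ) : ℂ := ((1 - 4 * v) / (1 - v)) ^ (((2 * b)⁻¹ : ℝ) : ℂ)

theorem ratioC_zero (b : ℝ) : ratioC b 0 = 1 := by simp [ratioC]

theorem contDiffAt_ratioC (b : ℝ) : ContDiffAt ℂ ω (ratioC b) 0 := by
  have h1 : ContDiffAt ℂ ω (fun v : ℂ => (1 - 4 * v) / (1 - v)) 0 :=
    (contDiffAt_const.sub (contDiffAt_const.mul contDiffAt_id)).div
      (contDiffAt_const.sub contDiffAt_id) (by simp)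
  have h2 : AnalyticAt ℂ (ratioC b) 0 := by
    unfold ratioC
    exact h1.analyticAt.cpow analyticAt_const (by simp)
  exact h2.contDiffAt

theorem exists_ratioC_inverse (b : ℝ) : ∃ K : ℂ → ℂ, ContDiffAt ℂ ω K 0 ∧ K 0 = 1 ∧
    ∀ᶠ v in 𝓝 (0 : ℂ), K (v / ratioC b v ^ 2) * ratioC b v = 1 := by
  have hr := contDiffAt_ratioC b
  have hr0 := ratioC_zero b
  set Θ : ℂ → ℂ := fun v => v / ratioC b v ^ 2 with hΘ
  have hΘ0 : Θ 0 = 0 := by simp [hΘ]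
  have hΘc : ContDiffAt ℂ ω Θ 0 := contDiffAt_id.div (hr.pow 2) (by simp [hr0])
  have hd : HasDerivAt Θ 1 0 := by
    have h1 := (hr.differentiableAt (by simp)).hasDerivAt
    have h2 := (hasDerivAt_id (0 : ℂ)).div (h1.pow 2) (by simp [hr0])
    refine HasDerivAt.congr_deriv h2 ?_
    simp [hr0]
  have hf := hd.hasFDerivAt_equiv one_ne_zero
  have hs := hΘc.hasStrictFDerivAt' hf (by simp)
  set Ξ := hs.localInverse with hΞ
  have hΞc : ContDiffAt ℂ ω Ξ 0 := by
    have := hΘc.to_localInverse hf (by simp)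
    rw [hΘ0] at this
    exact this
  have hleft : ∀ᶠ v in 𝓝 (0 : ℂ), Ξ (Θ v) = v := hs.eventually_left_inverse
  have hΞ0 : Ξ 0 = 0 := by
    have := hleft.self_of_nhds
    rwa [hΘ0] at this
  have hrΞ : ContDiffAt ℂ ω (fun v => ratioC b (Ξ v)) 0 :=
    ContDiffAt.comp (g := ratioC b) 0 (by rwa [hΞ0]) hΞc
  refine ⟨fun v => (ratioC b (Ξ v))⁻¹, hrΞ.inv (by rw [hΞ0, hr0]; exact one_ne_zero),
    by simp [hΞ0, hr0], ?_⟩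
  have hne : ∀ᶠ v in 𝓝 (0 : ℂ), ratioC b v ≠ 0 :=
    hr.continuousAt.eventually_ne (by rw [hr0]; exact one_ne_zero)
  filter_upwards [hleft, hne] with v hv hv0
  change (ratioC b (Ξ (Θ v)))⁻¹ * ratioC b v = 1
  rw [hv, inv_mul_cancel₀ hv0]

theorem ratioC_ofReal {b a w : ℝ} (hb : b ≠ 0) (ha : 0 < a) (hw : 4 * a < w) :
    ratioC b ((a : ℂ) / (w : ℂ)) = ((√(gOut b a w ^ b⁻¹ / w) : ℝ) : ℂ) := by
  have hw0 : 0 < w := by linarith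
  have hq : 0 < (w - 4 * a) / (w - a) := div_pos (by linarith) (by linarith)
  have e1 : (1 - 4 * ((a : ℂ) / (w : ℂ))) / (1 - (a : ℂ) / (w : ℂ)) =
      (((w - 4 * a) / (w - a) : ℝ) : ℂ) := by
    have h1 : (w : ℂ) ≠ 0 := by exact_mod_cast hw0.ne'
    have h2 : (w : ℂ) - a ≠ 0 := by exact_mod_cast (show w - a ≠ 0 by linarith)
    push_cast
    have h3 : 1 - (a : ℂ) / (w : ℂ) ≠ 0 := by
      rw [one_sub_div h1]; exact div_ne_zero h2 h1
    rw [one_sub_div h1]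
    field_simp
  have e2 : gOut b a w ^ b⁻¹ / w = ((w - 4 * a) / (w - a)) ^ b⁻¹ := by
    unfold gOut
    rw [mul_div_assoc, Real.mul_rpow (by positivity) hq.le, ← Real.rpow_mul hw0.le,
      mul_inv_cancel₀ hb, Real.rpow_one, mul_div_cancel_left₀ _ hw0.ne']
  unfold ratioC
  rw [e1, e2, ← Complex.ofReal_cpow hq.le, Real.sqrt_eq_rpow, ← Real.rpow_mul hq.le]
  congr 3
  field_simp

theorem exists_transition_data {b : ℝ} (hb : 1 < b) {c ε : ℝ} (hc : 0 < c) (hε : 0 < ε) :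
    ∃ a : ℝ, 0 < a ∧ a ≤ c / 100 ∧ ∃ h k : ℂ → ℂ,
      DifferentiableOn ℂ h {z | c / 2 < ‖z‖} ∧ DifferentiableOn ℂ k {z | c / 2 < ‖z‖} ∧
      (∀ z, c / 2 < ‖z‖ → ‖h z - 1‖ ≤ ε) ∧ (∀ z, c / 2 < ‖z‖ → ‖k z - 1‖ ≤ ε) ∧
      ∀ w s : ℝ, c < w → s = √(gOut b a w ^ b⁻¹ / w) →
        h (w : ℂ) = s ∧ k ((w * s ^ 2 : ℝ) : ℂ) * s = 1 := by
  obtain ⟨K, hK, hK0, hKr⟩ := exists_ratioC_inverse b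
  have hr := contDiffAt_ratioC b
  have hr0 := ratioC_zero b
  have ev : ∀ᶠ v in 𝓝 (0 : ℂ), DifferentiableAt ℂ (ratioC b) v ∧ DifferentiableAt ℂ K v ∧
      ‖ratioC b v - 1‖ ≤ ε ∧ ‖K v - 1‖ ≤ ε ∧ K (v / ratioC b v ^ 2) * ratioC b v = 1 := by
    have h1 := hr.eventually (by simp)
    have h2 := hK.eventually (by simp)
    have h3 := hr.continuousAt.eventually (closedBall_mem_nhds _ hε)
    have h4 := hK.continuousAt.eventually (closedBall_mem_nhds _ hε)
    rw [hr0] at h3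
    rw [hK0] at h4
    filter_upwards [h1, h2, h3, h4, hKr] with v h1 h2 h3 h4 h5
    exact ⟨h1.differentiableAt (by simp), h2.differentiableAt (by simp),
      mem_closedBall_iff_norm.1 h3, mem_closedBall_iff_norm.1 h4, h5⟩
  obtain ⟨δ, hδ, hball⟩ := Metric.eventually_nhds_iff_ball.1 ev
  set a := min (c / 100) (c * δ / 4) with ha
  have ha0 : 0 < a := lt_min (by positivity) (by positivity)
  have ha1 : a ≤ c / 100 := min_le_left _ _
  have ha2 : a ≤ c * δ / 4 := min_le_right _ _
  have hz : ∀ z : ℂ, c / 2 < ‖z‖ → (a : ℂ) / z ∈ ball (0 : ℂ) δ := by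
    intro z hz
    rw [mem_ball_zero_iff, norm_div, Complex.norm_real, Real.norm_eq_abs, abs_of_pos ha0,
      div_lt_iff₀ (by linarith)]
    nlinarith
  have hdz : ∀ z : ℂ, c / 2 < ‖z‖ → DifferentiableAt ℂ (fun z => (a : ℂ) / z) z := by
    intro z hz
    have : z ≠ 0 := by
      rintro rfl
      simp at hz; linarith
    exact (differentiableAt_const _).div differentiableAt_id this
  refine ⟨a, ha0, ha1, fun z => ratioC b (a / z), fun z => K (a / z), fun z h => ?_, fun z h => ?_,
    fun z h => (hball _ (hz z h)).2.2.1, fun z h => (hball _ (hz z h)).2.2.2.1, ?_⟩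
  · exact ((hball _ (hz z h)).1.comp z (hdz z h)).differentiableWithinAt
  · exact ((hball _ (hz z h)).2.1.comp z (hdz z h)).differentiableWithinAt
  · intro w s hw hs
    have hw0 : 0 < w := by linarith
    have e1 := ratioC_ofReal (b := b) (a := a) (w := w) (by linarith) ha0 (by linarith)
    rw [← hs] at e1
    refine ⟨e1, ?_⟩
    have hwn : c / 2 < ‖(w : ℂ)‖ := by
      rw [Complex.norm_real, Real.norm_eq_abs, abs_of_pos hw0]; linarith
    have h5 := (hball _ (hz w hwn)).2.2.2.2
    rw [e1, div_div] at h5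
    push_cast
    exact h5

end TorusBlowup

namespace TorusBlowup
open Metric Set Filter Topology MeasureTheory

section General
variable {E : Type*} [NormedAddCommGroup E] [NormedSpace ℝ E]

theorem isInvertible_of_injective [FiniteDimensional ℝ E] {L : E →L[ℝ] E}
    (h : Function.Injective L) : L.IsInvertible :=
  ⟨(LinearEquiv.ofInjectiveEndo (L : E →ₗ[ℝ] E) h).toContinuousLinearEquiv, by ext; rfl⟩

theorem isInvertible_of_norm_sub_id [FiniteDimensional ℝ E] {L : E →L[ℝ] E} {q : ℝ} (hq : q < 1)
    (h : ‖L - ContinuousLinearMap.id ℝ E‖ ≤ q) : L.IsInvertible := by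
  refine isInvertible_of_injective ((injective_iff_map_eq_zero L).2 fun v hv => ?_)
  have h1 := (L - ContinuousLinearMap.id ℝ E).le_of_opNorm_le h v
  simp only [_root_.sub_apply, hv, ContinuousLinearMap.id_apply, zero_sub, norm_neg] at h1
  by_contra hne
  have := norm_pos_iff.2 hne
  nlinarith

/-- The displacement of a map whose derivative is close to the identity is a contraction. -/
theorem norm_displacement_sub_le {f : E → E} {S : Set E} (hS : Convex ℝ S) {q : ℝ}
    (hd : ∀ y ∈ S, DifferentiableAt ℝ f y)
    (hf : ∀ y ∈ S, ‖fderiv ℝ f y - ContinuousLinearMap.id ℝ E‖ ≤ q) {x y : E} (hx : x ∈ S)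
    (hy : y ∈ S) : ‖(f y - y) - (f x - x)‖ ≤ q * ‖y - x‖ :=
  hS.norm_image_sub_le_of_norm_hasFDerivWithin_le (f := fun y => f y - y)
    (fun z hz => ((hd z hz).hasFDerivAt.sub (hasFDerivAt_id z)).hasFDerivWithinAt) hf hx hy

theorem injOn_of_near_id {f : E → E} {S : Set E} (hS : Convex ℝ S) {q : ℝ} (hq : q < 1)
    (hd : ∀ y ∈ S, DifferentiableAt ℝ f y)
    (hf : ∀ y ∈ S, ‖fderiv ℝ f y - ContinuousLinearMap.id ℝ E‖ ≤ q) : InjOn f S := by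
  intro x hx y hy hxy
  have h := norm_displacement_sub_le hS hd hf hx hy
  rw [hxy, sub_sub_sub_cancel_left, norm_sub_rev] at h
  by_contra hne
  have := norm_pos_iff.2 (sub_ne_zero.2 (Ne.symm hne))
  nlinarith

theorem exists_preimage_of_near_id [CompleteSpace E] {f : E → E} {z : E} {η q : ℝ} (hη : 0 ≤ η)
    (hq0 : 0 ≤ q) (hq : q < 1) (hd : ∀ y ∈ closedBall z η, DifferentiableAt ℝ f y)
    (hb : ∀ y ∈ closedBall z η, ‖f y - y‖ ≤ η)
    (hf : ∀ y ∈ closedBall z η, ‖fderiv ℝ f y - ContinuousLinearMap.id ℝ E‖ ≤ q) :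
    ∃ y ∈ closedBall z η, f y = z := by
  set T : E → E := fun y => z - (f y - y) with hT
  have hmaps : MapsTo T (closedBall z η) (closedBall z η) := fun y hy => by
    rw [mem_closedBall_iff_norm, hT]
    simp only [sub_sub_cancel_left, norm_neg]
    exact hb y hy
  have hlip : ContractingWith ⟨q, hq0⟩ (hmaps.restrict T _ _) := by
    refine ⟨by exact_mod_cast hq, LipschitzWith.of_dist_le_mul fun x y => ?_⟩
    have := norm_displacement_sub_le (convex_closedBall z η) hd hf x.2 y.2
    rw [Subtype.dist_eq, Subtype.dist_eq, dist_eq_norm, dist_comm, dist_eq_norm]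
    change ‖(z - (f x - x)) - (z - (f y - y))‖ ≤ q * ‖(y : E) - x‖
    rwa [sub_sub_sub_cancel_left]
  obtain ⟨y, hy, hfix, -⟩ := hlip.exists_fixedPoint' (isClosed_closedBall.isComplete) hmaps
    (mem_closedBall_self hη) (edist_ne_top _ _)
  refine ⟨y, hy, ?_⟩
  have h1 : z - (f y - y) = y := hfix
  have := sub_eq_iff_eq_add.1 h1
  rw [this]; abel

theorem contDiffAt_of_comp {p g F : E → E} [CompleteSpace E] {u : E}
    (hp : ContDiffAt ℝ ω p u) (hi : (fderiv ℝ p u).IsInvertible) (hg : ContDiffAt ℝ ω g u)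
    (h : ∀ᶠ x in 𝓝 u, F (p x) = g x) : ContDiffAt ℝ ω F (p u) := by
  obtain ⟨e, he⟩ := hi
  have hd : HasFDerivAt p (e : E →L[ℝ] E) u := by
    rw [he]; exact (hp.differentiableAt (by simp)).hasFDerivAt
  have hs := hp.hasStrictFDerivAt' hd (by simp)
  have hq := hp.to_localInverse hd (by simp)
  have hq0 : hp.localInverse hd (by simp) (p u) = u := hp.localInverse_apply_image hd (by simp)
  have h1 : ContDiffAt ℝ ω (fun y => g (hp.localInverse hd (by simp) y)) (p u) :=
    ContDiffAt.comp (g := g) (p u) (by rwa [hq0]) hq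
  refine h1.congr_of_eventuallyEq ?_
  have h2 : ∀ᶠ y in 𝓝 (p u), p (hp.localInverse hd (by simp) y) = y := hs.eventually_right_inverse
  have h3 : ∀ᶠ y in 𝓝 (p u), F (p (hp.localInverse hd (by simp) y)) =
      g (hp.localInverse hd (by simp) y) := by
    have : Tendsto (hp.localInverse hd (by simp)) (𝓝 (p u)) (𝓝 u) := by
      have := hq.continuousAt.tendsto
      rwa [hq0] at this
    exact this.eventually h
  filter_upwards [h2, h3] with y h2 h3
  rw [← h3, h2]

end General

section Lattice
variable {n : ℕ}

/-- An integer vector, viewed as a real vector. -/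
abbrev intVec (l : Fin n → ℤ) : Fin n → ℝ := fun i => (l i : ℝ)

theorem intVec_add (k l : Fin n → ℤ) : intVec (k + l) = intVec k + intVec l := by
  ext i; simp [intVec]

theorem intVec_sub (k l : Fin n → ℤ) : intVec (k - l) = intVec k - intVec l := by
  ext i; simp [intVec]

theorem eq_of_norm_intVec_sub_lt {k l : Fin n → ℤ} (h : ‖intVec k - intVec l‖ < 1) : k = l := by
  ext i
  have h1 := (norm_le_pi_norm _ i).trans_lt h
  rw [Pi.sub_apply, Real.norm_eq_abs, abs_lt] at h1
  have h2 : -1 < k i - l i := by exact_mod_cast h1.1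
  have h3 : k i - l i < 1 := by exact_mod_cast h1.2
  omega

theorem norm_lt_of_nsq_lt {u : Fin n → ℝ} {r : ℝ} (hr : 0 < r) (h : nsq u < r ^ 2) : ‖u‖ < r := by
  have := norm_sq_le_dotProduct u
  exact lt_of_pow_lt_pow_left₀ 2 hr.le (this.trans_lt h)

theorem eq_of_nsq_sub_lt {x : Fin n → ℝ} {k l : Fin n → ℤ} (hk : nsq (x - intVec k) < 1 / 4)
    (hl : nsq (x - intVec l) < 1 / 4) : k = l := by
  have h1 : ‖x - intVec k‖ < 1 / 2 := norm_lt_of_nsq_lt (by norm_num) (by linarith)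
  have h2 : ‖x - intVec l‖ < 1 / 2 := norm_lt_of_nsq_lt (by norm_num) (by linarith)
  apply eq_of_norm_intVec_sub_lt
  have : intVec k - intVec l = (x - intVec l) - (x - intVec k) := by abel
  rw [this]
  linarith [norm_sub_le (x - intVec l) (x - intVec k)]

theorem nsq_le_of_norm_sub_le {u v : Fin n → ℝ} {η : ℝ} (h : ‖u - v‖ ≤ η) :
    nsq u ≤ 101 / 100 * nsq v + 101 * n * η ^ 2 := by
  have h1 : nsq u ≤ 101 / 100 * nsq v + 101 * nsq (u - v) := by
    simp only [nsq, dotProduct, Finset.mul_sum, ← Finset.sum_add_distrib]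
    refine Finset.sum_le_sum fun i _ => ?_
    simp only [Pi.sub_apply]
    nlinarith [sq_nonneg (100 * u i - 101 * v i)]
  have h2 := dotProduct_le_norm_sq (u - v)
  have h3 : ‖u - v‖ ^ 2 ≤ η ^ 2 := pow_le_pow_left₀ (norm_nonneg _) h 2
  have h4 : (n : ℝ) * ‖u - v‖ ^ 2 ≤ n * η ^ 2 := by gcongr
  change nsq (u - v) ≤ _ at h2
  linarith

theorem convex_nsq_lt (r : ℝ) : Convex ℝ {y : Fin n → ℝ | nsq y < r} := by
  have h : ConvexOn ℝ univ (nsq : (Fin n → ℝ) → ℝ) := by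
    refine ⟨convex_univ, fun x _ y _ s t hs ht hst => ?_⟩
    simp only [nsq, dotProduct, smul_eq_mul, Finset.mul_sum, ← Finset.sum_add_distrib]
    refine Finset.sum_le_sum fun i _ => ?_
    simp only [Pi.add_apply, Pi.smul_apply, smul_eq_mul]
    have : t = 1 - s := by linarith
    subst this
    nlinarith [mul_nonneg (mul_nonneg hs ht) (sq_nonneg (x i - y i))]
  simpa using h.convex_lt r

end Lattice

/-- A solution of the gluing problem: a pair of near-identity analytic maps realizing a periodic
family of blow-ups of the lattice points inside `ℝⁿ`. -/
structure Blowup (n : ℕ) (b : ℝ) where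
  c : ℝ
  c_pos : 0 < c
  c_le : c ≤ 1 / 1000000
  a : ℝ
  a_le : a ≤ c / 100
  D : RadialFlow b a
  η : ℝ
  η_pos : 0 < η
  η_le : η ≤ 1 / 4
  η_sq : 1010 * n * η ^ 2 ≤ c
  P : (Fin n → ℝ) → (Fin n → ℝ)
  O : (Fin n → ℝ) → (Fin n → ℝ)
  P_spec : ∀ y, nsq y < 32 * c → ContDiffAt ℝ ω P y ∧ ‖P y - y‖ ≤ η ∧
    ‖fderiv ℝ P y - ContinuousLinearMap.id ℝ _‖ ≤ η
  O_spec : ∀ x, (∀ l : Fin n → ℤ, 4 * c < nsq (x - intVec l)) →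
    ContDiffAt ℝ ω O x ∧ ‖O x - x‖ ≤ η ∧ ‖fderiv ℝ O x - ContinuousLinearMap.id ℝ _‖ ≤ η
  O_add : ∀ x (l : Fin n → ℤ), O (x + intVec l) = O x + intVec l
  glue : ∀ y, 8 * c < nsq y → nsq y < 32 * c → P y = O (D.outX y)

theorem exists_blowup (n : ℕ) {b : ℝ} (hb : 1 < b) (hb3 : b < 3) : Nonempty (Blowup n b) := by
  obtain ⟨c, hc, hc1, H⟩ := exists_cousin_solution n
  obtain ⟨η, hη, hη1, hη2⟩ : ∃ η : ℝ, 0 < η ∧ η ≤ 1 / 4 ∧ 1010 * n * η ^ 2 ≤ c := by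
    refine ⟨c / (1010 * (n + 1)), by positivity, ?_, ?_⟩
    · rw [div_le_iff₀ (by positivity)]
      have : (0 : ℝ) ≤ n := Nat.cast_nonneg n
      linarith
    · have hn : (0 : ℝ) ≤ n := Nat.cast_nonneg n
      rw [div_pow, mul_div_assoc', div_le_iff₀ (by positivity)]
      have h1 : c ^ 2 ≤ c := by nlinarith
      have h2 : 1010 * (n : ℝ) ≤ (1010 * (n + 1)) ^ 2 := by nlinarith
      calc 1010 * (n : ℝ) * c ^ 2 ≤ (1010 * (n + 1)) ^ 2 * c := by gcongr
        _ = c * (1010 * (n + 1)) ^ 2 := mul_comm _ _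
  obtain ⟨ε, hε, -, H⟩ := H η hη
  obtain ⟨a, ha, hac, h, k, h1, h2, h3, h4, h5⟩ := exists_transition_data hb hc hε
  obtain ⟨D⟩ := exists_radialFlow hb hb3 ha
  obtain ⟨P, O, hP, hO, hper, hglue⟩ := H h k h1 h2 h3 h4
  refine ⟨⟨c, hc, hc1, a, hac, D, η, hη, hη1, hη2, P, O, hP, hO, hper, fun y h8 h32 => ?_⟩⟩
  obtain ⟨e1, e2⟩ := h5 (nsq y) _ (by linarith) rfl
  exact hglue y _ h8 h32 e1 e2

end TorusBlowup

namespace TorusBlowup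
open Metric Set Filter Topology MeasureTheory

namespace RadialFlow
variable {b a : ℝ} (D : RadialFlow b a) {n : ℕ}

theorem gOut_rpow_eq {w : ℝ} (D : RadialFlow b a) (hw : 4 * a < w) :
    gOut b a w ^ b⁻¹ = w * ((w - 4 * a) / (w - a)) ^ b⁻¹ := by
  have ha := D.ha
  have hb : b ≠ 0 := by linarith [D.hb]
  have hw0 : 0 < w := by linarith
  have hq : 0 < (w - 4 * a) / (w - a) := div_pos (by linarith) (by linarith)
  unfold gOut
  rw [mul_div_assoc, Real.mul_rpow (by positivity) hq.le, ← Real.rpow_mul hw0.le,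
    mul_inv_cancel₀ hb, Real.rpow_one]

theorem nsq_outX_le {y : Fin n → ℝ} (h : 4 * a < nsq y) : nsq (D.outX y) ≤ nsq y := by
  have ha := D.ha
  rw [D.nsq_outX h, D.gOut_rpow_eq h]
  have hq : 0 < (nsq y - 4 * a) / (nsq y - a) := div_pos (by linarith) (by linarith)
  have h1 : ((nsq y - 4 * a) / (nsq y - a)) ^ b⁻¹ ≤ 1 := by
    refine Real.rpow_le_one hq.le ?_ (inv_nonneg.2 (by linarith [D.hb]))
    rw [div_le_one (by linarith)]; linarith
  nlinarith [nsq_nonneg y]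

theorem le_nsq_outX {y : Fin n → ℝ} (h : 100 * a ≤ nsq y) :
    24 / 25 * nsq y ≤ nsq (D.outX y) := by
  have ha := D.ha
  have h4 : 4 * a < nsq y := by linarith
  rw [D.nsq_outX h4, D.gOut_rpow_eq h4]
  have hq : 0 < (nsq y - 4 * a) / (nsq y - a) := div_pos (by linarith) (by linarith)
  have hq1 : (nsq y - 4 * a) / (nsq y - a) ≤ 1 := by rw [div_le_one (by linarith)]; linarith
  have h1 : (nsq y - 4 * a) / (nsq y - a) ≤ ((nsq y - 4 * a) / (nsq y - a)) ^ b⁻¹ := by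
    conv_lhs => rw [← Real.rpow_one ((nsq y - 4 * a) / (nsq y - a))]
    exact Real.rpow_le_rpow_of_exponent_ge hq hq1 (inv_le_one_of_one_le₀ D.hb.le)
  have h2 : 24 / 25 ≤ (nsq y - 4 * a) / (nsq y - a) := by
    rw [le_div_iff₀ (by linarith)]; linarith
  nlinarith [nsq_nonneg y]

theorem isInvertible_fderiv_outY {x : Fin n → ℝ} (hx : x ≠ 0) :
    (fderiv ℝ D.outY x).IsInvertible := by
  refine isInvertible_of_injective ?_
  have h1 := ((D.contDiffAt_outY hx).differentiableAt (by simp)).hasFDerivAt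
  have h2 := ((D.contDiffAt_outX (D.four_lt_nsq_outY hx)).differentiableAt (by simp)).hasFDerivAt
  have h3 := h2.comp x h1
  have h4 : HasFDerivAt (D.outX ∘ D.outY) (ContinuousLinearMap.id ℝ (Fin n → ℝ)) x := by
    refine (hasFDerivAt_id x).congr_of_eventuallyEq ?_
    filter_upwards [isOpen_ne.mem_nhds hx] with z hz using D.outX_outY hz
  have h5 := h3.unique h4
  refine Function.LeftInverse.injective (g := fderiv ℝ D.outX (D.outY x)) fun v => ?_
  exact congrArg (fun L => L v) h5

end RadialFlow

namespace Blowup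
variable {n : ℕ} {b : ℝ} (B : Blowup n b)

theorem a_pos : 0 < B.a := B.D.ha

theorem nsq_le {u v : Fin n → ℝ} {s : ℝ} (hs : 0 ≤ s) (hs2 : s ≤ 2) (h : ‖u - v‖ ≤ s * B.η) :
    nsq u ≤ 101 / 100 * nsq v + B.c / 2 := by
  have h1 := nsq_le_of_norm_sub_le h
  have h2 := B.η_sq
  have h3 : 101 * (n : ℝ) * (s * B.η) ^ 2 ≤ 101 * n * (4 * B.η ^ 2) := by
    have : (s * B.η) ^ 2 ≤ 4 * B.η ^ 2 := by
      rw [mul_pow]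
      have : s ^ 2 ≤ 4 := by nlinarith
      nlinarith [sq_nonneg B.η]
    have hn : (0 : ℝ) ≤ 101 * n := by positivity
    gcongr
  have e : 101 * (n : ℝ) * (4 * B.η ^ 2) = 404 / 1010 * (1010 * n * B.η ^ 2) := by ring
  linarith [B.c_pos]

theorem injOn_P : InjOn B.P {y | nsq y < 32 * B.c} :=
  injOn_of_near_id (convex_nsq_lt _) (q := B.η) (by linarith [B.η_le])
    (fun y hy => (B.P_spec y hy).1.differentiableAt (by simp)) (fun y hy => (B.P_spec y hy).2.2)

theorem inner_inner {k l : Fin n → ℤ} {y z : Fin n → ℝ} (hy : nsq y < 32 * B.c)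
    (hz : nsq z < 32 * B.c) (h : intVec k + B.P y = intVec l + B.P z) : k = l ∧ y = z := by
  have hc := B.c_le
  have h1 : ‖y‖ < 1 / 100 := norm_lt_of_nsq_lt (by norm_num) (by linarith)
  have h2 : ‖z‖ < 1 / 100 := norm_lt_of_nsq_lt (by norm_num) (by linarith)
  have h3 := (B.P_spec y hy).2.1
  have h4 := (B.P_spec z hz).2.1
  have hη := B.η_le
  have hkl : k = l := by
    apply eq_of_norm_intVec_sub_lt
    have e : intVec k - intVec l = ((B.P z - z) + z) - ((B.P y - y) + y) := by
      rw [sub_add_cancel, sub_add_cancel, sub_eq_sub_iff_add_eq_add, h, add_comm]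
    rw [e]
    have := norm_sub_le ((B.P z - z) + z) ((B.P y - y) + y)
    have := norm_add_le (B.P z - z) z
    have := norm_add_le (B.P y - y) y
    linarith
  subst hkl
  exact ⟨rfl, B.injOn_P hy hz (add_left_cancel h)⟩

theorem outer_outer {x x' : Fin n → ℝ} (hx : ∀ l, 8 * B.c < nsq (x - intVec l))
    (hx' : ∀ l, 8 * B.c < nsq (x' - intVec l)) (h : B.O x = B.O x') : x = x' := by
  have hc := B.c_pos
  have h1 := (B.O_spec x fun l => by linarith [hx l]).2.1
  have h2 := (B.O_spec x' fun l => by linarith [hx' l]).2.1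
  have hη := B.η_pos
  have hdist : ‖x' - x‖ ≤ 2 * B.η := by
    have e : x' - x = (B.O x - x) - (B.O x' - x') := by rw [h]; abel
    rw [e]
    linarith [norm_sub_le (B.O x - x) (B.O x' - x')]
  have key : ∀ z ∈ closedBall x (2 * B.η), ∀ l, 4 * B.c < nsq (z - intVec l) := by
    intro z hz l
    rw [mem_closedBall_iff_norm, norm_sub_rev] at hz
    have := B.nsq_le (u := x - intVec l) (v := z - intVec l) (s := 2) (by norm_num) le_rfl
      (by rwa [sub_sub_sub_cancel_right])
    linarith [hx l]
  refine injOn_of_near_id (convex_closedBall x (2 * B.η)) (q := B.η) (by linarith [B.η_le])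
    (fun z hz => (B.O_spec z (key z hz)).1.differentiableAt (by simp))
    (fun z hz => (B.O_spec z (key z hz)).2.2) (mem_closedBall_self (by linarith))
    (mem_closedBall_iff_norm.2 hdist) h

theorem far_of_near {x : Fin n → ℝ} {k : Fin n → ℤ} (h : 8 * B.c < nsq (x - intVec k))
    (h2 : nsq (x - intVec k) < 1 / 4) (l : Fin n → ℤ) : 8 * B.c < nsq (x - intVec l) := by
  by_cases hl : l = k
  · rwa [hl]
  · have hc := B.c_le
    by_contra hcon
    exact hl (eq_of_nsq_sub_lt (by linarith) h2)

theorem glue_add {y : Fin n → ℝ} (k : Fin n → ℤ) (h : 8 * B.c < nsq y) (h2 : nsq y < 32 * B.c) :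
    intVec k + B.P y = B.O (intVec k + B.D.outX y) := by
  rw [B.glue y h h2, add_comm, add_comm (intVec k), B.O_add]

theorem inner_outer {k : Fin n → ℤ} {y x : Fin n → ℝ} (hy : nsq y < 32 * B.c)
    (hx : ∀ l, 10 * B.c < nsq (x - intVec l)) (h : intVec k + B.P y = B.O x) :
    8 * B.c < nsq y ∧ x = intVec k + B.D.outX y := by
  have hc := B.c_pos
  have hcl := B.c_le
  have ha := B.a_le
  have ha0 := B.a_pos
  have h1 := (B.P_spec y hy).2.1
  have h2 := (B.O_spec x fun l => by linarith [hx l]).2.1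
  have h3 : nsq (x - intVec k) ≤ 101 / 100 * nsq y + B.c / 2 := by
    refine B.nsq_le (s := 2) (by norm_num) le_rfl ?_
    have e : x - intVec k - y = (B.P y - y) - (B.O x - x) := by rw [← h]; abel
    rw [e]
    linarith [norm_sub_le (B.P y - y) (B.O x - x)]
  have h4 : 9 * B.c < nsq y := by linarith [hx k]
  refine ⟨by linarith, ?_⟩
  have h5 := B.D.le_nsq_outX (y := y) (by linarith)
  have h6 := B.D.nsq_outX_le (y := y) (by linarith)
  refine B.outer_outer (fun l => by linarith [hx l]) (B.far_of_near (k := k) ?_ ?_) ?_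
  · rw [add_sub_cancel_left]; linarith
  · rw [add_sub_cancel_left]; linarith
  · rw [← B.glue_add k (by linarith) hy, h]

open Classical in
/-- The chart of the complement of the blown-up lattice points. -/
noncomputable def E (x : Fin n → ℝ) : Fin n → ℝ :=
  if h : ∃ k : Fin n → ℤ, nsq (x - intVec k) < 16 * B.c then
    intVec h.choose + B.P (B.D.outY (x - intVec h.choose)) else B.O x

theorem E_of_near {x : Fin n → ℝ} {k : Fin n → ℤ} (h : nsq (x - intVec k) < 16 * B.c) :
    B.E x = intVec k + B.P (B.D.outY (x - intVec k)) := by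
  have hex : ∃ k : Fin n → ℤ, nsq (x - intVec k) < 16 * B.c := ⟨k, h⟩
  have hc := B.c_le
  have e : hex.choose = k :=
    eq_of_nsq_sub_lt (x := x) (by linarith [hex.choose_spec]) (by linarith)
  unfold E
  rw [dif_pos hex, e]

theorem E_of_far {x : Fin n → ℝ} (h : ∀ k, 16 * B.c ≤ nsq (x - intVec k)) :
    B.E x = B.O x := by
  unfold E
  rw [dif_neg]
  push Not
  exact h

theorem nsq_lt_of_outX {y : Fin n → ℝ} (h : 4 * B.a < nsq y) {s : ℝ} (hs : 1 ≤ s)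
    (h2 : nsq (B.D.outX y) < s * B.c) :
    nsq y < 25 / 24 * s * B.c := by
  have hc := B.c_pos
  by_contra hcon
  push Not at hcon
  have := B.D.le_nsq_outX (y := y) (by nlinarith [B.a_le])
  nlinarith

theorem E_inner {y : Fin n → ℝ} (k : Fin n → ℤ) (h : 4 * B.a < nsq y)
    (h2 : nsq (B.D.outX y) < 26 * B.c) : B.E (intVec k + B.D.outX y) = intVec k + B.P y := by
  have hc := B.c_pos
  have hcl := B.c_le
  have h3 := B.nsq_lt_of_outX h (by norm_num) h2
  have h4 := B.D.nsq_outX_le h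
  rcases lt_or_ge (nsq (B.D.outX y)) (16 * B.c) with h5 | h5
  · rw [B.E_of_near (k := k) (by rwa [add_sub_cancel_left]), add_sub_cancel_left,
      B.D.outY_outX h]
  · rw [B.E_of_far, ← B.glue_add k (by linarith) (by linarith)]
    intro l
    by_cases hl : l = k
    · rwa [hl, add_sub_cancel_left]
    · by_contra hcon
      push Not at hcon
      exact hl (eq_of_nsq_sub_lt (x := intVec k + B.D.outX y) (by linarith) (by rw [add_sub_cancel_left]; linarith))

theorem sub_ne_zero_of_notMem {x : Fin n → ℝ} (hx : x ∉ range (intVec (n := n)))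
    (k : Fin n → ℤ) : x - intVec k ≠ 0 := fun h => hx ⟨k, (sub_eq_zero.1 h).symm⟩

theorem E_near {x : Fin n → ℝ} {k : Fin n → ℤ} (hx : x ≠ intVec k)
    (h : nsq (x - intVec k) < 26 * B.c) :
    B.E x = intVec k + B.P (B.D.outY (x - intVec k)) := by
  have hne := sub_ne_zero.2 hx
  have := B.E_inner k (B.D.four_lt_nsq_outY hne) (by rwa [B.D.outX_outY hne])
  rwa [B.D.outX_outY hne, add_sub_cancel] at this

theorem E_outer {x : Fin n → ℝ} (h : ∀ k, 10 * B.c < nsq (x - intVec k)) : B.E x = B.O x := by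
  have hc := B.c_pos
  by_cases hn : ∃ k : Fin n → ℤ, nsq (x - intVec k) < 16 * B.c
  · obtain ⟨k, hk⟩ := hn
    have hne : x - intVec k ≠ 0 := ne_zero_of_lt_nsq (by positivity) (h k)
    have h4 := B.D.four_lt_nsq_outY hne
    have h5 : nsq (B.D.outX (B.D.outY (x - intVec k))) < 16 * B.c := by rwa [B.D.outX_outY hne]
    have h6 := B.nsq_lt_of_outX h4 (by norm_num) h5
    have h7 := B.D.nsq_outX_le h4
    rw [B.D.outX_outY hne] at h7
    rw [B.E_of_near hk, B.glue_add k (by linarith [h k]) (by linarith), B.D.outX_outY hne,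
      add_sub_cancel]
  · push Not at hn
    exact B.E_of_far hn

theorem E_add (x : Fin n → ℝ) (l : Fin n → ℤ) : B.E (x + intVec l) = B.E x + intVec l := by
  have e : ∀ k, x + intVec l - intVec (k + l) = x - intVec k := fun k => by
    rw [intVec_add]; abel
  by_cases hn : ∃ k : Fin n → ℤ, nsq (x - intVec k) < 16 * B.c
  · obtain ⟨k, hk⟩ := hn
    rw [B.E_of_near hk, B.E_of_near (k := k + l) (by rwa [e]), e, intVec_add]
    abel
  · push Not at hn
    rw [B.E_of_far hn, B.E_of_far, B.O_add]
    intro k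
    have := hn (k - l)
    rwa [← e, sub_add_cancel] at this

/-- Every point of the complement of the lattice is treated by one of the two charts. -/
theorem near_or_far (x : Fin n → ℝ) : (∃ k : Fin n → ℤ, nsq (x - intVec k) < 16 * B.c) ∨
    ∀ k, 16 * B.c ≤ nsq (x - intVec k) := by
  by_cases hn : ∃ k : Fin n → ℤ, nsq (x - intVec k) < 16 * B.c
  · exact Or.inl hn
  · push Not at hn
    exact Or.inr hn

theorem nsq_outY_lt {u : Fin n → ℝ} (hu : u ≠ 0) (h : nsq u < 26 * B.c) :
    nsq (B.D.outY u) < 32 * B.c := by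
  have := B.nsq_lt_of_outX (s := 26) (B.D.four_lt_nsq_outY hu) (by norm_num)
    (by rwa [B.D.outX_outY hu])
  linarith [B.c_pos]

theorem outY_injective {u v : Fin n → ℝ} (hu : u ≠ 0) (hv : v ≠ 0)
    (h : B.D.outY u = B.D.outY v) : u = v := by
  rw [← B.D.outX_outY hu, h, B.D.outX_outY hv]

theorem E_injOn : InjOn B.E (range (intVec (n := n)))ᶜ := by
  have hc := B.c_pos
  have mixed : ∀ x ∈ (range (intVec (n := n)))ᶜ, ∀ x', ∀ k, nsq (x - intVec k) < 16 * B.c →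
      (∀ k, 16 * B.c ≤ nsq (x' - intVec k)) → B.E x = B.E x' → x = x' := by
    intro x hx x' k hk hx' h
    have hne := sub_ne_zero_of_notMem hx k
    rw [B.E_of_near hk, B.E_of_far hx'] at h
    have h1 := B.inner_outer (B.nsq_outY_lt hne (by linarith))
      (fun l => by linarith [hx' l]) h
    rw [h1.2, B.D.outX_outY hne, add_sub_cancel]
  intro x hx x' hx' h
  rcases B.near_or_far x with ⟨k, hk⟩ | hf <;> rcases B.near_or_far x' with ⟨k', hk'⟩ | hf'
  · have hne := sub_ne_zero_of_notMem hx k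
    have hne' := sub_ne_zero_of_notMem hx' k'
    rw [B.E_of_near hk, B.E_of_near hk'] at h
    obtain ⟨rfl, h2⟩ := B.inner_inner (B.nsq_outY_lt hne (by linarith))
      (B.nsq_outY_lt hne' (by linarith)) h
    exact sub_left_injective (B.outY_injective hne hne' h2)
  · exact mixed x hx x' k hk hf' h
  · exact (mixed x' hx' x k' hk' hf h.symm).symm
  · rw [B.E_of_far hf, B.E_of_far hf'] at h
    exact B.outer_outer (fun l => by linarith [hf l]) (fun l => by linarith [hf' l]) h

theorem E_ne_inner {x : Fin n → ℝ} (hx : x ∉ range (intVec (n := n))) {k : Fin n → ℤ}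
    {y : Fin n → ℝ} (hy : nsq y ≤ 4 * B.a) : B.E x ≠ intVec k + B.P y := by
  intro h
  have hc := B.c_pos
  have ha := B.a_le
  rcases B.near_or_far x with ⟨l, hl⟩ | hf
  · have hne := sub_ne_zero_of_notMem hx l
    rw [B.E_of_near hl] at h
    have h2 := (B.inner_inner (B.nsq_outY_lt hne (by linarith)) (by linarith) h).2
    have h3 := B.D.four_lt_nsq_outY hne
    rw [h2] at h3
    linarith
  · rw [B.E_of_far hf] at h
    have := (B.inner_outer (by linarith) (fun l => by linarith [hf l]) h.symm).1
    linarith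

theorem covering (ξ : Fin n → ℝ) : (∃ x ∉ range (intVec (n := n)), B.E x = ξ) ∨
    ∃ (k : Fin n → ℤ) (y : Fin n → ℝ), nsq y ≤ 4 * B.a ∧ intVec k + B.P y = ξ := by
  have hc := B.c_pos
  have hcl := B.c_le
  have ha := B.a_le
  have ha0 := B.a_pos
  have hη := B.η_pos
  have hηle := B.η_le
  by_cases hn : ∃ k : Fin n → ℤ, nsq (ξ - intVec k) < 20 * B.c
  · obtain ⟨k, hk⟩ := hn
    have hball : ∀ y ∈ closedBall (ξ - intVec k) B.η, nsq y < 26 * B.c := fun y hy => by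
      have := B.nsq_le (s := 1) (by norm_num) (by norm_num)
        (by rw [one_mul]; exact mem_closedBall_iff_norm.1 hy)
      linarith
    obtain ⟨y, hy, hP⟩ := exists_preimage_of_near_id hη.le hη.le (by linarith)
      (fun y hy => (B.P_spec y (by linarith [hball y hy])).1.differentiableAt (by simp))
      (fun y hy => (B.P_spec y (by linarith [hball y hy])).2.1)
      (fun y hy => (B.P_spec y (by linarith [hball y hy])).2.2)
    have hξ : intVec k + B.P y = ξ := by rw [hP, add_sub_cancel]
    rcases le_or_gt (nsq y) (4 * B.a) with h4 | h4
    · exact Or.inr ⟨k, y, h4, hξ⟩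
    · refine Or.inl ⟨intVec k + B.D.outX y, ?_, ?_⟩
      · rintro ⟨l, hl⟩
        have h5 := B.D.nsq_outX_le h4
        have h6 := hball y hy
        have h7 : k = l := by
          refine eq_of_nsq_sub_lt (x := intVec l) ?_ (by simp [nsq])
          rw [hl, add_sub_cancel_left]; linarith
        subst h7
        exact B.D.outX_ne_zero h4 (by simpa using hl.symm)
      · rw [B.E_inner k h4 ((B.D.nsq_outX_le h4).trans_lt (hball y hy)), hξ]
  · push Not at hn
    have hball : ∀ x ∈ closedBall ξ B.η, ∀ l, 16 * B.c < nsq (x - intVec l) := fun x hx l => by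
      have := B.nsq_le (u := ξ - intVec l) (v := x - intVec l) (s := 1) (by norm_num) (by norm_num)
        (by rw [one_mul, sub_sub_sub_cancel_right, norm_sub_rev]; exact mem_closedBall_iff_norm.1 hx)
      linarith [hn l]
    obtain ⟨x, hx, hO⟩ := exists_preimage_of_near_id hη.le hη.le (by linarith)
      (fun y hy => (B.O_spec y fun l => by linarith [hball y hy l]).1.differentiableAt (by simp))
      (fun y hy => (B.O_spec y fun l => by linarith [hball y hy l]).2.1)
      (fun y hy => (B.O_spec y fun l => by linarith [hball y hy l]).2.2)
    refine Or.inl ⟨x, ?_, ?_⟩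
    · rintro ⟨l, rfl⟩
      have := hball _ hx l
      simp only [sub_self, nsq, dotProduct_zero] at this
      linarith
    · rw [B.E_of_far fun l => (hball x hx l).le, hO]

theorem E_regular {x : Fin n → ℝ} (hx : x ∉ range (intVec (n := n))) :
    ContDiffAt ℝ ω B.E x ∧ (fderiv ℝ B.E x).IsInvertible := by
  have hc := B.c_pos
  have hη := B.η_pos
  have hηle := B.η_le
  rcases B.near_or_far x with ⟨k, hk⟩ | hf
  · have hne := sub_ne_zero_of_notMem hx k
    have hP := B.P_spec _ (B.nsq_outY_lt hne (by linarith))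
    have hY := B.D.contDiffAt_outY hne
    have ev : B.E =ᶠ[𝓝 x] fun x => intVec k + B.P (B.D.outY (x - intVec k)) := by
      have h1 : ∀ᶠ z in 𝓝 x, nsq (z - intVec k) < 26 * B.c :=
        (contDiff_nsq.continuous.comp (continuous_id.sub continuous_const)).continuousAt.eventually
          (gt_mem_nhds (by change nsq (x - intVec k) < 26 * B.c; linarith))
      filter_upwards [h1, isOpen_ne.mem_nhds (sub_ne_zero.1 hne)] with z hz hz2
      exact B.E_near hz2 hz
    have hYs : ContDiffAt ℝ ω (fun x => B.D.outY (x - intVec k)) x :=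
      ContDiffAt.comp (g := B.D.outY) x hY (contDiffAt_id.sub contDiffAt_const)
    have hc1 : ContDiffAt ℝ ω (fun x => intVec k + B.P (B.D.outY (x - intVec k))) x :=
      contDiffAt_const.add (ContDiffAt.comp (g := B.P) x hP.1 hYs)
    refine ⟨hc1.congr_of_eventuallyEq ev, ?_⟩
    have hYd : HasFDerivAt (fun x => B.D.outY (x - intVec k))
        (fderiv ℝ B.D.outY (x - intVec k)) x := by
      have := (hY.differentiableAt (by simp)).hasFDerivAt.comp x
        ((hasFDerivAt_id x).sub_const (intVec k))
      rwa [ContinuousLinearMap.comp_id] at this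
    have hd : HasFDerivAt (fun x => intVec k + B.P (B.D.outY (x - intVec k)))
        ((fderiv ℝ B.P (B.D.outY (x - intVec k))).comp (fderiv ℝ B.D.outY (x - intVec k))) x :=
      ((HasFDerivAt.comp (g := B.P) x (hP.1.differentiableAt (by simp)).hasFDerivAt
        hYd)).const_add _
    rw [(hd.congr_of_eventuallyEq ev).fderiv]
    exact (isInvertible_of_norm_sub_id (by linarith) hP.2.2).comp
      (B.D.isInvertible_fderiv_outY hne)
  · have hO := B.O_spec x fun l => by linarith [hf l]
    have ev : B.E =ᶠ[𝓝 x] B.O := by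
      filter_upwards [closedBall_mem_nhds x hη] with z hz
      refine B.E_outer fun l => ?_
      have := B.nsq_le (u := x - intVec l) (v := z - intVec l) (s := 1) (by norm_num) (by norm_num)
        (by rw [one_mul, sub_sub_sub_cancel_right, norm_sub_rev]; exact mem_closedBall_iff_norm.1 hz)
      linarith [hf l]
    refine ⟨hO.1.congr_of_eventuallyEq ev, ?_⟩
    rw [ev.fderiv_eq]
    exact isInvertible_of_norm_sub_id (by linarith) hO.2.2

end Blowup
end TorusBlowup

namespace TorusBlowup
open Metric Set Filter Topology MeasureTheory

variable {n : ℕ}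

/-- The linear map of `ℝⁿ` given by an integer matrix. -/
noncomputable def linMap (g : Matrix.SpecialLinearGroup (Fin n) ℤ) :
    (Fin n → ℝ) →L[ℝ] (Fin n → ℝ) :=
  LinearMap.toContinuousLinearMap (Matrix.toLin' (g.1.map (Int.cast : ℤ → ℝ)))

theorem linMap_apply (g : Matrix.SpecialLinearGroup (Fin n) ℤ) (v : Fin n → ℝ) :
    linMap g v = (g.1.map (Int.cast : ℤ → ℝ)) *ᵥ v := rfl

theorem linMap_one : linMap (1 : Matrix.SpecialLinearGroup (Fin n) ℤ) =
    ContinuousLinearMap.id ℝ (Fin n → ℝ) := by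
  ext v i
  have : (1 : Matrix (Fin n) (Fin n) ℤ).map (Int.cast : ℤ → ℝ) = 1 :=
    Matrix.map_one _ Int.cast_zero Int.cast_one
  simp [linMap_apply, this]

theorem linMap_mul (g h : Matrix.SpecialLinearGroup (Fin n) ℤ) :
    linMap (g * h) = (linMap g).comp (linMap h) := by
  refine ContinuousLinearMap.ext fun v => ?_
  have : (g.1 * h.1).map (Int.cast : ℤ → ℝ) =
    g.1.map (Int.cast : ℤ → ℝ) * h.1.map (Int.cast : ℤ → ℝ) :=
    Matrix.map_mul (f := Int.castRingHom ℝ)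
  simp only [ContinuousLinearMap.comp_apply, linMap_apply, Matrix.mulVec_mulVec,
    Matrix.SpecialLinearGroup.coe_mul, this]

theorem linMap_inv_apply (g : Matrix.SpecialLinearGroup (Fin n) ℤ) (v : Fin n → ℝ) :
    linMap g⁻¹ (linMap g v) = v := by
  rw [← ContinuousLinearMap.comp_apply, ← linMap_mul, inv_mul_cancel, linMap_one]; rfl

theorem linMap_injective (g : Matrix.SpecialLinearGroup (Fin n) ℤ) :
    Function.Injective (linMap g) :=
  Function.LeftInverse.injective (linMap_inv_apply g)

theorem linMap_intVec (g : Matrix.SpecialLinearGroup (Fin n) ℤ) (k : Fin n → ℤ) :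
    linMap g (intVec k) = intVec (g.1 *ᵥ k) := by
  ext i
  simp [linMap_apply, intVec, Matrix.mulVec, dotProduct]

theorem linMap_notMem (g : Matrix.SpecialLinearGroup (Fin n) ℤ) {x : Fin n → ℝ}
    (hx : x ∉ range (intVec (n := n))) : linMap g x ∉ range (intVec (n := n)) := by
  rintro ⟨m, hm⟩
  exact hx ⟨(g⁻¹).1 *ᵥ m, by rw [← linMap_intVec, hm, linMap_inv_apply]⟩

namespace Blowup
variable {b : ℝ} (B : Blowup n b)

open Classical in
/-- The lift to `ℝⁿ` of the blown-up action of an integer matrix. -/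
noncomputable def F (g : Matrix.SpecialLinearGroup (Fin n) ℤ) (ξ : Fin n → ℝ) : Fin n → ℝ :=
  if h : ∃ x ∉ range (intVec (n := n)), B.E x = ξ then B.E (linMap g h.choose)
  else if h : ∃ p : (Fin n → ℤ) × (Fin n → ℝ),
      nsq p.2 ≤ 4 * B.a ∧ intVec p.1 + B.P p.2 = ξ then
    intVec (g.1 *ᵥ h.choose.1) + B.P (B.D.act (linMap g) h.choose.2)
  else ξ

theorem F_E (g : Matrix.SpecialLinearGroup (Fin n) ℤ) {x : Fin n → ℝ}
    (hx : x ∉ range (intVec (n := n))) : B.F g (B.E x) = B.E (linMap g x) := by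
  have h : ∃ z ∉ range (intVec (n := n)), B.E z = B.E x := ⟨x, hx, rfl⟩
  unfold F
  rw [dif_pos h, B.E_injOn h.choose_spec.1 hx h.choose_spec.2]

theorem F_P (g : Matrix.SpecialLinearGroup (Fin n) ℤ) (k : Fin n → ℤ) {y : Fin n → ℝ}
    (hy : nsq y ≤ 4 * B.a) :
    B.F g (intVec k + B.P y) = intVec (g.1 *ᵥ k) + B.P (B.D.act (linMap g) y) := by
  have h : ∃ p : (Fin n → ℤ) × (Fin n → ℝ),
      nsq p.2 ≤ 4 * B.a ∧ intVec p.1 + B.P p.2 = intVec k + B.P y := ⟨(k, y), hy, rfl⟩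
  have h' : ¬ ∃ x ∉ range (intVec (n := n)), B.E x = intVec k + B.P y := by
    rintro ⟨x, hx, e⟩
    exact B.E_ne_inner hx hy e
  have hc := B.c_pos
  have ha := B.a_le
  obtain ⟨e1, e2⟩ := B.inner_inner (by linarith [h.choose_spec.1]) (by linarith)
    h.choose_spec.2
  unfold F
  rw [dif_neg h', dif_pos h, e1, e2]

theorem F_P_of_lt (g : Matrix.SpecialLinearGroup (Fin n) ℤ) (k : Fin n → ℤ) {y : Fin n → ℝ}
    (hy : nsq y < 26 * B.c) (hy' : nsq (B.D.act (linMap g) y) < 26 * B.c) :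
    B.F g (intVec k + B.P y) = intVec (g.1 *ᵥ k) + B.P (B.D.act (linMap g) y) := by
  rcases le_or_gt (nsq y) (4 * B.a) with h | h
  · exact B.F_P g k h
  · have hinj := linMap_injective g
    have h2 : 4 * B.a < nsq (B.D.act (linMap g) y) := B.D.lt_nsq_act hinj h
    rw [← B.E_inner k h ((B.D.nsq_outX_le h).trans_lt hy),
      ← B.E_inner (g.1 *ᵥ k) h2 ((B.D.nsq_outX_le h2).trans_lt hy'), B.D.outX_act hinj h,
      F_E, map_add, linMap_intVec]
    rintro ⟨m, hm⟩
    have hc := B.c_pos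
    have hcl := B.c_le
    have h3 := B.D.nsq_outX_le h
    have h7 : k = m := by
      refine eq_of_nsq_sub_lt (x := intVec m) ?_ (by simp [nsq])
      rw [hm, add_sub_cancel_left]; linarith
    subst h7
    exact B.D.outX_ne_zero h (by simpa using hm.symm)

theorem F_add (g : Matrix.SpecialLinearGroup (Fin n) ℤ) (ξ : Fin n → ℝ) (l : Fin n → ℤ) :
    B.F g (ξ + intVec l) = B.F g ξ + intVec (g.1 *ᵥ l) := by
  rcases B.covering ξ with ⟨x, hx, rfl⟩ | ⟨k, y, hy, rfl⟩
  · have hx' : x + intVec l ∉ range (intVec (n := n)) := by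
      rintro ⟨m, hm⟩
      exact hx ⟨m - l, by rw [intVec_sub, hm, add_sub_cancel_right]⟩
    rw [← B.E_add, B.F_E g hx', B.F_E g hx, map_add, linMap_intVec, B.E_add]
  · rw [add_right_comm, ← intVec_add, B.F_P g _ hy, B.F_P g _ hy, Matrix.mulVec_add, intVec_add,
      add_right_comm]

theorem F_one (ξ : Fin n → ℝ) : B.F 1 ξ = ξ := by
  rcases B.covering ξ with ⟨x, hx, rfl⟩ | ⟨k, y, hy, rfl⟩
  · rw [B.F_E 1 hx, linMap_one]; rfl
  · rw [B.F_P 1 k hy, linMap_one, B.D.act_id, Matrix.SpecialLinearGroup.coe_one, Matrix.one_mulVec]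

theorem F_mul (g h : Matrix.SpecialLinearGroup (Fin n) ℤ) (ξ : Fin n → ℝ) :
    B.F (g * h) ξ = B.F g (B.F h ξ) := by
  rcases B.covering ξ with ⟨x, hx, rfl⟩ | ⟨k, y, hy, rfl⟩
  · rw [B.F_E _ hx, B.F_E _ hx, B.F_E _ (linMap_notMem h hx), linMap_mul]; rfl
  · rw [B.F_P _ k hy, B.F_P _ k hy, B.F_P _ _ (B.D.nsq_act_le (linMap_injective h) hy),
      linMap_mul, B.D.act_comp (linMap_injective h) (linMap_injective g), Matrix.mulVec_mulVec,
      Matrix.SpecialLinearGroup.coe_mul]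

theorem P_regular (k : Fin n → ℤ) {y : Fin n → ℝ} (hy : nsq y < 32 * B.c) :
    ContDiffAt ℝ ω (fun y => intVec k + B.P y) y ∧
      HasFDerivAt (fun y => intVec k + B.P y) (fderiv ℝ B.P y) y ∧
      (fderiv ℝ B.P y).IsInvertible := by
  have h := B.P_spec y hy
  exact ⟨contDiffAt_const.add h.1, (h.1.differentiableAt (by simp)).hasFDerivAt.const_add _,
    isInvertible_of_norm_sub_id (by linarith [B.η_le]) h.2.2⟩

theorem eventually_F_P (g : Matrix.SpecialLinearGroup (Fin n) ℤ) (k : Fin n → ℤ)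
    {y : Fin n → ℝ} (hy : nsq y ≤ 4 * B.a) : ∀ᶠ z in 𝓝 y,
    B.F g (intVec k + B.P z) = intVec (g.1 *ᵥ k) + B.P (B.D.act (linMap g) z) := by
  have hc := B.c_pos
  have ha := B.a_le
  have hinj := linMap_injective g
  have h2 := B.D.nsq_act_le hinj hy
  have c1 : ∀ᶠ z in 𝓝 y, nsq z < 26 * B.c :=
    contDiff_nsq.continuous.continuousAt.eventually (gt_mem_nhds (by linarith))
  have c2 : ∀ᶠ z in 𝓝 y, nsq (B.D.act (linMap g) z) < 26 * B.c :=
    (ContinuousAt.comp (g := nsq) contDiff_nsq.continuous.continuousAt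
      (B.D.contDiffAt_act hinj y).continuousAt).eventually
      (gt_mem_nhds (by change nsq (B.D.act (linMap g) y) < _; linarith))
  filter_upwards [c1, c2] with z h3 h4 using B.F_P_of_lt g k h3 h4

theorem eventually_F_E (g : Matrix.SpecialLinearGroup (Fin n) ℤ) {x : Fin n → ℝ}
    (hx : x ∉ range (intVec (n := n))) : ∀ᶠ z in 𝓝 x, B.F g (B.E z) = B.E (linMap g z) := by
  have hc : IsOpen (range (intVec (n := n)))ᶜ := by
    rw [isOpen_compl_iff]
    have : range (intVec (n := n)) = Set.pi univ fun _ => range ((↑) : ℤ → ℝ) := by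
      ext v
      simp only [mem_range, Set.mem_pi, mem_univ, true_imp_iff]
      refine ⟨?_, fun h => ?_⟩
      · rintro ⟨k, rfl⟩ i; exact ⟨k i, rfl⟩
      · choose k hk using h
        exact ⟨k, funext hk⟩
    rw [this]
    exact isClosed_set_pi fun _ _ => Int.isClosedEmbedding_coe_real.isClosed_range
  filter_upwards [hc.mem_nhds hx] with z hz using B.F_E g hz

theorem contDiff_F (g : Matrix.SpecialLinearGroup (Fin n) ℤ) : ContDiff ℝ ω (B.F g) := by
  have hc := B.c_pos
  have ha := B.a_le
  refine contDiff_iff_contDiffAt.2 fun ξ => ?_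
  rcases B.covering ξ with ⟨x, hx, rfl⟩ | ⟨k, y, hy, rfl⟩
  · exact contDiffAt_of_comp (B.E_regular hx).1 (B.E_regular hx).2
      (ContDiffAt.comp (g := B.E) x (B.E_regular (linMap_notMem g hx)).1
        (linMap g).contDiff.contDiffAt) (B.eventually_F_E g hx)
  · have hinj := linMap_injective g
    have h1 := B.P_regular k (y := y) (by linarith)
    have h2 := B.P_regular (g.1 *ᵥ k) (y := B.D.act (linMap g) y)
      (by linarith [B.D.nsq_act_le hinj hy])
    exact contDiffAt_of_comp (p := fun y => intVec k + B.P y) h1.1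
      (by rw [h1.2.1.fderiv]; exact h1.2.2)
      (ContDiffAt.comp (g := fun y => intVec (g.1 *ᵥ k) + B.P y) y h2.1 (B.D.contDiffAt_act hinj y))
      (B.eventually_F_P g k hy)

end Blowup
end TorusBlowup

namespace TorusBlowup
open Metric Set Filter Topology MeasureTheory

variable {n : ℕ}

/-- `μ` is a real eigenvalue of `L`. -/
def IsEigenvalue (L : (Fin n → ℝ) →L[ℝ] (Fin n → ℝ)) (μ : ℝ) : Prop := ∃ v, v ≠ 0 ∧ L v = μ • v

/-- The real eigenvalues of the derivatives of `F` at its fixed points modulo `ℤⁿ`. -/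
def fixedSpectrum (F : (Fin n → ℝ) → (Fin n → ℝ)) : Set ℝ :=
  {κ | ∃ x, (∃ l, F x = x + intVec l) ∧ IsEigenvalue (fderiv ℝ F x) κ}

theorem isEigenvalue_of_conj {p q φ F : (Fin n → ℝ) → (Fin n → ℝ)} {x : Fin n → ℝ}
    {L M : (Fin n → ℝ) →L[ℝ] (Fin n → ℝ)} (hp : HasFDerivAt p L x) (hL : L.IsInvertible)
    (hφ : HasFDerivAt φ M x) (hq : HasFDerivAt q L (φ x)) (hF : DifferentiableAt ℝ F (p x))
    (h : ∀ᶠ z in 𝓝 x, F (p z) = q (φ z)) (κ : ℝ) :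
    IsEigenvalue (fderiv ℝ F (p x)) κ ↔ IsEigenvalue M κ := by
  have h1 : (fderiv ℝ F (p x)).comp L = L.comp M :=
    (HasFDerivAt.comp (g := F) x hF.hasFDerivAt hp).unique
      ((HasFDerivAt.comp (g := q) x hq hφ).congr_of_eventuallyEq h)
  have h2 : ∀ u, fderiv ℝ F (p x) (L u) = L (M u) := fun u => congrArg (fun T => T u) h1
  obtain ⟨e, rfl⟩ := hL
  constructor
  · rintro ⟨v, hv, hv2⟩
    refine ⟨e.symm v, by simpa using hv, e.injective ?_⟩
    have := h2 (e.symm v)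
    simp only [ContinuousLinearEquiv.coe_coe, ContinuousLinearEquiv.apply_symm_apply] at this
    rw [← this, hv2, map_smul, ContinuousLinearEquiv.apply_symm_apply]
  · rintro ⟨u, hu, hu2⟩
    refine ⟨e u, by simpa using hu, ?_⟩
    have := h2 u
    rw [hu2, map_smul] at this
    exact this

namespace RadialFlow
variable {b a : ℝ} (D : RadialFlow b a) {A M : (Fin n → ℝ) →L[ℝ] (Fin n → ℝ)}

theorem act_eq_smul (hA : Function.Injective A) {z : Fin n → ℝ} (hz : z ≠ 0) :
    D.act A z = ((D.act A z ⬝ᵥ A z) / nsq (A z)) • A z := by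
  have hAz : A z ≠ 0 := fun h => hz (hA (h.trans (map_zero A).symm))
  have := nsq_pos hAz
  have e : ∀ s : ℝ, s • A z = ((s • A z) ⬝ᵥ A z / nsq (A z)) • A z := fun s => by
    rw [smul_dotProduct, smul_eq_mul, mul_div_assoc, div_self this.ne', mul_one]
  exact e _

theorem exists_eigenvalue_of_act_eq (hA : Function.Injective A) {y : Fin n → ℝ} (hy : y ≠ 0)
    (h : D.act A y = y) : ∃ μ : ℝ, 0 < μ ∧ A y = μ • y := by
  have hAy : A y ≠ 0 := fun h => hy (hA (h.trans (map_zero A).symm))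
  have h1 := nsq_pos hAy
  have h2 := nsq_pos hy
  have hs : 0 < √(D.fl (nsq (A y) / nsq y) (nsq y) / nsq (A y)) :=
    Real.sqrt_pos.2 (div_pos (D.fl_pos (div_pos h1 h2) h2) h1)
  refine ⟨(√(D.fl (nsq (A y) / nsq y) (nsq y) / nsq (A y)))⁻¹, inv_pos.2 hs,
    (eq_inv_smul_iff₀ hs.ne').2 h⟩

theorem exists_fderiv_act_apply (hA : Function.Injective A) {y : Fin n → ℝ} (hy : y ≠ 0)
    (h : D.act A y = y) {μ : ℝ} (hμ : 0 < μ) (hAy : A y = μ • y)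
    (hM : HasFDerivAt (D.act A) M y) (u : Fin n → ℝ) :
    ∃ s : ℝ, M u = s • y + μ⁻¹ • A u := by
  have hAy0 : A y ≠ 0 := fun h => hy (hA (h.trans (map_zero A).symm))
  have h2 := nsq_pos hy
  set s : (Fin n → ℝ) → ℝ := fun z => (D.act A z ⬝ᵥ A z) / nsq (A z) with hs
  have hact : DifferentiableAt ℝ (D.act A) y := hM.differentiableAt
  have hsd : DifferentiableAt ℝ s y := by
    have c : ∀ i, DifferentiableAt ℝ (fun z => D.act A z i) y := differentiableAt_pi.1 hact
    have c' : ∀ i, DifferentiableAt ℝ (fun z => A z i) y :=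
      differentiableAt_pi.1 A.differentiableAt
    have c1 : DifferentiableAt ℝ (fun z => D.act A z ⬝ᵥ A z) y :=
      DifferentiableAt.fun_sum fun i _ => (c i).mul (c' i)
    have c2 : DifferentiableAt ℝ (fun z => nsq (A z)) y :=
      DifferentiableAt.fun_sum fun i _ => (c' i).mul (c' i)
    simp only [hs, div_eq_mul_inv]
    exact c1.mul (c2.fun_inv (nsq_pos hAy0).ne')
  have hd := hsd.hasFDerivAt.smul (A.hasFDerivAt (x := y))
  have he : D.act A =ᶠ[𝓝 y] fun z => s z • A z := by
    filter_upwards [isOpen_ne.mem_nhds hy] with z hz using D.act_eq_smul hA hz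
  have hu := congrArg (fun T => T u) (hM.unique (hd.congr_of_eventuallyEq he))
  have hsy : s y = μ⁻¹ := by
    simp only [hs]
    rw [h, hAy, nsq_smul, dotProduct_smul, smul_eq_mul]
    field_simp
  refine ⟨fderiv ℝ s y u * μ, ?_⟩
  rw [hu, mul_smul, ← hAy, ← hsy]
  simp [add_comm]

theorem radial_eigenvalue (hA : Function.Injective A) {y : Fin n → ℝ} (hy : y ≠ 0)
    (h : D.act A y = y) {μ κ : ℝ} (hμ : 0 < μ) (hAy : A y = μ • y)
    (hM : HasFDerivAt (D.act A) M y) (hκ : M y = κ • y) :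
    (a < nsq y → κ = μ ^ (2 * b)) ∧ (nsq y < 4 * a → κ = μ ^ (-(2 * b))) := by
  have ha := D.ha
  have hw := nsq_pos hy
  have hline : HasDerivAt (fun σ : ℝ => σ • y) y 1 := by
    simpa using (hasDerivAt_id (1 : ℝ)).smul_const y
  have hf : HasDerivAt (fun σ : ℝ => nsq (D.act A (σ • y))) (κ * (2 * nsq y)) 1 := by
    have h1 : HasDerivAt (fun σ : ℝ => D.act A (σ • y)) (κ • y) 1 := by
      have := HasFDerivAt.comp_hasDerivAt (l := D.act A) 1 (by rw [one_smul]; exact hM) hline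
      rwa [hκ] at this
    have h2 : HasDerivAt (fun σ : ℝ => ∑ i, D.act A (σ • y) i * D.act A (σ • y) i)
        (∑ i, ((κ • y) i * D.act A ((1 : ℝ) • y) i + D.act A ((1 : ℝ) • y) i * (κ • y) i)) 1 :=
      HasDerivAt.fun_sum fun i _ => (hasDerivAt_pi.1 h1 i).mul (hasDerivAt_pi.1 h1 i)
    refine h2.congr_deriv ?_
    simp only [one_smul, h, Pi.smul_apply, smul_eq_mul, nsq, dotProduct, Finset.mul_sum]
    exact Finset.sum_congr rfl fun i _ => by ring
  have hg : HasDerivAt (fun σ : ℝ => σ ^ 2 * nsq y) (2 * nsq y) 1 :=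
    (((hasDerivAt_id (1 : ℝ)).pow 2).mul_const (nsq y)).congr_deriv (by simp)
  have hfl : ∀ᶠ σ : ℝ in 𝓝 1, nsq (D.act A (σ • y)) = D.fl (μ ^ 2) (σ ^ 2 * nsq y) := by
    filter_upwards [lt_mem_nhds (zero_lt_one' ℝ)] with σ hσ
    rw [D.nsq_act hA (smul_ne_zero hσ.ne' hy), map_smul, hAy, smul_comm, nsq_smul, nsq_smul,
      mul_div_assoc, div_self (by positivity), mul_one]
  have e1 : nsq (D.act A ((1 : ℝ) • y)) = nsq y := by rw [one_smul, h]
  have e2 : (1 : ℝ) ^ 2 * nsq y = nsq y := by ring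
  have hq := profileQuad_pos D.hb D.hb3 (w := nsq y) D.ha
  have hμ2 : (0 : ℝ) < μ ^ 2 := by positivity
  have hmul : ∀ {c d : ℝ}, d ≠ 0 → d * (κ * (2 * nsq y)) = c * (d * (2 * nsq y)) → κ = c := by
    intro c d hd he
    have : (d * (2 * nsq y)) * κ = (d * (2 * nsq y)) * c := by linarith
    exact mul_left_cancel₀ (by positivity) this
  constructor
  · intro hlt
    have hG := hasDerivAt_gOut (b := b) (a := a) hw hlt.ne'
    have d1 := HasDerivAt.comp (h₂ := gOut b a) 1 (by rw [e1]; exact hG) hf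
    have d2 := (HasDerivAt.comp (h₂ := gOut b a) 1 (by rw [e2]; exact hG) hg).const_mul
      ((μ ^ 2) ^ b)
    have ev : (gOut b a ∘ fun σ : ℝ => nsq (D.act A (σ • y))) =ᶠ[𝓝 1]
        fun σ => (μ ^ 2) ^ b * (gOut b a ∘ fun σ : ℝ => σ ^ 2 * nsq y) σ := by
      have c : ∀ᶠ σ : ℝ in 𝓝 1, a < σ ^ 2 * nsq y :=
        hg.continuousAt.eventually (lt_mem_nhds (by simpa using hlt))
      filter_upwards [hfl, c] with σ h1 h2
      simp only [Function.comp]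
      rw [h1, (D.fl_outer _ _ hμ2 h2).2]
    have := d1.unique (d2.congr_of_eventuallyEq ev)
    have hd := hmul ?_ this
    · rw [hd, ← Real.rpow_natCast, ← Real.rpow_mul hμ.le]; norm_cast
    · have h1 := Real.rpow_pos_of_pos hw (b - 1)
      have h2 : nsq y - a ≠ 0 := by linarith
      positivity
  · intro hlt
    have hG := hasDerivAt_gIn (b := b) (a := a) hw hlt.ne
    have d1 := HasDerivAt.comp (h₂ := gIn b a) 1 (by rw [e1]; exact hG) hf
    have d2 := (HasDerivAt.comp (h₂ := gIn b a) 1 (by rw [e2]; exact hG) hg).const_mul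
      ((μ ^ 2) ^ (-b))
    have ev : (gIn b a ∘ fun σ : ℝ => nsq (D.act A (σ • y))) =ᶠ[𝓝 1]
        fun σ => (μ ^ 2) ^ (-b) * (gIn b a ∘ fun σ : ℝ => σ ^ 2 * nsq y) σ := by
      have c : ∀ᶠ σ : ℝ in 𝓝 1, σ ^ 2 * nsq y < 4 * a :=
        hg.continuousAt.eventually (gt_mem_nhds (by simpa using hlt))
      filter_upwards [hfl, c, lt_mem_nhds (zero_lt_one' ℝ)] with σ h1 h2 h3
      simp only [Function.comp]
      rw [h1, (D.fl_inner _ _ hμ2 (by positivity) h2).2.2]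
    have := d1.unique (d2.congr_of_eventuallyEq ev)
    have hd := hmul ?_ this
    · rw [hd, ← Real.rpow_natCast, ← Real.rpow_mul hμ.le]; congr 1; push_cast; ring
    · have h1 := Real.rpow_pos_of_pos hw (-b - 1)
      have h2 : nsq y - 4 * a ≠ 0 := by linarith
      exact neg_ne_zero.2 (by positivity)

theorem eigenvalue_fderiv_act (hA : Function.Injective A) {y : Fin n → ℝ} (h : D.act A y = y)
    (hM : HasFDerivAt (D.act A) M y) {κ : ℝ} (hκ : IsEigenvalue M κ) :
    IsEigenvalue A κ ∨ ∃ μ, 0 < μ ∧ IsEigenvalue A μ ∧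
      (IsEigenvalue A (κ * μ) ∨ κ = 1 ∨ κ = μ ^ (2 * b) ∨ κ = μ ^ (-(2 * b))) := by
  by_cases hy : y = 0
  · subst hy
    rw [hM.unique (D.hasFDerivAt_act_zero hA)] at hκ
    exact Or.inl hκ
  · obtain ⟨μ, hμ, hAy⟩ := D.exists_eigenvalue_of_act_eq hA hy h
    refine Or.inr ⟨μ, hμ, ⟨y, hy, hAy⟩, ?_⟩
    obtain ⟨u, hu, hMu⟩ := hκ
    by_cases hpar : ∃ r : ℝ, u = r • y
    · obtain ⟨r, rfl⟩ := hpar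
      have hr : r ≠ 0 := fun h => hu (by rw [h, zero_smul])
      have hMy : M y = κ • y := by
        rw [map_smul, smul_comm] at hMu
        exact smul_right_injective _ hr hMu
      have := D.radial_eigenvalue hA hy h hμ hAy hM hMy
      rcases lt_or_ge a (nsq y) with hlt | hge
      · exact Or.inr (Or.inr (Or.inl (this.1 hlt)))
      · exact Or.inr (Or.inr (Or.inr (this.2 (by linarith [D.ha]))))
    · by_cases hκ1 : κ = 1
      · exact Or.inr (Or.inl hκ1)
      · left
        obtain ⟨s, hs⟩ := D.exists_fderiv_act_apply hA hy h hμ hAy hM u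
        have hAu : A u = (κ * μ) • u - (s * μ) • y := by
          have : μ⁻¹ • A u = κ • u - s • y := by rw [← hMu, hs]; abel
          rw [← smul_inv_smul₀ hμ.ne' (A u), this, smul_sub, smul_smul, smul_smul]
          rw [mul_comm κ, mul_comm s]
        have hκ' : 1 - κ ≠ 0 := sub_ne_zero.2 (Ne.symm hκ1)
        refine ⟨u + (s / (1 - κ)) • y, fun h0 => hpar ⟨-(s / (1 - κ)), ?_⟩, ?_⟩
        · rw [neg_smul]; exact eq_neg_of_add_eq_zero_left h0
        · rw [map_add, map_smul, hAu, hAy]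
          ext i
          simp only [Pi.add_apply, Pi.sub_apply, Pi.smul_apply, smul_eq_mul]
          field_simp
          ring

theorem exists_fixed_act (hA : Function.Injective A) {μ : ℝ} (hμ : 0 < μ)
    (h : IsEigenvalue A μ) : ∃ y, nsq y = 4 * a ∧ D.act A y = y ∧
      ∀ M, HasFDerivAt (D.act A) M y → IsEigenvalue M (μ ^ (2 * b)) := by
  obtain ⟨v, hv, hAv⟩ := h
  have ha := D.ha
  have hnv := nsq_pos hv
  set y := √(4 * a / nsq v) • v with hydef
  have hy4 : nsq y = 4 * a := nsq_sqrt_smul (by linarith) hv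
  have hy : y ≠ 0 := ne_zero_of_lt_nsq le_rfl (by rw [hy4]; linarith)
  have hAy : A y = μ • y := by rw [hydef, map_smul, hAv, smul_comm]
  have hact : D.act A y = y := by
    rw [act, hAy, nsq_smul, hy4, mul_div_assoc, div_self (by positivity), mul_one,
      D.fl_four (by positivity), smul_smul]
    have : 4 * a / (μ ^ 2 * (4 * a)) = (μ⁻¹) ^ 2 := by field_simp
    rw [this, Real.sqrt_sq (by positivity), inv_mul_cancel₀ hμ.ne', one_smul]
  refine ⟨y, hy4, hact, fun M hM => ⟨y, hy, ?_⟩⟩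
  obtain ⟨s, hs⟩ := D.exists_fderiv_act_apply hA hy hact hμ hAy hM y
  have hMy : M y = (s + 1) • y := by
    rw [hs, hAy, inv_smul_smul₀ hμ.ne', add_smul, one_smul]
  rw [hMy, (D.radial_eigenvalue hA hy hact hμ hAy hM hMy).1 (by linarith)]

end RadialFlow

namespace Blowup
variable {b : ℝ} (B : Blowup n b)

theorem fixedSpectrum_subset (g : Matrix.SpecialLinearGroup (Fin n) ℤ) {κ : ℝ}
    (h : κ ∈ fixedSpectrum (B.F g)) :
    IsEigenvalue (linMap g) κ ∨ ∃ μ, 0 < μ ∧ IsEigenvalue (linMap g) μ ∧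
      (IsEigenvalue (linMap g) (κ * μ) ∨ κ = 1 ∨ κ = μ ^ (2 * b) ∨ κ = μ ^ (-(2 * b))) := by
  obtain ⟨ξ, ⟨l, hl⟩, hκ⟩ := h
  have hc := B.c_pos
  have ha := B.a_le
  have hF : ∀ z, DifferentiableAt ℝ (B.F g) z := (B.contDiff_F g).differentiable (by simp)
  rcases B.covering ξ with ⟨x, hx, rfl⟩ | ⟨k, y, hy, rfl⟩
  · left
    have hx' : x + intVec l ∉ range (intVec (n := n)) := by
      rintro ⟨m, hm⟩
      exact hx ⟨m - l, by rw [intVec_sub, hm, add_sub_cancel_right]⟩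
    have hfix : linMap g x = x + intVec l :=
      B.E_injOn (linMap_notMem g hx) hx' (by rw [← B.F_E g hx, hl, B.E_add])
    have hE := ((B.E_regular hx).1.differentiableAt (by simp)).hasFDerivAt
    have hE' : HasFDerivAt B.E (fderiv ℝ B.E x) (linMap g x) := by
      rw [hfix]
      have h1 := ((B.E_regular hx').1.differentiableAt (by simp)).hasFDerivAt
      have h2 : HasFDerivAt (fun z => B.E (z + intVec l)) (fderiv ℝ B.E (x + intVec l)) x := by
        have := HasFDerivAt.comp (g := B.E) x h1 ((hasFDerivAt_id x).add_const (intVec l))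
        rwa [ContinuousLinearMap.comp_id] at this
      have h3 : HasFDerivAt (fun z => B.E (z + intVec l)) (fderiv ℝ B.E x) x := by
        simp only [B.E_add]; exact hE.add_const _
      rwa [h2.unique h3] at h1
    exact (isEigenvalue_of_conj hE (B.E_regular hx).2 (linMap g).hasFDerivAt hE' (hF _)
      (B.eventually_F_E g hx) κ).1 hκ
  · have hinj := linMap_injective g
    have h2 := B.D.nsq_act_le hinj hy
    rw [B.F_P g k hy, add_right_comm, ← intVec_add] at hl
    obtain ⟨-, hfix⟩ := B.inner_inner (by linarith) (by linarith) hl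
    have hd := ((B.D.contDiffAt_act hinj y).differentiableAt (by simp)).hasFDerivAt
    have hP := B.P_regular k (y := y) (by linarith)
    have hP' := B.P_regular (g.1 *ᵥ k) (y := y) (by linarith)
    refine B.D.eigenvalue_fderiv_act hinj hfix hd
      ((isEigenvalue_of_conj (p := fun y => intVec k + B.P y)
        (q := fun y => intVec (g.1 *ᵥ k) + B.P y) hP.2.1 hP.2.2 hd (by rw [hfix]; exact hP'.2.1)
        (hF _) (B.eventually_F_P g k hy) κ).1 hκ)

theorem rpow_mem_fixedSpectrum (g : Matrix.SpecialLinearGroup (Fin n) ℤ) {μ : ℝ} (hμ : 0 < μ)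
    (h : IsEigenvalue (linMap g) μ) : μ ^ (2 * b) ∈ fixedSpectrum (B.F g) := by
  have hc := B.c_pos
  have ha := B.a_le
  have hinj := linMap_injective g
  obtain ⟨y, hy, hfix, hM⟩ := B.D.exists_fixed_act hinj hμ h
  have hd := ((B.D.contDiffAt_act hinj y).differentiableAt (by simp)).hasFDerivAt
  have hP := B.P_regular 0 (y := y) (by linarith)
  have hP' := B.P_regular (g.1 *ᵥ 0) (y := y) (by linarith)
  refine ⟨intVec 0 + B.P y, ⟨0, ?_⟩, (isEigenvalue_of_conj (p := fun y => intVec 0 + B.P y)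
        (q := fun y => intVec (g.1 *ᵥ 0) + B.P y) hP.2.1 hP.2.2 hd (by rw [hfix]; exact hP'.2.1)
        ((B.contDiff_F g).differentiable (by simp) _) (B.eventually_F_P g 0 hy.le) _).2 (hM _ hd)⟩
  rw [B.F_P g 0 hy.le, hfix, Matrix.mulVec_zero]
  have : intVec (0 : Fin n → ℤ) = 0 := by ext i; simp [intVec]
  rw [this, add_zero]

end Blowup
end TorusBlowup

namespace TorusBlowup
open Metric Set Filter Topology MeasureTheory

variable {n : ℕ}

theorem torusProj_eq_iff {x y : Fin n → ℝ} :
    torusProj n x = torusProj n y ↔ ∃ l, x = y + intVec l := by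
  simp only [torusProj, funext_iff]
  constructor
  · intro h
    have : ∀ i, ∃ k : ℤ, x i = y i + k := fun i => by
      obtain ⟨k, hk⟩ := (AddCircle.coe_eq_zero_iff (1 : ℝ) (x := x i - y i)).1
        (by rw [AddCircle.coe_sub, h i, sub_self])
      rw [zsmul_one] at hk
      exact ⟨k, by linarith⟩
    choose k hk using this
    exact ⟨k, hk⟩
  · rintro ⟨l, h⟩ i
    have h0 : ((l i : ℝ) : AddCircle (1 : ℝ)) = 0 :=
      (AddCircle.coe_eq_zero_iff (1 : ℝ)).2 ⟨l i, zsmul_one _⟩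
    rw [h i, Pi.add_apply, AddCircle.coe_add, h0, add_zero]

theorem torusProj_surjective : Function.Surjective (torusProj n) := fun t => by
  have := fun i => QuotientAddGroup.mk_surjective (t i)
  choose x hx using this
  exact ⟨x, funext hx⟩

theorem torusProj_add (x : Fin n → ℝ) (l : Fin n → ℤ) :
    torusProj n (x + intVec l) = torusProj n x := torusProj_eq_iff.2 ⟨l, rfl⟩

/-- The self-map of the torus induced by an equivariant self-map of `ℝⁿ`. -/
noncomputable def descend (F : (Fin n → ℝ) → (Fin n → ℝ)) (t : Torus n) : Torus n :=
  torusProj n (F (Function.surjInv torusProj_surjective t))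

theorem isTorusLift_descend {F : (Fin n → ℝ) → (Fin n → ℝ)}
    (h : ∀ x l, ∃ m, F (x + intVec l) = F x + intVec m) : IsTorusLift n (descend F) F := by
  intro x
  obtain ⟨l, hl⟩ := torusProj_eq_iff.1 (Function.surjInv_eq torusProj_surjective (torusProj n x))
  obtain ⟨m, hm⟩ := h x l
  rw [descend, hl, hm, torusProj_add]

theorem fderiv_eq_of_torusProj_eq {f g : (Fin n → ℝ) → (Fin n → ℝ)} {f' g' : (Fin n → ℝ) →L[ℝ] (Fin n → ℝ)}
    {x : Fin n → ℝ} (hf : HasFDerivAt f f' x) (hg : HasFDerivAt g g' x)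
    (h : ∀ z, torusProj n (f z) = torusProj n (g z)) : f' = g' := by
  choose l hl using fun z => torusProj_eq_iff.1 (h z)
  have hd : ∀ z, intVec (l z) = f z - g z := fun z => by rw [hl z, add_sub_cancel_left]
  have hc : ContinuousAt (fun z => intVec (l z)) x := by
    simp only [hd]; exact hf.continuousAt.sub hg.continuousAt
  have he : f =ᶠ[𝓝 x] fun z => g z + intVec (l x) := by
    filter_upwards [hc.eventually (ball_mem_nhds _ one_pos)] with z hz
    rw [dist_eq_norm] at hz
    rw [hl z, eq_of_norm_intVec_sub_lt hz]
  exact (hf.congr_of_eventuallyEq he.symm).unique (hg.add_const _)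

/-- The spectrum of the derivatives at fixed points is an invariant of `C¹` conjugacy. -/
theorem fixedSpectrum_subset_of_conj {φ₁ φ₂ h : Torus n → Torus n}
    {F₁ F₂ : (Fin n → ℝ) → (Fin n → ℝ)} (h₁ : IsTorusLift n φ₁ F₁) (h₂ : IsTorusLift n φ₂ F₂)
    (d₁ : Differentiable ℝ F₁) (d₂ : Differentiable ℝ F₂) (hh : IsCrTorusDiffeo n 1 h)
    (hconj : h ∘ φ₁ = φ₂ ∘ h) : fixedSpectrum F₁ ⊆ fixedSpectrum F₂ := by
  obtain ⟨ψ, H, G, hH, lH, hG, lG, -, hψ⟩ := hh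
  have dH : Differentiable ℝ H := hH.differentiable one_ne_zero
  have dG : Differentiable ℝ G := hG.differentiable one_ne_zero
  have key : ∀ z, torusProj n (F₂ (H z)) = torusProj n (H (F₁ z)) := fun z => by
    rw [h₂, lH, lH, h₁]
    exact (congrFun hconj _).symm
  rintro κ ⟨x, ⟨l, hl⟩, v, hv, hκ⟩
  have e1 : (fderiv ℝ F₂ (H x)).comp (fderiv ℝ H x) =
      (fderiv ℝ H (F₁ x)).comp (fderiv ℝ F₁ x) :=
    fderiv_eq_of_torusProj_eq (HasFDerivAt.comp (g := F₂) x (d₂ _).hasFDerivAt (dH x).hasFDerivAt)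
      (HasFDerivAt.comp (g := H) x (dH _).hasFDerivAt (d₁ x).hasFDerivAt) key
  have e2 : fderiv ℝ H (F₁ x) = fderiv ℝ H x := by
    rw [hl]
    have h3 : HasFDerivAt (fun z => H (z + intVec l)) (fderiv ℝ H (x + intVec l)) x := by
      have := HasFDerivAt.comp (g := H) x (dH (x + intVec l)).hasFDerivAt
        ((hasFDerivAt_id x).add_const (intVec l))
      rwa [ContinuousLinearMap.comp_id] at this
    exact fderiv_eq_of_torusProj_eq h3 (dH x).hasFDerivAt fun z => by rw [lH, lH, torusProj_add]
  have e3 : (fderiv ℝ G (H x)).comp (fderiv ℝ H x) = ContinuousLinearMap.id ℝ _ :=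
    fderiv_eq_of_torusProj_eq (HasFDerivAt.comp (g := G) x (dG _).hasFDerivAt (dH x).hasFDerivAt)
      (hasFDerivAt_id x) fun z => by
        rw [Function.comp, lG, lH]
        exact congrFun hψ _
  refine ⟨H x, ?_, fderiv ℝ H x v, fun h0 => hv ?_, ?_⟩
  · refine torusProj_eq_iff.1 ?_
    rw [key, hl, lH, lH, torusProj_add]
  · have := congrArg (fun T => T v) e3
    simp only [ContinuousLinearMap.comp_apply, h0, map_zero] at this
    exact this.symm
  · have := congrArg (fun T => T v) e1
    rw [e2] at this
    simp only [ContinuousLinearMap.comp_apply, hκ, map_smul] at this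
    exact this

section Hyperbolic

/-- An elementary matrix. -/
def elementary {i j : Fin n} (h : i ≠ j) : Matrix.SpecialLinearGroup (Fin n) ℤ :=
  ⟨Matrix.transvection i j 1, Matrix.det_transvection_of_ne i j h 1⟩

theorem linMap_elementary {i j : Fin n} (h : i ≠ j) (v : Fin n → ℝ) (k : Fin n) :
    linMap (elementary h) v k = v k + if k = i then v j else 0 := by
  have : (Matrix.transvection i j (1 : ℤ)).map (Int.cast : ℤ → ℝ) = Matrix.transvection i j 1 := by
    ext p q
    simp only [Matrix.transvection, Matrix.map_apply, Matrix.add_apply, Matrix.one_apply,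
      Matrix.single_apply]
    push_cast
    split_ifs <;> simp
  rw [linMap_apply, elementary, this, Matrix.transvection, Matrix.add_mulVec, Matrix.one_mulVec,
    Pi.add_apply]
  congr 1
  simp only [Matrix.mulVec, dotProduct, Matrix.single_apply, ite_mul, one_mul, zero_mul]
  by_cases hk : k = i
  · simp [hk]
  · simp [hk, Ne.symm hk]

/-- An integer matrix acting on the span of two coordinates as `!![2, 1; 1, 1]`, and trivially on
the other ones. -/
def catMatrix {i j : Fin n} (h : i ≠ j) : Matrix.SpecialLinearGroup (Fin n) ℤ :=
  elementary h * elementary h.symm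

theorem linMap_catMatrix {i j : Fin n} (h : i ≠ j) (v : Fin n → ℝ) :
    linMap (catMatrix h) v i = 2 * v i + v j ∧ linMap (catMatrix h) v j = v i + v j ∧
      ∀ k, k ≠ i → k ≠ j → linMap (catMatrix h) v k = v k := by
  simp only [catMatrix, linMap_mul, ContinuousLinearMap.comp_apply, linMap_elementary]
  refine ⟨?_, ?_, fun k h1 h2 => ?_⟩
  · simp [h]; ring
  · simp [h.symm]; ring
  · simp [h1, h2]

theorem linMap_pow_functional {g : Matrix.SpecialLinearGroup (Fin n) ℤ} {f : (Fin n → ℝ) → ℝ}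
    {s : ℝ} (h : ∀ v, f (linMap g v) = s * f v) (m : ℕ) (v : Fin n → ℝ) :
    f (linMap (g ^ m) v) = s ^ m * f v := by
  induction m with
  | zero => rw [pow_zero, linMap_one]; simp
  | succ m ih => rw [pow_succ', linMap_mul, ContinuousLinearMap.comp_apply, h, ih, pow_succ']; ring

theorem linMap_pow_eigenvector {g : Matrix.SpecialLinearGroup (Fin n) ℤ} {v : Fin n → ℝ}
    {s : ℝ} (h : linMap g v = s • v) (m : ℕ) : linMap (g ^ m) v = s ^ m • v := by
  induction m with
  | zero => rw [pow_zero, linMap_one]; simp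
  | succ m ih =>
    rw [pow_succ', linMap_mul, ContinuousLinearMap.comp_apply, ih, map_smul, h, smul_smul, pow_succ]

theorem catMatrix_functional {i j : Fin n} (h : i ≠ j) {s : ℝ} (hs : s ^ 2 = s + 1)
    (v : Fin n → ℝ) : s * linMap (catMatrix h) v i + linMap (catMatrix h) v j =
      s ^ 2 * (s * v i + v j) := by
  obtain ⟨h1, h2, -⟩ := linMap_catMatrix h v
  rw [h1, h2]
  linear_combination (-(s * v i) - v i - v j) * hs

theorem exists_hyperbolic (hn : 2 ≤ n) (Γ : Subgroup (Matrix.SpecialLinearGroup (Fin n) ℤ))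
    [Γ.FiniteIndex] : ∃ γ ∈ Γ, ∃ Λ : ℝ, 1 < Λ ∧ IsEigenvalue (linMap γ) Λ ∧
      ∀ κ, IsEigenvalue (linMap γ) κ → ∃ e : ℝ, (e = 1 ∨ e = 0 ∨ e = -1) ∧ κ = Λ ^ e := by
  have hij : (⟨0, by omega⟩ : Fin n) ≠ ⟨1, by omega⟩ := by simp
  set i : Fin n := ⟨0, by omega⟩
  set j : Fin n := ⟨1, by omega⟩
  obtain ⟨m, hm, -, hmem⟩ := Subgroup.exists_pow_mem_of_index_ne_zero
    (Subgroup.FiniteIndex.index_ne_zero (H := Γ)) (catMatrix hij)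
  have hφ := Real.goldenRatio_sq
  have hψ := Real.goldenConj_sq
  have hφ1 := Real.one_lt_goldenRatio
  have hprod := Real.goldenRatio_mul_goldenConj
  refine ⟨_, hmem, (Real.goldenRatio ^ 2) ^ m, one_lt_pow₀ (by nlinarith) hm.ne', ?_, ?_⟩
  · have hv : linMap (catMatrix hij) (fun k => if k = i then Real.goldenRatio else
        if k = j then 1 else 0) = Real.goldenRatio ^ 2 • (fun k => if k = i then Real.goldenRatio else
        if k = j then 1 else 0) := by
      obtain ⟨h1, h2, h3⟩ := linMap_catMatrix hij (fun k => if k = i then Real.goldenRatio else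
        if k = j then 1 else 0)
      ext k
      by_cases hk : k = i
      · subst hk
        rw [h1]
        simp only [Pi.smul_apply, smul_eq_mul, if_true, if_neg hij.symm]
        linear_combination (-Real.goldenRatio - 1) * hφ
      by_cases hk' : k = j
      · subst hk'
        rw [h2]
        simp only [Pi.smul_apply, smul_eq_mul, if_true, if_neg hij.symm]
        linear_combination - hφ
      · rw [h3 k hk hk']
        simp [hk, hk']
    refine ⟨_, fun h0 => ?_, linMap_pow_eigenvector hv m⟩
    have := congrFun h0 i
    simp only [if_true, Pi.zero_apply] at this
    linarith
  · rintro κ ⟨v, hv, hκ⟩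
    have key : ∀ (f : (Fin n → ℝ) → ℝ) (s : ℝ), (∀ c : ℝ, ∀ v, f (c • v) = c * f v) →
        (∀ v, f (linMap (catMatrix hij) v) = s * f v) → f v ≠ 0 → κ = s ^ m := by
      intro f s hf h hne
      have := linMap_pow_functional h m v
      rw [hκ, hf] at this
      exact mul_right_cancel₀ hne this
    by_cases h1 : Real.goldenRatio * v i + v j = 0
    · by_cases h2 : Real.goldenConj * v i + v j = 0
      · have hvi : v i = 0 := by
          have : (Real.goldenRatio - Real.goldenConj) * v i = 0 := by linear_combination h1 - h2
          refine (mul_eq_zero.1 this).resolve_left ?_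
          linarith [Real.goldenConj_neg]
        have hvj : v j = 0 := by rw [hvi] at h1; linarith
        obtain ⟨k, hk⟩ := Function.ne_iff.1 hv
        have hki : k ≠ i := by rintro rfl; exact hk hvi
        have hkj : k ≠ j := by rintro rfl; exact hk hvj
        refine ⟨0, Or.inr (Or.inl rfl), ?_⟩
        rw [Real.rpow_zero, key (fun v => v k) 1 (fun _ _ => rfl)
          (fun v => by rw [(linMap_catMatrix hij v).2.2 k hki hkj, one_mul]) hk, one_pow]
      · refine ⟨-1, Or.inr (Or.inr rfl), ?_⟩
        rw [key (fun v => Real.goldenConj * v i + v j) _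
          (fun c v => by simp only [Pi.smul_apply, smul_eq_mul]; ring)
          (catMatrix_functional hij hψ) h2, Real.rpow_neg_one]
        refine eq_inv_of_mul_eq_one_left ?_
        rw [← mul_pow, ← mul_pow, mul_comm, hprod]
        norm_num
    · refine ⟨1, Or.inl rfl, ?_⟩
      rw [key (fun v => Real.goldenRatio * v i + v j) _
        (fun c v => by simp only [Pi.smul_apply, smul_eq_mul]; ring)
        (catMatrix_functional hij hφ) h1, Real.rpow_one]

end Hyperbolic


/-- The exponent of the blow-up is determined by the fixed point spectra. -/
theorem exponent_eq_of_fixedSpectrum_subset {b₁ b₂ : ℝ} (B₁ : Blowup n b₁) (B₂ : Blowup n b₂)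
    {g : Matrix.SpecialLinearGroup (Fin n) ℤ} {Λ : ℝ} (hΛ : 1 < Λ)
    (hg : IsEigenvalue (linMap g) Λ) (hg' : ∀ κ, IsEigenvalue (linMap g) κ →
      ∃ e : ℝ, (e = 1 ∨ e = 0 ∨ e = -1) ∧ κ = Λ ^ e)
    (h : fixedSpectrum (B₁.F g) ⊆ fixedSpectrum (B₂.F g)) : b₁ = b₂ := by
  have h1 := B₁.D.hb
  have h2 := B₂.D.hb
  have hΛ0 : 0 < Λ := by linarith
  have inj : ∀ {s t : ℝ}, Λ ^ s = Λ ^ t → s = t := fun {s t} hst =>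
    (Real.rpow_right_inj hΛ0 hΛ.ne').1 hst
  have heig := B₂.fixedSpectrum_subset g (h (B₁.rpow_mem_fixedSpectrum g hΛ0 hg))
  have h0 : (1 : ℝ) = Λ ^ (0 : ℝ) := (Real.rpow_zero _).symm
  rcases heig with he | ⟨μ, -, hμ, hκ⟩
  · obtain ⟨e, he, h3⟩ := hg' _ he
    have := inj h3
    rcases he with rfl | rfl | rfl <;> linarith
  · obtain ⟨e, he, rfl⟩ := hg' _ hμ
    rcases hκ with hκ | hκ | hκ | hκ
    · obtain ⟨e', he', h3⟩ := hg' _ hκ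
      rw [← Real.rpow_add hΛ0] at h3
      have := inj h3
      rcases he with rfl | rfl | rfl <;> rcases he' with rfl | rfl | rfl <;> linarith
    · rw [h0] at hκ
      have := inj hκ
      linarith
    · rw [← Real.rpow_mul hΛ0.le] at hκ
      have := inj hκ
      rcases he with rfl | rfl | rfl <;> linarith
    · rw [← Real.rpow_mul hΛ0.le] at hκ
      have := inj hκ
      rcases he with rfl | rfl | rfl <;> linarith

section Action
variable {b : ℝ} (B : Blowup n b)

theorem isTorusLift_F (g : Matrix.SpecialLinearGroup (Fin n) ℤ) :
    IsTorusLift n (descend (B.F g)) (B.F g) :=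
  isTorusLift_descend fun x l => ⟨_, B.F_add g x l⟩

theorem descend_one (t : Torus n) : descend (B.F 1) t = t := by
  obtain ⟨x, rfl⟩ := torusProj_surjective t
  rw [← isTorusLift_F, B.F_one]

theorem descend_mul (g h : Matrix.SpecialLinearGroup (Fin n) ℤ) (t : Torus n) :
    descend (B.F (g * h)) t = descend (B.F g) (descend (B.F h) t) := by
  obtain ⟨x, rfl⟩ := torusProj_surjective t
  rw [← isTorusLift_F, ← isTorusLift_F, ← isTorusLift_F, B.F_mul]

theorem isCrTorusDiffeo_descend (r : WithTop ℕ∞) (g : Matrix.SpecialLinearGroup (Fin n) ℤ) :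
    IsCrTorusDiffeo n r (descend (B.F g)) := by
  refine ⟨descend (B.F g⁻¹), B.F g, B.F g⁻¹, (B.contDiff_F g).of_le le_top, isTorusLift_F B g,
    (B.contDiff_F _).of_le le_top, isTorusLift_F B _, funext fun t => ?_, funext fun t => ?_⟩
  · rw [Function.comp, ← descend_mul, mul_inv_cancel, descend_one]; rfl
  · rw [Function.comp, ← descend_mul, inv_mul_cancel, descend_one]; rfl

end Action

theorem areC1Conjugate_refl {G : Type*} (ρ : G → Torus n → Torus n) : AreC1Conjugate n ρ ρ :=
  ⟨id, ⟨id, id, id, contDiff_id, fun _ => rfl, contDiff_id, fun _ => rfl, rfl, rfl⟩, fun _ => rfl⟩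

end TorusBlowup

/-- Let `n ≥ 3` and let `Γ ≤ SL(n,ℤ)` be a finite-index subgroup.  Then for
every `r` with `2 < r ≤ ∞`, and also for `r = ω` (real-analytic), there exists an uncountable
family of `C^r` actions of `Γ` on the `n`-torus `𝕋ⁿ = ℝⁿ/ℤⁿ` such that no two distinct actions
in the family are `C¹`-conjugate.  (The smoothness degree `r` ranges over `WithTop ℕ∞`, whose
top element is `ω`; the hypothesis `2 < r` thus covers exactly the degrees
`r ∈ {3, 4, …, ∞, ω}`.) -/
theorem uncountably_many_nonconjugate_lattice_actions_on_torus
    (n : ℕ) (hn : 3 ≤ n)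
    (Γ : Subgroup (Matrix.SpecialLinearGroup (Fin n) ℤ)) [Γ.FiniteIndex]
    (r : WithTop ℕ∞) (hr : 2 < r) :
    ∃ S : Set (Γ → Torus n → Torus n),
      ¬ S.Countable ∧
      (∀ ρ ∈ S, (∀ γ : Γ, IsCrTorusDiffeo n r (ρ γ)) ∧
        (∀ x, ρ 1 x = x) ∧ (∀ γ₁ γ₂ : Γ, ∀ x, ρ (γ₁ * γ₂) x = ρ γ₁ (ρ γ₂ x))) ∧
      (∀ ρ₁ ∈ S, ∀ ρ₂ ∈ S, ρ₁ ≠ ρ₂ → ¬ AreC1Conjugate n ρ₁ ρ₂) := by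
  have hB : ∀ b : Set.Ioo (1 : ℝ) 3, Nonempty (TorusBlowup.Blowup n b) := fun b =>
    TorusBlowup.exists_blowup n b.2.1 b.2.2
  let B : ∀ b : Set.Ioo (1 : ℝ) 3, TorusBlowup.Blowup n b := fun b => (hB b).some
  let ρ : Set.Ioo (1 : ℝ) 3 → Γ → Torus n → Torus n := fun b γ => TorusBlowup.descend ((B b).F γ)
  obtain ⟨γ, hγ, Λ, hΛ, h1, h2⟩ := TorusBlowup.exists_hyperbolic (by omega) Γ
  have key : ∀ b₁ b₂, AreC1Conjugate n (ρ b₁) (ρ b₂) → b₁ = b₂ := by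
    rintro b₁ b₂ ⟨h, hh, hconj⟩
    refine Subtype.ext (TorusBlowup.exponent_eq_of_fixedSpectrum_subset (B b₁) (B b₂) hΛ h1 h2 ?_)
    exact TorusBlowup.fixedSpectrum_subset_of_conj (TorusBlowup.isTorusLift_F _ γ)
      (TorusBlowup.isTorusLift_F _ γ) (((B b₁).contDiff_F γ).differentiable (by simp))
      (((B b₂).contDiff_F γ).differentiable (by simp)) hh (hconj ⟨γ, hγ⟩)
  have hinj : Function.Injective ρ := fun b₁ b₂ h =>
    key b₁ b₂ (h ▸ TorusBlowup.areC1Conjugate_refl _)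
  refine ⟨Set.range ρ, fun hc => ?_, ?_, ?_⟩
  · have h3 : Countable (Set.Ioo (1 : ℝ) 3) := by
      have := hc.to_subtype
      exact (Set.rangeFactorization_injective.2 hinj).countable
    have := Cardinal.Real.Ioo_countable_iff.1 (Set.countable_coe_iff.1 h3)
    linarith
  · rintro _ ⟨b, rfl⟩
    exact ⟨fun γ => TorusBlowup.isCrTorusDiffeo_descend (B b) r γ,
      fun x => TorusBlowup.descend_one (B b) x,
      fun γ₁ γ₂ x => TorusBlowup.descend_mul (B b) γ₁ γ₂ x⟩
  · rintro _ ⟨b₁, rfl⟩ _ ⟨b₂, rfl⟩ hne hconj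
    exact hne (congrArg ρ (key b₁ b₂ hconj))
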